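/- Let n ≥ 3, a = (a_1,…,a_n) ∈ ℂ^n and a' = (a'_1,…,a'_{n−2}) ∈ ℂ^{n−2} with every a_j and a'_k purely imaginary, and let s ∈ ℂ with Re(s) > 0 be such that the double integral defining I^∨_{n,n−2;a,a'}(s) converges absolutely. Then I^∨_{n,n−2;a,a'}(s) = [∏_{1≤j≤n} ∏_{1≤k≤n−2} Γ_ℝ(s−a_j−a'_k)] · (1/(4πi))·∫_{w} [∏_{j=1}^{n} Γ_ℝ(w−a_j) / ∏_{j=1}^{n−2} Γ_ℝ(1−s+w+a'_j)] dw. -/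

import Mathlib

open MeasureTheory Complex

noncomputable section

/-- `Γ_ℝ(s) = π^{-s/2} Γ(s/2)`. -/
def GammaR (s : ℂ) : ℂ := (Real.pi : ℂ) ^ (-s / 2) * Complex.Gamma (s / 2)

/-- Modified Bessel function of the second kind, via its integral representation. -/
def BesselK (ν : ℂ) (y : ℝ) : ℂ :=
  (1 / 2) * ∫ t in Set.Ioi (0 : ℝ),
    Complex.exp (-((y : ℂ) / 2) * ((t : ℂ) + 1 / (t : ℂ))) * (t : ℂ) ^ ν / (t : ℂ)

/-- Extend a finite real tuple to `ℕ`, defaulting to `1`. -/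
def extR {k : ℕ} (t : Fin k → ℝ) : ℕ → ℝ := fun i => if h : i < k then t ⟨i, h⟩ else 1

/-- Extend a finite real tuple to `ℕ`, defaulting to `0`. -/
def extR0 {k : ℕ} (t : Fin k → ℝ) : ℕ → ℝ := fun i => if h : i < k then t ⟨i, h⟩ else 0

/-- The positive orthant. -/
def posSet (k : ℕ) : Set (Fin k → ℝ) := {t | ∀ j, 0 < t j}

/-- `|a| = a_1 + ⋯ + a_n` (0-based indexing). -/
def sumA (n : ℕ) (a : ℕ → ℂ) : ℂ := ∑ j ∈ Finset.range n, a j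

/-- `ã_j = a_{j+1} + a_1/(n-1)` (0-based indexing). -/
def tildeA (n : ℕ) (a : ℕ → ℂ) : ℕ → ℂ := fun j => a (j + 1) + a 0 / ((n : ℂ) - 1)

/-- The normalized radial part `Ŵ^A_{n,a}` of the class one `GL_n(ℝ)` Whittaker function,
as a function of `(y_1,…,y_{n-1})` (0-based indexing). -/
def WhittAr : ℕ → (ℕ → ℂ) → (ℕ → ℝ) → ℂ
  | 0, _, _ => 1
  | 1, _, _ => 1
  | 2, a, y => 2 * ((y 0 : ℂ) ^ ((a 0 + a 1) / 2)) *
      BesselK ((a 0 - a 1) / 2) (2 * Real.pi * y 0)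
  | (n + 3), a, y =>
      ∫ t in posSet (n + 2),
        WhittAr (n + 2) (tildeA (n + 3) a)
            (fun j => y (j + 1) * Real.sqrt (extR t (j + 1) / extR t j)) *
          (∏ j ∈ Finset.range (n + 2),
            Complex.exp (((-(Real.pi * y j) ^ 2 * extR t j - 1 / extR t j : ℝ) : ℂ)) *
              ((Real.pi * y j : ℝ) : ℂ) ^ ((((n + 2 - j : ℕ) : ℂ) * a 0) / ((n + 2 : ℕ) : ℂ)) *
              ((extR t j : ℝ) : ℂ) ^ ((((n + 3 : ℕ) : ℂ) * a 0) / (2 * ((n + 2 : ℕ) : ℂ)))) *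
          ((Real.pi * extR t (n + 1) : ℝ) : ℂ) ^ (-(sumA (n + 3) a) / 2) *
          (∏ j ∈ Finset.range (n + 2), ((extR t j : ℝ) : ℂ))⁻¹

/-- `Ŵ^A_{n,a}` as a function of the full tuple `(y_1,…,y_n)`. -/
def WhittAhat (n : ℕ) (a : ℕ → ℂ) (y : ℕ → ℝ) : ℂ :=
  ((y (n - 1) : ℝ) : ℂ) ^ sumA n a * WhittAr n a y

/-- The Mellin transform `U_{n,a}` (0-based: `s j` stands for `s_{j+1}`). -/
def Ufun (n : ℕ) (a : ℕ → ℂ) (s : ℕ → ℂ) : ℂ :=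
  ∫ y in posSet (n - 1),
    WhittAr n a (extR y) *
      ∏ j ∈ Finset.range (n - 1), ((extR y j : ℝ) : ℂ) ^ s j / ((extR y j : ℝ) : ℂ)

/-- The normalized radial part `Ŵ^B_{n,b}` of the class one `SO_{2n+1}(ℝ)` Whittaker function. -/
def WhittBr : ℕ → (ℕ → ℂ) → (ℕ → ℝ) → ℂ
  | 0, _, _ => 1
  | 1, b, y => 2 * BesselK (b 0 / 2) (2 * Real.pi * y 0)
  | (n + 2), b, y =>
      ∫ p in (posSet (n + 2) ×ˢ posSet (n + 1)),
        WhittBr (n + 1) b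
            (fun j =>
              if j < n then
                y (j + 1) *
                  Real.sqrt (extR p.1 (j + 1) * extR p.2 (j + 1) /
                    (extR p.1 (j + 2) * extR p.2 j))
              else y (n + 1) * Real.sqrt (extR p.1 (n + 1) / extR p.2 n)) *
          (∏ j ∈ Finset.range (n + 2),
            Complex.exp (((-(Real.pi * y j) ^ 2 * extR p.1 j - 1 / extR p.1 j : ℝ) : ℂ)) *
              ((Real.pi * y j : ℝ) : ℂ) ^ b (n + 1)) *
          (∏ j ∈ Finset.range (n + 1),
            Complex.exp (((-(Real.pi * y j) ^ 2 * (extR p.1 j / extR p.1 (j + 1)) * extR p.2 j -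
                  1 / extR p.2 j : ℝ) : ℂ)) *
              ((extR p.1 (j + 1) * extR p.2 j : ℝ) : ℂ) ^ (b (n + 1) / 2)) *
          ((extR p.1 0 : ℝ) : ℂ) ^ b (n + 1) *
          (∏ j ∈ Finset.range (n + 1), ((extR p.2 j : ℝ) : ℂ))⁻¹ *
          (∏ j ∈ Finset.range (n + 2), ((extR p.1 j : ℝ) : ℂ))⁻¹

/-- The Mellin transform `V_{n,b}` (0-based: `s j` stands for `s_{j+1}`). -/
def Vfun (n : ℕ) (b : ℕ → ℂ) (s : ℕ → ℂ) : ℂ :=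
  ∫ y in posSet n,
    WhittBr n b (extR y) *
      ∏ j ∈ Finset.range n, ((extR y j : ℝ) : ℂ) ^ s j / ((extR y j : ℝ) : ℂ)

/-- Integral over the vertical line `Re z = c`, i.e. `i·∫_ℝ f(c+it) dt`. -/
def VInt (c : ℝ) (f : ℂ → ℂ) : ℂ := Complex.I * ∫ t : ℝ, f (c + t * Complex.I)

/-- Iterated integral over `k` vertical lines with abscissas `c 0, …, c (k-1)`;
the integrand is fed the contour points as a 0-based sequence. -/
def VIntK (k : ℕ) (c : ℕ → ℝ) (f : (ℕ → ℂ) → ℂ) : ℂ :=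
  Complex.I ^ k * ∫ t : Fin k → ℝ, f (fun i => (c i : ℂ) + (extR0 t i : ℝ) * Complex.I)

/-- `g = u · diag d · k` is an Iwasawa decomposition of `g`: `u` is upper
triangular unipotent, `d` has positive entries, and `k` is orthogonal. -/
def IsIwasawa (n : ℕ) (g u : Matrix (Fin n) (Fin n) ℝ) (d : Fin n → ℝ)
    (k : Matrix (Fin n) (Fin n) ℝ) : Prop :=
  (∀ i, u i i = 1) ∧ (∀ i j : Fin n, j < i → u i j = 0) ∧ (∀ i, 0 < d i) ∧
    k.transpose * k = 1 ∧ g = u * Matrix.diagonal d * k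

open scoped Classical

/-- The class one Whittaker function `W^A_{n,a}` on `GL_n(ℝ)`, defined through
the Iwasawa decomposition `g = u·d·k`, the character `ψ(u)`, the ρ-shift, and
the radial part `Ŵ^A_{n,a}`. -/
def WhittAGrp (n : ℕ) (a : ℕ → ℂ) (g : Matrix (Fin n) (Fin n) ℝ) : ℂ :=
  if h : ∃ q : Matrix (Fin n) (Fin n) ℝ × (Fin n → ℝ) × Matrix (Fin n) (Fin n) ℝ,
      IsIwasawa n g q.1 q.2.1 q.2.2 then
    let q := Classical.choose h
    let y : ℕ → ℝ := fun j =>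
      if h2 : j + 1 < n then q.2.1 ⟨j, Nat.lt_of_succ_lt h2⟩ / q.2.1 ⟨j + 1, h2⟩
      else if h3 : j < n then q.2.1 ⟨j, h3⟩ else 1
    Complex.exp (2 * (Real.pi : ℂ) * Complex.I *
        (((∑ j ∈ Finset.range (n - 1),
            if h4 : j + 1 < n then q.1 ⟨j, Nat.lt_of_succ_lt h4⟩ ⟨j + 1, h4⟩ else 0) : ℝ) : ℂ)) *
      (∏ j ∈ Finset.range (n - 1),
        ((y j : ℝ) : ℂ) ^ ((((j + 1) * (n - (j + 1)) : ℕ) : ℂ) / 2)) *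
      WhittAhat n a y
  else 0

/-- The antidiagonal permutation matrix `w_N`. -/
def wMat (N : ℕ) : Matrix (Fin N) (Fin N) ℝ :=
  Matrix.of fun i j => if (i : ℕ) + (j : ℕ) = N - 1 then 1 else 0

/-- The torus element `α[y_1,…,y_m] = diag(y_1⋯y_m, y_2⋯y_m, …, y_m)`. -/
def alphaMat (m : ℕ) (y : ℕ → ℝ) : Matrix (Fin m) (Fin m) ℝ :=
  Matrix.of fun i j => if i = j then ∏ p ∈ Finset.Ico (i : ℕ) m, y p else 0

/-- The matrix `M(x;y)`: upper-left `(n-2) × (n-2)` block `α[y_1,…,y_{n-2}]`,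
row `n-1` equal to `(x_1,…,x_{n-2},1,0)`, and `(n,n)` entry `1`. -/
def MmatX (n : ℕ) (x y : ℕ → ℝ) : Matrix (Fin n) (Fin n) ℝ :=
  Matrix.of fun i j =>
    if (i : ℕ) < n - 2 ∧ (i : ℕ) = (j : ℕ) then ∏ p ∈ Finset.Ico (i : ℕ) (n - 2), y p
    else if (i : ℕ) = n - 2 ∧ (j : ℕ) < n - 2 then x j
    else if (i : ℕ) = n - 2 ∧ (j : ℕ) = n - 2 then 1
    else if (i : ℕ) = n - 1 ∧ (j : ℕ) = n - 1 then 1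
    else 0

/-- The integrand of the dual archimedean `GL_n × GL_{n-2}` zeta integral
`I^∨_{n,n-2;a,a'}(s)`. -/
def IcheckIntegrand (n : ℕ) (a a' : ℕ → ℂ) (s : ℂ)
    (q : (Fin (n - 2) → ℝ) × (Fin (n - 2) → ℝ)) : ℂ :=
  WhittAGrp n a (wMat n * ((MmatX n (extR0 q.2) (extR q.1)).transpose)⁻¹) *
    WhittAGrp (n - 2) a' (wMat (n - 2) * ((alphaMat (n - 2) (extR q.1)).transpose)⁻¹) *
    ∏ j ∈ Finset.range (n - 2),
      ((extR q.1 j : ℝ) : ℂ) ^ (((j + 1 : ℕ) : ℂ) * (s - (n : ℂ) + ((j : ℕ) : ℂ) + 2)) /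
        ((extR q.1 j : ℝ) : ℂ)

/-- The dual archimedean `GL_n × GL_{n-2}` zeta integral `I^∨_{n,n-2;a,a'}(s)`:
the first component of `q` is `y ∈ (0,∞)^{n-2}`, the second is `x ∈ ℝ^{n-2}`. -/
def Icheck (n : ℕ) (a a' : ℕ → ℂ) (s : ℂ) : ℂ :=
  (2 : ℂ) ^ (n - 2) *
    ∫ q in (posSet (n - 2) ×ˢ (Set.univ : Set (Fin (n - 2) → ℝ))),
      IcheckIntegrand n a a' s q

/-! ### One-dimensional kernels -/

theorem integral_Ioi_eq_integral_comp_exp {F : Type*} [NormedAddCommGroup F] [NormedSpace ℝ F]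
    (f : ℝ → F) : ∫ t in Set.Ioi (0 : ℝ), f t = ∫ y : ℝ, Real.exp y • f (Real.exp y) := by
  have h := integral_image_eq_integral_abs_deriv_smul (s := Set.univ) (f := Real.exp)
    (f' := Real.exp) MeasurableSet.univ
    (fun x _ => (Real.hasDerivAt_exp x).hasDerivWithinAt) Real.exp_injective.injOn f
  rw [Set.image_univ, Real.range_exp] at h
  simpa [abs_of_pos (Real.exp_pos _)] using h

theorem integrableOn_Ioi_iff_integrable_comp_exp {F : Type*} [NormedAddCommGroup F]
    [NormedSpace ℝ F] (f : ℝ → F) :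
    IntegrableOn f (Set.Ioi (0 : ℝ)) ↔ Integrable fun y : ℝ => Real.exp y • f (Real.exp y) := by
  have h := integrableOn_image_iff_integrableOn_abs_deriv_smul (s := Set.univ) (f := Real.exp)
    (f' := Real.exp) MeasurableSet.univ
    (fun x _ => (Real.hasDerivAt_exp x).hasDerivWithinAt) Real.exp_injective.injOn f
  rw [Set.image_univ, Real.range_exp] at h
  simpa [abs_of_pos (Real.exp_pos _)] using h

/-- The integrand of a two-sided exponential (Bessel type) integral. -/
def expKer (α β : ℝ) (κ : ℂ) (y : ℝ) : ℂ :=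
  cexp (-((α * Real.exp (-y) + β * Real.exp y : ℝ) : ℂ) + κ * y)

theorem continuous_expKer (α β : ℝ) (κ : ℂ) : Continuous (expKer α β κ) := by
  unfold expKer; fun_prop

theorem norm_expKer (α β : ℝ) (κ : ℂ) (y : ℝ) :
    ‖expKer α β κ y‖ = Real.exp (-(α * Real.exp (-y) + β * Real.exp y) + κ.re * y) := by
  rw [expKer, Complex.norm_exp]
  congr 1
  simp only [add_re, neg_re, ofReal_re, mul_re, ofReal_im, mul_zero, sub_zero]

theorem ofReal_exp_cpow (y : ℝ) (κ : ℂ) : ((Real.exp y : ℝ) : ℂ) ^ κ = cexp (κ * y) := by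
  rw [Complex.cpow_def_of_ne_zero (by exact_mod_cast (Real.exp_pos y).ne'),
    ← Complex.ofReal_log (Real.exp_pos y).le, Real.log_exp, mul_comm]

theorem expKer_zero_left (β : ℝ) (κ : ℂ) (y : ℝ) :
    expKer 0 β κ y = Real.exp y • (((Real.exp y : ℝ) : ℂ) ^ (κ - 1) *
      cexp (-(β * ((Real.exp y : ℝ) : ℂ)))) := by
  rw [expKer, Complex.real_smul, ofReal_exp_cpow, ofReal_exp, ← Complex.exp_add,
    ← Complex.exp_add]
  congr 1
  push_cast
  ring

theorem expKer_neg (α β : ℝ) (κ : ℂ) (y : ℝ) : expKer α β κ (-y) = expKer β α (-κ) y := by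
  unfold expKer
  congr 1
  push_cast
  rw [neg_neg]
  ring

theorem integral_expKer_zero_left {β : ℝ} (hβ : 0 < β) {κ : ℂ} (hκ : 0 < κ.re) :
    ∫ y, expKer 0 β κ y = cexp (-(κ * Real.log β)) * Complex.Gamma κ := by
  have h := Complex.integral_cpow_mul_exp_neg_mul_Ioi (a := κ) (r := β) hκ (by simpa using hβ)
  rw [integral_Ioi_eq_integral_comp_exp] at h
  simp_rw [expKer_zero_left]
  rw [h, one_div, ← ofReal_inv, ← Real.exp_log (inv_pos.2 hβ), ofReal_exp_cpow, Real.log_inv]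
  simp

theorem norm_expKer_zero_left (β : ℝ) (κ : ℂ) (y : ℝ) :
    ‖expKer 0 β κ y‖ = Real.exp y • ((Real.exp y) ^ (κ.re - 1) *
      Real.exp (-(β * Real.exp y))) := by
  rw [norm_expKer, smul_eq_mul, ← Real.exp_mul, ← Real.exp_add, ← Real.exp_add]
  congr 1
  ring

theorem integral_norm_expKer_zero_left {β : ℝ} (hβ : 0 < β) {κ : ℂ} (hκ : 0 < κ.re) :
    ∫ y, ‖expKer 0 β κ y‖ = Real.exp (-(κ.re * Real.log β)) * Real.Gamma κ.re := by
  have h := Real.integral_rpow_mul_exp_neg_mul_Ioi (a := κ.re) (r := β) hκ hβ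
  rw [integral_Ioi_eq_integral_comp_exp] at h
  simp_rw [norm_expKer_zero_left]
  rw [h, one_div, Real.inv_rpow hβ.le, ← Real.rpow_neg hβ.le, Real.rpow_def_of_pos hβ]
  congr 2
  ring

theorem integrable_expKer_zero_left {β : ℝ} (hβ : 0 < β) {κ : ℂ} (hκ : 0 < κ.re) :
    Integrable (expKer 0 β κ) := by
  rw [← integrable_norm_iff (continuous_expKer _ _ _).aestronglyMeasurable]
  have h := integrableOn_rpow_mul_exp_neg_mul_rpow (p := 1) (s := κ.re - 1) (b := β)
    (by linarith) zero_lt_one hβ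
  rw [integrableOn_Ioi_iff_integrable_comp_exp] at h
  refine h.congr (Filter.Eventually.of_forall fun y => ?_)
  simp only [norm_expKer_zero_left, Real.rpow_one, neg_mul]

theorem integrable_expKer_zero_right {α : ℝ} (hα : 0 < α) {κ : ℂ} (hκ : κ.re < 0) :
    Integrable (expKer α 0 κ) := by
  have h := (integrable_expKer_zero_left hα (κ := -κ) (by simpa using hκ)).comp_neg
  simpa only [expKer_neg, neg_neg] using h

theorem integral_expKer_zero_right {α : ℝ} (hα : 0 < α) {κ : ℂ} (hκ : κ.re < 0) :
    ∫ y, expKer α 0 κ y = cexp (κ * Real.log α) * Complex.Gamma (-κ) := by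
  rw [← integral_neg_eq_self]
  simp_rw [expKer_neg]
  rw [integral_expKer_zero_left hα (by simpa using hκ)]
  simp

theorem exp_neg_exp_le {k : ℝ} (hk : 0 ≤ k) (w : ℝ) :
    Real.exp (-Real.exp w) ≤ Real.exp (k * Real.log k - k) * Real.exp (-(k * w)) := by
  rw [← Real.exp_add, Real.exp_le_exp]
  rcases hk.eq_or_lt with rfl | hk
  · simp [(Real.exp_pos w).le]
  · have h := Real.add_one_le_exp (w - Real.log k)
    rw [Real.exp_sub, Real.exp_log hk, le_div_iff₀ hk] at h
    linarith

/-- Integrability of the exponential kernel, with a bound which is exponential in the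
logarithms of its two coefficients. -/
theorem expKer_bound (κ : ℂ) {k : ℝ} (hk : 0 ≤ k) : ∃ C : ℝ, 0 ≤ C ∧ ∀ u v β : ℝ,
    ((0 < κ.re + k ∧ β = Real.exp (-v)) ∨ (κ.re + k = 0 ∧ 0 < k ∧ 0 ≤ β)) →
    Integrable (expKer (Real.exp u) β κ) ∧
      ∫ y, ‖expKer (Real.exp u) β κ y‖ ≤ C * Real.exp (-(k * u) + (κ.re + k) * v) := by
  rcases lt_trichotomy 0 (κ.re + k) with h | h | h
  · refine ⟨Real.exp (k * Real.log k - k) * Real.Gamma (κ.re + k),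
      mul_nonneg (Real.exp_pos _).le (Real.Gamma_pos_of_pos h).le, fun u v β hβ => ?_⟩
    obtain rfl : β = Real.exp (-v) := by
      rcases hβ with h' | h'
      · exact h'.2
      · exact absurd h'.1 h.ne'
    have hre : (κ + (k : ℂ)).re = κ.re + k := by simp
    have hle : ∀ y, ‖expKer (Real.exp u) (Real.exp (-v)) κ y‖ ≤
        Real.exp (k * Real.log k - k) * Real.exp (-(k * u)) *
          ‖expKer 0 (Real.exp (-v)) (κ + k) y‖ := by
      intro y
      rw [norm_expKer, norm_expKer, hre]
      calc _ = Real.exp (-Real.exp (u - y)) *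
            Real.exp (-(Real.exp (-v) * Real.exp y) + κ.re * y) := by
            rw [sub_eq_add_neg, Real.exp_add u, ← Real.exp_add (-(_ * _))]; congr 1; ring
        _ ≤ _ := mul_le_mul_of_nonneg_right (exp_neg_exp_le hk (u - y)) (Real.exp_pos _).le
        _ = _ := by
            rw [mul_assoc, mul_assoc, ← Real.exp_add (-(k * (u - y))),
              ← Real.exp_add (-(k * u))]
            congr 2; ring
    have hi := (integrable_expKer_zero_left (Real.exp_pos (-v)) (κ := κ + k)
      (by rw [hre]; exact h)).norm.const_mul
        (Real.exp (k * Real.log k - k) * Real.exp (-(k * u)))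
    have hint : Integrable (expKer (Real.exp u) (Real.exp (-v)) κ) :=
      hi.mono' (continuous_expKer _ _ _).aestronglyMeasurable (Filter.Eventually.of_forall hle)
    refine ⟨hint, (integral_mono hint.norm hi hle).trans_eq ?_⟩
    rw [integral_const_mul, integral_norm_expKer_zero_left (Real.exp_pos _) (by rw [hre]; exact h),
      hre, Real.log_exp, Real.exp_add]
    ring_nf
  · refine ⟨Real.Gamma k, ?_, fun u v β hβ => ?_⟩
    · rcases hk.eq_or_lt with rfl | hk
      · simp
      · exact (Real.Gamma_pos_of_pos hk).le
    · obtain ⟨-, hk, hβ⟩ : (κ.re + k = 0 ∧ 0 < k ∧ 0 ≤ β) := by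
        rcases hβ with h' | h'
        · exact absurd h h'.1.ne
        · exact h'
      have hκ : κ.re < 0 := by linarith
      have hle : ∀ y, ‖expKer (Real.exp u) β κ y‖ ≤ ‖expKer (Real.exp u) 0 κ y‖ := by
        intro y
        rw [norm_expKer, norm_expKer, Real.exp_le_exp]
        have := mul_nonneg hβ (Real.exp_pos y).le
        linarith
      have hi := (integrable_expKer_zero_right (Real.exp_pos u) hκ).norm
      have hint : Integrable (expKer (Real.exp u) β κ) :=
        hi.mono' (continuous_expKer _ _ _).aestronglyMeasurable (Filter.Eventually.of_forall hle)
      refine ⟨hint, (integral_mono hint.norm hi hle).trans_eq ?_⟩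
      rw [← integral_neg_eq_self]
      simp_rw [expKer_neg]
      rw [integral_norm_expKer_zero_left (Real.exp_pos _) (by simpa using hκ), Real.log_exp, ← h]
      have : (-κ).re = k := by rw [neg_re]; linarith
      rw [this]
      ring_nf
  · refine ⟨0, le_rfl, fun u v β hβ => ?_⟩
    rcases hβ with h' | h' <;> linarith [h'.1]

/-- The reflection `y ↦ log (α / β) - y` exchanges the two ends of the kernel. -/
theorem integral_expKer_symm {u v : ℝ} (κ : ℂ) :
    ∫ y, expKer (Real.exp u) (Real.exp v) κ y =
      cexp (κ * (u - v)) * ∫ y, expKer (Real.exp u) (Real.exp v) (-κ) y := by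
  rw [← integral_sub_left_eq_self _ volume (u - v), ← integral_const_mul]
  congr 1 with y
  unfold expKer
  rw [← Complex.exp_add]
  simp only [← Real.exp_add]
  congr 1
  rw [show u + -(u - v - y) = v + y by ring, show v + (u - v - y) = u + -y by ring]
  push_cast
  ring

/-! ### Products over coordinates -/

@[simp] theorem extR0_coe {n : ℕ} (z : Fin n → ℝ) (i : Fin n) : extR0 z i = z i := by
  simp [extR0]

theorem extR0_of_lt {n : ℕ} (z : Fin n → ℝ) {i : ℕ} (h : i < n) : extR0 z i = z ⟨i, h⟩ := by
  simp [extR0, h]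

theorem extR0_of_le {n : ℕ} (z : Fin n → ℝ) {i : ℕ} (h : n ≤ i) : extR0 z i = 0 := by
  simp [extR0, h]

theorem continuous_extR0 (n : ℕ) : Continuous (extR0 : (Fin n → ℝ) → ℕ → ℝ) := by
  refine continuous_pi fun i => ?_
  by_cases h : i < n
  · simp only [extR0, h, dif_pos]; fun_prop
  · simp only [extR0, h, dif_neg, not_false_iff]; fun_prop

@[fun_prop] theorem continuous_extR0_apply (n : ℕ) (i : ℕ) :
    Continuous fun z : Fin n → ℝ => extR0 z i :=
  (continuous_apply i).comp (continuous_extR0 n)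

theorem integral_prod_extR0 {n : ℕ} (f : ℕ → ℝ → ℂ) :
    ∫ z : Fin n → ℝ, ∏ j ∈ Finset.range n, f j (extR0 z j) =
      ∏ j ∈ Finset.range n, ∫ y, f j y := by
  simp_rw [Finset.prod_range, extR0_coe]
  exact integral_fintype_prod_volume_eq_prod fun (i : Fin n) => f i

theorem integral_prod_extR0_real {n : ℕ} (f : ℕ → ℝ → ℝ) :
    ∫ z : Fin n → ℝ, ∏ j ∈ Finset.range n, f j (extR0 z j) =
      ∏ j ∈ Finset.range n, ∫ y, f j y := by
  simp_rw [Finset.prod_range, extR0_coe]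
  exact integral_fintype_prod_volume_eq_prod fun (i : Fin n) => f i

theorem integrable_prod_extR0 {n : ℕ} {f : ℕ → ℝ → ℂ} (h : ∀ j < n, Integrable (f j)) :
    Integrable fun z : Fin n → ℝ => ∏ j ∈ Finset.range n, f j (extR0 z j) := by
  simp_rw [Finset.prod_range, extR0_coe]
  exact Integrable.fintype_prod (f := fun i : Fin n => f i) (fun i => h i i.2)

theorem integrable_prod_extR0_real {n : ℕ} {f : ℕ → ℝ → ℝ} (h : ∀ j < n, Integrable (f j)) :
    Integrable fun z : Fin n → ℝ => ∏ j ∈ Finset.range n, f j (extR0 z j) := by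
  simp_rw [Finset.prod_range, extR0_coe]
  exact Integrable.fintype_prod (f := fun i : Fin n => f i) (fun i => h i i.2)

/-- A product of one-dimensional kernels. -/
def prodKer (n : ℕ) (α β : ℕ → ℝ) (κ : ℕ → ℂ) (z : ℕ → ℝ) : ℂ :=
  ∏ j ∈ Finset.range n, expKer (α j) (β j) (κ j) (z j)

theorem prodKer_eq (n : ℕ) (α β : ℕ → ℝ) (κ : ℕ → ℂ) (z : ℕ → ℝ) :
    prodKer n α β κ z = cexp (∑ j ∈ Finset.range n,
      (-((α j * Real.exp (-z j) + β j * Real.exp (z j) : ℝ) : ℂ) + κ j * z j)) := by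
  rw [Complex.exp_sum]; rfl

theorem prodKer_bound (n : ℕ) (κ : ℕ → ℂ) (k : ℕ → ℝ) (hk : ∀ j < n, 0 ≤ k j) :
    ∃ C : ℝ, 0 ≤ C ∧ ∀ u v β : ℕ → ℝ,
    (∀ j < n, (0 < (κ j).re + k j ∧ β j = Real.exp (-v j)) ∨
      ((κ j).re + k j = 0 ∧ 0 < k j ∧ 0 ≤ β j)) →
    Integrable (fun z : Fin n → ℝ => prodKer n (fun j => Real.exp (u j)) β κ (extR0 z)) ∧
      ∫ z : Fin n → ℝ, ‖prodKer n (fun j => Real.exp (u j)) β κ (extR0 z)‖ ≤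
        C * Real.exp (∑ j ∈ Finset.range n, (-(k j * u j) + ((κ j).re + k j) * v j)) := by
  have h : ∀ j, ∃ C : ℝ, 0 ≤ C ∧ (j < n → ∀ u v β : ℝ,
      ((0 < (κ j).re + k j ∧ β = Real.exp (-v)) ∨ ((κ j).re + k j = 0 ∧ 0 < k j ∧ 0 ≤ β)) →
      Integrable (expKer (Real.exp u) β (κ j)) ∧
      ∫ y, ‖expKer (Real.exp u) β (κ j) y‖ ≤
        C * Real.exp (-(k j * u) + ((κ j).re + k j) * v)) := by
    intro j
    by_cases hj : j < n
    · obtain ⟨C, h0, h1⟩ := expKer_bound (κ j) (hk j hj)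
      exact ⟨C, h0, fun _ => h1⟩
    · exact ⟨0, le_rfl, fun h => absurd h hj⟩
  choose C hC0 hC using h
  refine ⟨∏ j ∈ Finset.range n, C j, Finset.prod_nonneg fun j _ => hC0 j, fun u v β hβ => ⟨?_, ?_⟩⟩
  · exact integrable_prod_extR0 fun j hj => (hC j hj (u j) (v j) (β j) (hβ j hj)).1
  · simp_rw [prodKer, norm_prod]
    rw [integral_prod_extR0_real (fun j y => ‖expKer (Real.exp (u j)) (β j) (κ j) y‖),
      Real.exp_sum, ← Finset.prod_mul_distrib]
    refine Finset.prod_le_prod (fun j _ => integral_nonneg fun y => norm_nonneg _) fun j hj => ?_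
    have hj := Finset.mem_range.1 hj
    exact (hC j hj (u j) (v j) (β j) (hβ j hj)).2

theorem norm_prodKer_mul_exp (n : ℕ) (α β : ℕ → ℝ) (κ : ℕ → ℂ) (e z : ℕ → ℝ) :
    ‖prodKer n α β κ z‖ * Real.exp (∑ j ∈ Finset.range n, e j * z j) =
      ‖prodKer n α β (fun j => κ j + e j) z‖ := by
  simp_rw [prodKer, norm_prod, norm_expKer, Real.exp_sum]
  rw [← Finset.prod_mul_distrib]
  refine Finset.prod_congr rfl fun j _ => ?_
  rw [← Real.exp_add]
  congr 1
  simp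
  ring

/-! ### The Givental kernel and the Toda eigenfunctions -/

/-- The recursive kernel of the Givental integral representation, in logarithmic coordinates. -/
def kLam (n : ℕ) (c : ℂ) (x z : ℕ → ℝ) : ℂ :=
  cexp (c * ((∑ j ∈ Finset.range (n + 1), x j : ℝ) : ℂ)) *
    prodKer n (fun j => Real.exp (x j)) (fun j => Real.exp (-x (j + 1))) (fun _ => -c) z

/-- The kernel of the Baxter operator, in logarithmic coordinates. -/
def kQ (n : ℕ) (μ : ℂ) (x y : ℕ → ℝ) : ℂ :=
  cexp (μ * ((∑ j ∈ Finset.range n, x j : ℝ) : ℂ)) *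
    prodKer n (fun j => Real.exp (x j))
      (fun j => if j + 1 < n then Real.exp (-x (j + 1)) else 0) (fun _ => -μ) y

/-- The class one `GL_n` Whittaker function (open Toda eigenfunction) in logarithmic
coordinates. -/
def toda : ℕ → (ℕ → ℂ) → (ℕ → ℝ) → ℂ
  | 0, _, _ => 1
  | n + 1, c, x => ∫ z : Fin n → ℝ,
      kLam n (c 0) x (extR0 z) * toda n (fun j => c (j + 1)) (extR0 z)

theorem toda_zero (c : ℕ → ℂ) (x : ℕ → ℝ) : toda 0 c x = 1 := rfl

theorem toda_succ (n : ℕ) (c : ℕ → ℂ) (x : ℕ → ℝ) : toda (n + 1) c x =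
    ∫ z : Fin n → ℝ, kLam n (c 0) x (extR0 z) * toda n (fun j => c (j + 1)) (extR0 z) := rfl

theorem kLam_congr {n : ℕ} {c : ℂ} {x x' : ℕ → ℝ} (h : ∀ j < n + 1, x j = x' j) (z : ℕ → ℝ) :
    kLam n c x z = kLam n c x' z := by
  unfold kLam prodKer
  congr 1
  · rw [Finset.sum_congr rfl fun j hj => h j (Finset.mem_range.1 hj)]
  · refine Finset.prod_congr rfl fun j hj => ?_
    have := Finset.mem_range.1 hj
    beta_reduce
    rw [h j (by omega), h (j + 1) (by omega)]

theorem toda_congr {n : ℕ} {c c' : ℕ → ℂ} {x x' : ℕ → ℝ} (hc : ∀ j < n, c j = c' j)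
    (hx : ∀ j < n, x j = x' j) : toda n c x = toda n c' x' := by
  induction n generalizing c c' x x' with
  | zero => rfl
  | succ n ih =>
    simp only [toda_succ]
    congr 1 with z
    rw [hc 0 (by omega), kLam_congr hx, ih (fun j hj => hc (j + 1) (by omega)) fun _ _ => rfl]

theorem continuous_kLam (n : ℕ) (c : ℂ) :
    Continuous fun q : (ℕ → ℝ) × (ℕ → ℝ) => kLam n c q.1 q.2 := by
  unfold kLam prodKer expKer; fun_prop

theorem continuous_kQ (n : ℕ) (μ : ℂ) :
    Continuous fun q : (ℕ → ℝ) × (ℕ → ℝ) => kQ n μ q.1 q.2 := by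
  unfold kQ prodKer expKer
  refine Continuous.mul (by fun_prop) (continuous_finsetProd _ fun j _ => ?_)
  by_cases h : j + 1 < n <;> simp only [h, if_true, if_false] <;> fun_prop

theorem stronglyMeasurable_toda (n : ℕ) (c : ℕ → ℂ) : StronglyMeasurable (toda n c) := by
  induction n generalizing c with
  | zero => exact stronglyMeasurable_const
  | succ n ih =>
    have h : StronglyMeasurable (fun q : (ℕ → ℝ) × (Fin n → ℝ) =>
        kLam n (c 0) q.1 (extR0 q.2) * toda n (fun j => c (j + 1)) (extR0 q.2)) := by
      refine StronglyMeasurable.mul ?_ ?_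
      · exact ((continuous_kLam n (c 0)).comp
          (continuous_fst.prodMk ((continuous_extR0 n).comp continuous_snd))).stronglyMeasurable
      · exact (ih _).comp_measurable ((continuous_extR0 n).comp continuous_snd).measurable
    exact h.integral_prod_right

/-! ### Growth bounds -/

theorem norm_kLam_mul_exp (n : ℕ) (c : ℂ) (x e z : ℕ → ℝ) :
    ‖kLam n c x z‖ * Real.exp (∑ j ∈ Finset.range n, e j * z j) =
      Real.exp (c.re * ∑ j ∈ Finset.range (n + 1), x j) *
        ‖prodKer n (fun j => Real.exp (x j)) (fun j => Real.exp (-x (j + 1)))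
          (fun j => -c + e j) z‖ := by
  rw [kLam, norm_mul, mul_assoc, norm_prodKer_mul_exp, Complex.norm_exp, re_mul_ofReal]

theorem norm_kQ_mul_exp (n : ℕ) (μ : ℂ) (x e z : ℕ → ℝ) :
    ‖kQ n μ x z‖ * Real.exp (∑ j ∈ Finset.range n, e j * z j) =
      Real.exp (μ.re * ∑ j ∈ Finset.range n, x j) *
        ‖prodKer n (fun j => Real.exp (x j))
          (fun j => if j + 1 < n then Real.exp (-x (j + 1)) else 0) (fun j => -μ + e j) z‖ := by
  rw [kQ, norm_mul, mul_assoc, norm_prodKer_mul_exp, Complex.norm_exp, re_mul_ofReal]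

theorem stronglyMeasurable_toda_extR0 (n m : ℕ) (c : ℕ → ℂ) :
    StronglyMeasurable fun z : Fin m → ℝ => toda n c (extR0 z) :=
  (stronglyMeasurable_toda n c).comp_measurable (continuous_extR0 m).measurable

theorem continuous_kLam_right (n m : ℕ) (c : ℂ) (x : ℕ → ℝ) :
    Continuous fun z : Fin m → ℝ => kLam n c x (extR0 z) :=
  (continuous_kLam n c).comp (continuous_const.prodMk (continuous_extR0 m))

theorem continuous_kQ_right (n m : ℕ) (c : ℂ) (x : ℕ → ℝ) :
    Continuous fun z : Fin m → ℝ => kQ n c x (extR0 z) :=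
  (continuous_kQ n c).comp (continuous_const.prodMk (continuous_extR0 m))

/-- Integrating a function of exponential growth against a function dominated by a product
kernel. -/
theorem integrable_mul_of_le {n : ℕ} {f g : (Fin n → ℝ) → ℂ} {h : (Fin n → ℝ) → ℝ} {C D : ℝ}
    (hf : AEStronglyMeasurable f) (hg : AEStronglyMeasurable g) (hC : 0 ≤ C)
    (hle : ∀ z, ‖g z‖ ≤ C * h z) (hi : Integrable fun z => ‖f z‖ * h z)
    (hD : ∫ z, ‖f z‖ * h z ≤ D) :
    Integrable (fun z => f z * g z) ∧ ∫ z, ‖f z * g z‖ ≤ C * D := by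
  have hle' : ∀ z, ‖f z * g z‖ ≤ C * (‖f z‖ * h z) := fun z => by
    rw [norm_mul]
    nlinarith [hle z, norm_nonneg (f z), mul_le_mul_of_nonneg_left (hle z) (norm_nonneg (f z))]
  have hint : Integrable (fun z => f z * g z) :=
    (hi.const_mul C).mono' (hf.mul hg) (Filter.Eventually.of_forall hle')
  refine ⟨hint, (integral_mono hint.norm (hi.const_mul C) hle').trans ?_⟩
  rw [integral_const_mul]
  exact mul_le_mul_of_nonneg_left hD hC

theorem sum_shift_identity (n : ℕ) (δ : ℝ) (s s' x : ℕ → ℝ) (hs0 : s 0 = 0) (hsn : s (n + 1) = δ)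
    (hs0' : s' 0 = 0) (hsn' : s' n = 0) :
    δ * ∑ j ∈ Finset.range (n + 1), x j + ∑ j ∈ Finset.range n,
      (-((δ + s' j - s (j + 1)) * x j) + (s' (j + 1) - s (j + 1)) * x (j + 1)) =
    ∑ j ∈ Finset.range (n + 1), (s (j + 1) - s j) * x j := by
  have h : ∀ N, δ * ∑ j ∈ Finset.range (N + 1), x j + ∑ j ∈ Finset.range N,
      (-((δ + s' j - s (j + 1)) * x j) + (s' (j + 1) - s (j + 1)) * x (j + 1)) =
    ∑ j ∈ Finset.range (N + 1), (s (j + 1) - s j) * x j +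
      (δ + s' N - s (N + 1)) * x N := by
    intro N
    induction N with
    | zero => simp [hs0, hs0']; ring
    | succ N ih =>
      simp only [Finset.sum_range_succ] at ih ⊢
      linear_combination ih
  rw [h, hsn, hsn']
  ring

theorem toda_integrand_bound_of_bound {n : ℕ} {c : ℕ → ℂ} {s s' : ℕ → ℝ} {C : ℝ} (hC : 0 ≤ C)
    (hb : ∀ x, ‖toda n (fun j => c (j + 1)) x‖ ≤
      C * Real.exp (∑ j ∈ Finset.range n, (s' (j + 1) - s' j) * x j))
    (hs0 : s 0 = 0) (hsn : s (n + 1) = (c 0).re) (hs0' : s' 0 = 0) (hsn' : s' n = 0)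
    (h1 : ∀ j < n, s (j + 1) ≤ (c 0).re + s' j) (h2 : ∀ j < n, s (j + 1) < s' (j + 1)) :
    ∃ D : ℝ, 0 ≤ D ∧ ∀ x : ℕ → ℝ,
      Integrable (fun z : Fin n → ℝ =>
        kLam n (c 0) x (extR0 z) * toda n (fun j => c (j + 1)) (extR0 z)) ∧
      ∫ z : Fin n → ℝ, ‖kLam n (c 0) x (extR0 z) * toda n (fun j => c (j + 1)) (extR0 z)‖ ≤
        D * Real.exp (∑ j ∈ Finset.range (n + 1), (s (j + 1) - s j) * x j) := by
  obtain ⟨E, hE0, hE⟩ := prodKer_bound n (fun j => -c 0 + ((s' (j + 1) - s' j : ℝ) : ℂ))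
    (fun j => (c 0).re + s' j - s (j + 1)) (fun j hj => by linarith [h1 j hj])
  refine ⟨C * E, mul_nonneg hC hE0, fun x => ?_⟩
  obtain ⟨hEi, hEb⟩ := hE x (fun j => x (j + 1)) (fun j => Real.exp (-x (j + 1))) fun j hj =>
    Or.inl ⟨by simp; linarith [h2 j hj], rfl⟩
  have hfun : (fun z : Fin n → ℝ => ‖kLam n (c 0) x (extR0 z)‖ *
      Real.exp (∑ j ∈ Finset.range n, (s' (j + 1) - s' j) * extR0 z j)) = fun z : Fin n → ℝ =>
      Real.exp ((c 0).re * ∑ j ∈ Finset.range (n + 1), x j) *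
        ‖prodKer n (fun j => Real.exp (x j)) (fun j => Real.exp (-x (j + 1)))
          (fun j => -c 0 + ((s' (j + 1) - s' j : ℝ) : ℂ)) (extR0 z)‖ := by
    ext z; rw [← norm_kLam_mul_exp]
  rw [mul_assoc]
  refine integrable_mul_of_le (continuous_kLam_right n n _ x).aestronglyMeasurable
    (stronglyMeasurable_toda_extR0 n n _).aestronglyMeasurable hC (fun z => hb (extR0 z)) ?_ ?_
  · rw [hfun]; exact hEi.norm.const_mul _
  · rw [hfun, integral_const_mul]
    refine (mul_le_mul_of_nonneg_left hEb (Real.exp_pos _).le).trans_eq ?_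
    have hre : ∀ j, (-c 0 + ((s' (j + 1) - s' j : ℝ) : ℂ)).re + ((c 0).re + s' j - s (j + 1)) =
        s' (j + 1) - s (j + 1) := fun j => by simp; ring
    simp only [hre]
    rw [mul_left_comm, ← Real.exp_add, sum_shift_identity n (c 0).re s s' x hs0 hsn hs0' hsn']

theorem toda_bounds (n : ℕ) : (∀ (c : ℕ → ℂ) (s : ℕ → ℝ) (η : ℝ), 0 < η →
    (∀ j, 0 < j → j < n → (c j).re = 0) → s 0 = 0 → s n = (if n = 0 then 0 else (c 0).re) →
    (∀ j, 0 < j → j < n → s j ≤ min 0 (c 0).re - η) →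
    ∃ C : ℝ, 0 ≤ C ∧ ∀ x, ‖toda n c x‖ ≤
      C * Real.exp (∑ j ∈ Finset.range n, (s (j + 1) - s j) * x j)) ∧
    (∀ (c : ℕ → ℂ) (s : ℕ → ℝ) (η : ℝ), 0 < η →
    (∀ j, 0 < j → j < n + 1 → (c j).re = 0) → s 0 = 0 → s (n + 1) = (c 0).re →
    (∀ j, 0 < j → j < n + 1 → s j ≤ min 0 (c 0).re - η) →
    ∃ C : ℝ, 0 ≤ C ∧ ∀ x : ℕ → ℝ,
      Integrable (fun z : Fin n → ℝ =>
        kLam n (c 0) x (extR0 z) * toda n (fun j => c (j + 1)) (extR0 z)) ∧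
      ∫ z : Fin n → ℝ, ‖kLam n (c 0) x (extR0 z) * toda n (fun j => c (j + 1)) (extR0 z)‖ ≤
        C * Real.exp (∑ j ∈ Finset.range (n + 1), (s (j + 1) - s j) * x j)) := by
  induction n with
  | zero =>
    have h0 : ∀ (c : ℕ → ℂ) (s : ℕ → ℝ) (η : ℝ), 0 < η →
        (∀ j, 0 < j → j < 0 → (c j).re = 0) → s 0 = 0 → s 0 = (if 0 = 0 then 0 else (c 0).re) →
        (∀ j, 0 < j → j < 0 → s j ≤ min 0 (c 0).re - η) →
        ∃ C : ℝ, 0 ≤ C ∧ ∀ x, ‖toda 0 c x‖ ≤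
          C * Real.exp (∑ j ∈ Finset.range 0, (s (j + 1) - s j) * x j) :=
      fun c s η _ _ _ _ _ => ⟨1, zero_le_one, fun x => by simp [toda_zero]⟩
    refine ⟨h0, fun c s η hη hc hs0 hsn hs => ?_⟩
    exact toda_integrand_bound_of_bound (s' := fun _ => 0) zero_le_one
      (fun x => by simp [toda_zero]) hs0 hsn rfl rfl (by simp) (by simp)
  | succ n ih =>
    have h0 : ∀ (c : ℕ → ℂ) (s : ℕ → ℝ) (η : ℝ), 0 < η →
        (∀ j, 0 < j → j < n + 1 → (c j).re = 0) → s 0 = 0 →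
        s (n + 1) = (if n + 1 = 0 then 0 else (c 0).re) →
        (∀ j, 0 < j → j < n + 1 → s j ≤ min 0 (c 0).re - η) →
        ∃ C : ℝ, 0 ≤ C ∧ ∀ x, ‖toda (n + 1) c x‖ ≤
          C * Real.exp (∑ j ∈ Finset.range (n + 1), (s (j + 1) - s j) * x j) := by
      intro c s η hη hc hs0 hsn hs
      obtain ⟨C, hC0, hC⟩ := ih.2 c s η hη hc hs0 (by simpa using hsn) hs
      exact ⟨C, hC0, fun x => (norm_integral_le_integral_norm _).trans (hC x).2⟩
    refine ⟨h0, fun c s η hη hc hs0 hsn hs => ?_⟩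
    set s' : ℕ → ℝ := fun j => if j = 0 ∨ n + 1 ≤ j then 0 else -(η / 2) with hs'
    have hs'0 : ∀ j, -(η / 2) ≤ s' j := fun j => by
      simp only [hs']; split_ifs <;> linarith
    have htail : ∀ j < n + 1, (c (j + 1)).re = 0 := fun j hj => hc (j + 1) (by omega) (by omega)
    obtain ⟨C, hC0, hC⟩ := h0 (fun j => c (j + 1)) s' (η / 2) (by linarith)
      (fun j _ hj => htail j hj) (by simp [hs']) (by simp [hs', htail 0 (by omega)])
      (fun j h1 h2 => by
        simp only [hs', htail 0 (by omega), min_self]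
        rw [if_neg (by omega)]; linarith)
    refine toda_integrand_bound_of_bound (s := s) (s' := s') hC0 hC hs0 hsn (by simp [hs'])
      (by simp [hs']) (fun j hj => ?_) (fun j hj => ?_)
    · linarith [hs (j + 1) (by omega) (by omega), hs'0 j, min_le_right 0 (c 0).re]
    · linarith [hs (j + 1) (by omega) (by omega), hs'0 (j + 1), min_le_left 0 (c 0).re]

theorem toda_bound {n : ℕ} {c : ℕ → ℂ} {s : ℕ → ℝ} {η : ℝ} (hη : 0 < η)
    (hc : ∀ j, 0 < j → j < n → (c j).re = 0) (hs0 : s 0 = 0)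
    (hsn : s n = (if n = 0 then 0 else (c 0).re))
    (hs : ∀ j, 0 < j → j < n → s j ≤ min 0 (c 0).re - η) :
    ∃ C : ℝ, 0 ≤ C ∧ ∀ x, ‖toda n c x‖ ≤
      C * Real.exp (∑ j ∈ Finset.range n, (s (j + 1) - s j) * x j) :=
  (toda_bounds n).1 c s η hη hc hs0 hsn hs

theorem toda_integrand_bound {n : ℕ} {c : ℕ → ℂ} {s : ℕ → ℝ} {η : ℝ} (hη : 0 < η)
    (hc : ∀ j, 0 < j → j < n + 1 → (c j).re = 0) (hs0 : s 0 = 0) (hsn : s (n + 1) = (c 0).re)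
    (hs : ∀ j, 0 < j → j < n + 1 → s j ≤ min 0 (c 0).re - η) :
    ∃ C : ℝ, 0 ≤ C ∧ ∀ x : ℕ → ℝ,
      Integrable (fun z : Fin n → ℝ =>
        kLam n (c 0) x (extR0 z) * toda n (fun j => c (j + 1)) (extR0 z)) ∧
      ∫ z : Fin n → ℝ, ‖kLam n (c 0) x (extR0 z) * toda n (fun j => c (j + 1)) (extR0 z)‖ ≤
        C * Real.exp (∑ j ∈ Finset.range (n + 1), (s (j + 1) - s j) * x j) :=
  (toda_bounds n).2 c s η hη hc hs0 hsn hs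

/-! ### Exchange relation of the Givental kernel and the Baxter operator -/

theorem prodKer_const_eq (n : ℕ) (α β : ℕ → ℝ) (κ : ℂ) (z : ℕ → ℝ) :
    prodKer n α β (fun _ => κ) z = cexp (-((∑ j ∈ Finset.range n,
      (α j * Real.exp (-z j) + β j * Real.exp (z j)) : ℝ) : ℂ) +
      κ * ((∑ j ∈ Finset.range n, z j : ℝ) : ℂ)) := by
  rw [prodKer_eq, Finset.sum_add_distrib, Finset.sum_neg_distrib, ← Finset.mul_sum,
    ofReal_sum, ofReal_sum]

theorem kLam_eq (n : ℕ) (c : ℂ) (x z : ℕ → ℝ) : kLam n c x z =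
    cexp (-((∑ j ∈ Finset.range n,
      (Real.exp (x j - z j) + Real.exp (z j - x (j + 1))) : ℝ) : ℂ) +
      c * ((∑ j ∈ Finset.range (n + 1), x j - ∑ j ∈ Finset.range n, z j : ℝ) : ℂ)) := by
  rw [kLam, prodKer_const_eq, ← Complex.exp_add]
  congr 1
  simp only [← Real.exp_add, ← sub_eq_add_neg, neg_add_eq_sub]
  rw [ofReal_sub]
  ring

theorem kQ_eq (n : ℕ) (μ : ℂ) (x y : ℕ → ℝ) : kQ n μ x y =
    cexp (-((∑ j ∈ Finset.range n, (Real.exp (x j - y j) +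
      if j + 1 < n then Real.exp (y j - x (j + 1)) else 0) : ℝ) : ℂ) +
      μ * ((∑ j ∈ Finset.range n, x j - ∑ j ∈ Finset.range n, y j : ℝ) : ℂ)) := by
  rw [kQ, prodKer_const_eq, ← Complex.exp_add]
  congr 1
  simp only [← Real.exp_add, ← sub_eq_add_neg, ite_mul, zero_mul, neg_add_eq_sub]
  rw [ofReal_sub]
  ring

theorem sum_ite_succ_lt (n : ℕ) (f : ℕ → ℕ → ℝ) :
    ∑ j ∈ Finset.range n, (if j + 1 < n then f j (j + 1) else 0) =
      ∑ j ∈ Finset.range n, (if j = 0 then 0 else f (j - 1) j) := by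
  cases n with
  | zero => rfl
  | succ n =>
    rw [Finset.sum_range_succ, Finset.sum_range_succ']
    simp only [lt_irrefl, if_false, if_true, add_zero]
    refine Finset.sum_congr rfl fun j hj => ?_
    have := Finset.mem_range.1 hj
    simp [this]

/-- Coefficient of `e^{-y_j}` in the composition of the two kernels. -/
def kiA (x z : ℕ → ℝ) (j : ℕ) : ℝ := Real.exp (x j) + if j = 0 then 0 else Real.exp (z (j - 1))

theorem kiA_pos (x z : ℕ → ℝ) (j : ℕ) : 0 < kiA x z j := by
  unfold kiA
  have := Real.exp_pos (x j)
  have := Real.exp_pos (z (j - 1))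
  split_ifs <;> linarith

/-- Coefficient of `e^{y_j}` in the composition of the two kernels. -/
def kiB (k : ℕ) (x z : ℕ → ℝ) (j : ℕ) : ℝ :=
  if j < k then Real.exp (-x (j + 1)) + Real.exp (-z j) else 0

theorem kQ_mul_kLam (k : ℕ) (μ l : ℂ) (x z y : ℕ → ℝ) :
    kQ (k + 1) μ x y * kLam k l y z =
      cexp (μ * ((∑ j ∈ Finset.range (k + 1), x j : ℝ) : ℂ) -
        l * ((∑ j ∈ Finset.range k, z j : ℝ) : ℂ)) *
      prodKer (k + 1) (kiA x z) (kiB k x z) (fun _ => l - μ) y := by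
  rw [kQ_eq, kLam_eq, prodKer_const_eq, ← Complex.exp_add, ← Complex.exp_add]
  congr 1
  have h : ∑ j ∈ Finset.range (k + 1), (kiA x z j * Real.exp (-y j) +
        kiB k x z j * Real.exp (y j)) =
      ∑ j ∈ Finset.range (k + 1), (Real.exp (x j - y j) +
        if j + 1 < k + 1 then Real.exp (y j - x (j + 1)) else 0) +
      ∑ j ∈ Finset.range k, (Real.exp (y j - z j) + Real.exp (z j - y (j + 1))) := by
    simp only [kiA, kiB, add_mul, Finset.sum_add_distrib, ite_mul, zero_mul, ← Real.exp_add,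
      ← sub_eq_add_neg]
    rw [Finset.sum_range_succ' (fun j => if j = 0 then (0 : ℝ) else _),
      Finset.sum_range_succ (fun j => if j < k then _ else (0 : ℝ)),
      Finset.sum_range_succ (fun j => if j + 1 < k + 1 then _ else (0 : ℝ))]
    have e1 : ∑ j ∈ Finset.range k, (if j < k then Real.exp (-x (j + 1) + y j) +
        Real.exp (-z j + y j) else 0) = ∑ j ∈ Finset.range k, Real.exp (y j - x (j + 1)) +
        ∑ j ∈ Finset.range k, Real.exp (y j - z j) := by
      rw [← Finset.sum_add_distrib]
      refine Finset.sum_congr rfl fun j hj => ?_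
      rw [if_pos (Finset.mem_range.1 hj), neg_add_eq_sub, neg_add_eq_sub]
    have e2 : ∑ j ∈ Finset.range k, (if j + 1 < k + 1 then Real.exp (y j - x (j + 1)) else 0) =
        ∑ j ∈ Finset.range k, Real.exp (y j - x (j + 1)) := by
      refine Finset.sum_congr rfl fun j hj => ?_
      rw [if_pos (by have := Finset.mem_range.1 hj; omega)]
    rw [e1, e2]
    simp
    ring
  rw [h, ofReal_add, ofReal_sub, ofReal_sub]
  ring

theorem kLam_mul_kQ (k : ℕ) (μ l : ℂ) (x z y : ℕ → ℝ) :
    kLam k l x y * kQ k μ y z =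
      cexp (l * ((∑ j ∈ Finset.range (k + 1), x j : ℝ) : ℂ) -
        μ * ((∑ j ∈ Finset.range k, z j : ℝ) : ℂ)) *
      prodKer k (kiA x z) (kiB k x z) (fun _ => μ - l) y := by
  rw [kQ_eq, kLam_eq, prodKer_const_eq, ← Complex.exp_add, ← Complex.exp_add]
  congr 1
  have h : ∑ j ∈ Finset.range k, (kiA x z j * Real.exp (-y j) +
        kiB k x z j * Real.exp (y j)) =
      ∑ j ∈ Finset.range k, (Real.exp (x j - y j) + Real.exp (y j - x (j + 1))) +
      ∑ j ∈ Finset.range k, (Real.exp (y j - z j) +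
        if j + 1 < k then Real.exp (z j - y (j + 1)) else 0) := by
    simp only [Finset.sum_add_distrib]
    rw [sum_ite_succ_lt k fun i j => Real.exp (z i - y j)]
    simp only [← Finset.sum_add_distrib]
    refine Finset.sum_congr rfl fun j hj => ?_
    simp only [kiA, kiB, if_pos (Finset.mem_range.1 hj), add_mul, ite_mul, zero_mul,
      ← Real.exp_add, ← sub_eq_add_neg, neg_add_eq_sub]
    ring
  rw [h, ofReal_add, ofReal_sub, ofReal_sub]
  ring

theorem integral_prodKer (n : ℕ) (α β : ℕ → ℝ) (κ : ℕ → ℂ) :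
    ∫ y : Fin n → ℝ, prodKer n α β κ (extR0 y) =
      ∏ j ∈ Finset.range n, ∫ y, expKer (α j) (β j) (κ j) y :=
  integral_prod_extR0 fun j => expKer (α j) (β j) (κ j)

theorem log_kiB {k j : ℕ} (hj : j < k) (x z : ℕ → ℝ) :
    Real.log (kiB k x z j) = Real.log (kiA x z (j + 1)) - x (j + 1) - z j := by
  have h : kiB k x z j = kiA x z (j + 1) * Real.exp (-x (j + 1)) * Real.exp (-z j) := by
    simp only [kiA, kiB, if_pos hj, Nat.add_sub_cancel, Nat.succ_ne_zero, if_false, add_mul,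
      ← Real.exp_add]
    ring_nf
  rw [h, Real.log_mul (mul_pos (kiA_pos _ _ _) (Real.exp_pos _)).ne' (Real.exp_pos _).ne',
    Real.log_mul (kiA_pos _ _ _).ne' (Real.exp_pos _).ne', Real.log_exp, Real.log_exp]
  ring

theorem kiB_pos {k j : ℕ} (hj : j < k) (x z : ℕ → ℝ) : 0 < kiB k x z j := by
  rw [kiB, if_pos hj]; positivity

theorem exchange_relation (k : ℕ) {μ l : ℂ} (h : l.re < μ.re) (x z : ℕ → ℝ) :
    ∫ y : Fin (k + 1) → ℝ, kQ (k + 1) μ x (extR0 y) * kLam k l (extR0 y) z =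
      Complex.Gamma (μ - l) *
        ∫ y : Fin k → ℝ, kLam k l x (extR0 y) * kQ k μ (extR0 y) z := by
  simp_rw [kQ_mul_kLam, kLam_mul_kQ]
  rw [integral_const_mul, integral_const_mul, integral_prodKer, integral_prodKer,
    Finset.prod_range_succ]
  have hk : kiB k x z k = 0 := by simp [kiB]
  rw [hk, integral_expKer_zero_right (kiA_pos x z k) (by simpa using h)]
  have hs : ∀ j ∈ Finset.range k, ∫ y, expKer (kiA x z j) (kiB k x z j) (l - μ) y =
      cexp ((l - μ) * ((Real.log (kiA x z j) - Real.log (kiA x z (j + 1)) + x (j + 1) + z j : ℝ)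
        : ℂ)) * ∫ y, expKer (kiA x z j) (kiB k x z j) (μ - l) y := by
    intro j hj
    have hj := Finset.mem_range.1 hj
    have hsym := integral_expKer_symm (u := Real.log (kiA x z j)) (v := Real.log (kiB k x z j))
      (l - μ)
    rw [Real.exp_log (kiA_pos x z j), Real.exp_log (kiB_pos hj x z), neg_sub] at hsym
    rw [hsym, log_kiB hj]
    congr 3
    push_cast
    ring
  rw [Finset.prod_congr rfl hs, Finset.prod_mul_distrib, ← Complex.exp_sum, ← Finset.mul_sum,
    ← ofReal_sum]
  have htel : ∑ j ∈ Finset.range k, (Real.log (kiA x z j) - Real.log (kiA x z (j + 1)) +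
      x (j + 1) + z j) = ∑ j ∈ Finset.range (k + 1), x j + ∑ j ∈ Finset.range k, z j -
      Real.log (kiA x z k) := by
    rw [Finset.sum_add_distrib, Finset.sum_add_distrib, Finset.sum_range_sub',
      Finset.sum_range_succ' x]
    have : Real.log (kiA x z 0) = x 0 := by simp [kiA]
    rw [this]
    ring
  rw [htel, neg_sub]
  have he : cexp (μ * ((∑ j ∈ Finset.range (k + 1), x j : ℝ) : ℂ) -
        l * ((∑ j ∈ Finset.range k, z j : ℝ) : ℂ)) *
      cexp ((l - μ) * ((∑ j ∈ Finset.range (k + 1), x j + ∑ j ∈ Finset.range k, z j -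
        Real.log (kiA x z k) : ℝ) : ℂ)) * cexp ((l - μ) * Real.log (kiA x z k)) =
      cexp (l * ((∑ j ∈ Finset.range (k + 1), x j : ℝ) : ℂ) -
        μ * ((∑ j ∈ Finset.range k, z j : ℝ) : ℂ)) := by
    rw [← Complex.exp_add, ← Complex.exp_add]
    congr 1
    push_cast
    ring
  rw [← he]
  ring

/-! ### The Baxter operator -/

theorem kQ_exp_bound (n : ℕ) (μ : ℂ) (e : ℕ → ℝ) (he : ∀ j, j + 1 = n → e j < μ.re) :
    ∃ C : ℝ, 0 ≤ C ∧ ∃ t : ℕ → ℝ, ∀ x : ℕ → ℝ,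
      Integrable (fun z : Fin n → ℝ => ‖kQ n μ x (extR0 z)‖ *
        Real.exp (∑ j ∈ Finset.range n, e j * extR0 z j)) ∧
      ∫ z : Fin n → ℝ, ‖kQ n μ x (extR0 z)‖ *
        Real.exp (∑ j ∈ Finset.range n, e j * extR0 z j) ≤
        C * Real.exp (∑ j ∈ Finset.range n, t j * x j) := by
  set k : ℕ → ℝ := fun j => if j + 1 < n then |μ.re - e j| + 1 else μ.re - e j with hk
  obtain ⟨C, hC0, hC⟩ := prodKer_bound n (fun j => -μ + e j) k fun j hj => by
    simp only [hk]
    split_ifs with h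
    · positivity
    · linarith [he j (by omega)]
  have hre : ∀ j, (-μ + (e j : ℂ)).re + k j = if j + 1 < n then k j - (μ.re - e j) else 0 := by
    intro j
    simp only [hk, add_re, neg_re, ofReal_re]
    split_ifs <;> ring
  set t : ℕ → ℝ := fun j => μ.re - k j +
    if j = 0 then 0 else k (j - 1) - (μ.re - e (j - 1)) with ht
  refine ⟨C, hC0, t, fun x => ?_⟩
  obtain ⟨h1, h2⟩ := hC x (fun j => x (j + 1))
    (fun j => if j + 1 < n then Real.exp (-x (j + 1)) else 0) fun j hj => by
      rw [hre]
      by_cases h : j + 1 < n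
      · left
        simp only [h, if_true, hk, and_true]
        linarith [le_abs_self (μ.re - e j)]
      · right
        simp only [h, if_false, hk, le_refl, and_true, true_and]
        linarith [he j (by omega)]
  simp_rw [norm_kQ_mul_exp]
  refine ⟨h1.norm.const_mul _, ?_⟩
  rw [integral_const_mul]
  refine (mul_le_mul_of_nonneg_left h2 (Real.exp_pos _).le).trans_eq ?_
  rw [mul_left_comm, ← Real.exp_add]
  congr 2
  simp only [hre, ite_mul, zero_mul]
  rw [Finset.sum_add_distrib, sum_ite_succ_lt n fun i j => (k i - (μ.re - e i)) * x j,
    Finset.mul_sum, ← Finset.sum_add_distrib, ← Finset.sum_add_distrib]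
  refine Finset.sum_congr rfl fun j _ => ?_
  simp only [ht]
  split_ifs <;> ring

/-- Absolute integrability of an iterated integral. -/
theorem integrable_prod_mul_of_le {α β : Type*} [MeasureSpace α] [MeasureSpace β]
    [SFinite (volume : Measure α)] [SFinite (volume : Measure β)] {f : α → ℂ} {K : α → β → ℂ}
    {h : α → ℝ} {C : ℝ} (hf : AEStronglyMeasurable f)
    (hK : AEStronglyMeasurable (fun q : α × β => K q.1 q.2) (volume.prod volume))
    (hKi : ∀ y, Integrable (K y)) (hN : ∀ y, ∫ z, ‖K y z‖ ≤ C * h y)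
    (hi : Integrable fun y => ‖f y‖ * h y) :
    Integrable (fun q : α × β => f q.1 * K q.1 q.2) (volume.prod volume) := by
  have hm : AEStronglyMeasurable (fun q : α × β => f q.1 * K q.1 q.2) (volume.prod volume) :=
    hf.comp_fst.mul hK
  rw [integrable_prod_iff hm]
  refine ⟨Filter.Eventually.of_forall fun y => (hKi y).const_mul (f y), ?_⟩
  refine (hi.const_mul C).mono' hm.norm.integral_prod_right' (Filter.Eventually.of_forall fun y => ?_)
  simp_rw [norm_mul]
  rw [integral_const_mul, norm_mul, norm_norm,
    Real.norm_of_nonneg (integral_nonneg fun z => norm_nonneg _)]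
  have := mul_le_mul_of_nonneg_left (hN y) (norm_nonneg (f y))
  linarith

theorem stronglyMeasurable_kLam_mul_toda (n m k : ℕ) (l : ℂ) (c : ℕ → ℂ) :
    StronglyMeasurable fun q : (Fin m → ℝ) × (Fin k → ℝ) =>
      kLam n l (extR0 q.1) (extR0 q.2) * toda n c (extR0 q.2) :=
  (((continuous_kLam n l).comp (((continuous_extR0 m).comp continuous_fst).prodMk
    ((continuous_extR0 k).comp continuous_snd))).stronglyMeasurable).mul
    ((stronglyMeasurable_toda_extR0 n k c).comp_measurable measurable_snd)

theorem stronglyMeasurable_kQ_mul_toda (n m k : ℕ) (l : ℂ) (c : ℕ → ℂ) :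
    StronglyMeasurable fun q : (Fin m → ℝ) × (Fin k → ℝ) =>
      kQ n l (extR0 q.1) (extR0 q.2) * toda n c (extR0 q.2) :=
  (((continuous_kQ n l).comp (((continuous_extR0 m).comp continuous_fst).prodMk
    ((continuous_extR0 k).comp continuous_snd))).stronglyMeasurable).mul
    ((stronglyMeasurable_toda_extR0 n k c).comp_measurable measurable_snd)

/-- The exponents `s` used for the a priori bounds. -/
def bdExp (n : ℕ) (δ η : ℝ) (j : ℕ) : ℝ :=
  if j = 0 then 0 else if j < n then min 0 δ - η else δ

theorem toda_bound' {n : ℕ} {c : ℕ → ℂ} {η : ℝ} (hη : 0 < η)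
    (hc : ∀ j, 0 < j → j < n → (c j).re = 0) :
    ∃ C : ℝ, 0 ≤ C ∧ ∀ x, ‖toda n c x‖ ≤
      C * Real.exp (∑ j ∈ Finset.range n,
        (bdExp n (c 0).re η (j + 1) - bdExp n (c 0).re η j) * x j) :=
  toda_bound hη hc (by simp [bdExp]) (by simp [bdExp]) fun j h1 h2 => by
    simp [bdExp, h2, h1.ne']

theorem toda_integrand_bound' {n : ℕ} {c : ℕ → ℂ} {η : ℝ} (hη : 0 < η)
    (hc : ∀ j, 0 < j → j < n + 1 → (c j).re = 0) :
    ∃ C : ℝ, 0 ≤ C ∧ ∀ x : ℕ → ℝ,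
      Integrable (fun z : Fin n → ℝ =>
        kLam n (c 0) x (extR0 z) * toda n (fun j => c (j + 1)) (extR0 z)) ∧
      ∫ z : Fin n → ℝ, ‖kLam n (c 0) x (extR0 z) * toda n (fun j => c (j + 1)) (extR0 z)‖ ≤
        C * Real.exp (∑ j ∈ Finset.range (n + 1),
          (bdExp (n + 1) (c 0).re η (j + 1) - bdExp (n + 1) (c 0).re η j) * x j) :=
  toda_integrand_bound hη hc (by simp [bdExp]) (by simp [bdExp]) fun j h1 h2 => by
    simp [bdExp, h2, h1.ne']

theorem bdExp_last_lt {n : ℕ} {δ η m : ℝ} (hη : 0 < η) (h0 : 0 < m - η) (h1 : δ < m - η) (j : ℕ)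
    (hj : j + 1 = n) : bdExp n δ η (j + 1) - bdExp n δ η j < m := by
  subst hj
  unfold bdExp
  rcases Nat.eq_zero_or_pos j with rfl | hj
  · simp; linarith
  · simp only [Nat.succ_ne_zero, if_false, lt_irrefl, hj.ne', Nat.lt_succ_self, if_true]
    rcases min_cases 0 δ with h | h <;> linarith

theorem baxter_bound {n : ℕ} {c : ℕ → ℂ} {μ : ℂ}
    (hc : ∀ j, 0 < j → j < n → (c j).re = 0) (hμ : 0 < μ.re) (hμ' : n = 0 ∨ (c 0).re < μ.re) :
    ∃ C : ℝ, 0 ≤ C ∧ ∃ t : ℕ → ℝ, ∀ x : ℕ → ℝ,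
      Integrable (fun z : Fin n → ℝ => kQ n μ x (extR0 z) * toda n c (extR0 z)) ∧
      ∫ z : Fin n → ℝ, ‖kQ n μ x (extR0 z) * toda n c (extR0 z)‖ ≤
        C * Real.exp (∑ j ∈ Finset.range n, t j * x j) := by
  obtain ⟨η, hη, hη1, hη2⟩ : ∃ η > 0, 0 < μ.re - η ∧ (n = 0 ∨ (c 0).re < μ.re - η) := by
    rcases hμ' with h | h
    · exact ⟨μ.re / 2, half_pos hμ, by linarith, Or.inl h⟩
    · refine ⟨min μ.re (μ.re - (c 0).re) / 2, half_pos (lt_min hμ (by linarith)), ?_, Or.inr ?_⟩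
      · linarith [min_le_left μ.re (μ.re - (c 0).re)]
      · linarith [min_le_right μ.re (μ.re - (c 0).re)]
  obtain ⟨C, hC0, hC⟩ := toda_bound' (n := n) (c := c) hη hc
  obtain ⟨D, hD0, t, hD⟩ := kQ_exp_bound n μ
    (fun j => bdExp n (c 0).re η (j + 1) - bdExp n (c 0).re η j)
    (fun j hj => bdExp_last_lt hη hη1 (hη2.resolve_left (by omega)) j hj)
  refine ⟨C * D, mul_nonneg hC0 hD0, t, fun x => ?_⟩
  rw [mul_assoc]
  exact integrable_mul_of_le (continuous_kQ_right n n μ x).aestronglyMeasurable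
    (stronglyMeasurable_toda_extR0 n n c).aestronglyMeasurable hC0 (fun z => hC (extR0 z))
    (hD x).1 (hD x).2

theorem baxter_eigen {n : ℕ} {c : ℕ → ℂ} {μ : ℂ}
    (hc : ∀ j, 0 < j → j < n → (c j).re = 0) (hμ : 0 < μ.re) (hμ' : n = 0 ∨ (c 0).re < μ.re)
    (x : ℕ → ℝ) :
    ∫ y : Fin n → ℝ, kQ n μ x (extR0 y) * toda n c (extR0 y) =
      (∏ j ∈ Finset.range n, Complex.Gamma (μ - c j)) * toda n c x := by
  induction n generalizing c x with
  | zero => simp [kQ, prodKer, toda_zero, measureReal_def, volume_pi]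
  | succ k ih =>
    have hμ0 : (c 0).re < μ.re := hμ'.resolve_left (by omega)
    have htail : ∀ j < k, (c (j + 1)).re = 0 := fun j hj => hc (j + 1) (by omega) (by omega)
    have hμt : k = 0 ∨ (c (0 + 1)).re < μ.re := by
      rcases Nat.eq_zero_or_pos k with h | h
      · exact Or.inl h
      · right; rw [htail 0 h]; exact hμ
    set c' : ℕ → ℂ := fun j => c (j + 1) with hc'
    have hct : ∀ j, 0 < j → j < k → (c' j).re = 0 := fun j _ hj => htail j hj
    have ih' := fun x => ih (c := c') hct hμt x
    -- first exchange of integrals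
    obtain ⟨η, hη, hη1, hη2⟩ : ∃ η > 0, 0 < μ.re - η ∧ (c 0).re < μ.re - η := by
      refine ⟨min μ.re (μ.re - (c 0).re) / 2, half_pos (lt_min hμ (by linarith)), ?_, ?_⟩
      · linarith [min_le_left μ.re (μ.re - (c 0).re)]
      · linarith [min_le_right μ.re (μ.re - (c 0).re)]
    obtain ⟨C, hC0, hC⟩ := toda_integrand_bound' (n := k) (c := c) hη hc
    obtain ⟨D, hD0, t, hD⟩ := kQ_exp_bound (k + 1) μ
      (fun j => bdExp (k + 1) (c 0).re η (j + 1) - bdExp (k + 1) (c 0).re η j)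
      (fun j hj => bdExp_last_lt hη hη1 hη2 j hj)
    have hF1 : Integrable (fun q : (Fin (k + 1) → ℝ) × (Fin k → ℝ) =>
        kQ (k + 1) μ x (extR0 q.1) *
          (kLam k (c 0) (extR0 q.1) (extR0 q.2) * toda k c' (extR0 q.2)))
        (volume.prod volume) :=
      integrable_prod_mul_of_le (continuous_kQ_right _ _ μ x).aestronglyMeasurable
        (stronglyMeasurable_kLam_mul_toda k _ _ _ _).aestronglyMeasurable
        (fun y => (hC (extR0 y)).1) (fun y => (hC (extR0 y)).2) (hD x).1
    obtain ⟨C', hC'0, t', hC'⟩ := baxter_bound (n := k) (c := c') hct hμ hμt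
    obtain ⟨D', hD'0, hD'⟩ := prodKer_bound k (fun j => -c 0 + t' j)
      (fun j => |(c 0).re - t' j| + 1) (fun j _ => by positivity)
    have hF2 : Integrable (fun q : (Fin k → ℝ) × (Fin k → ℝ) =>
        kLam k (c 0) x (extR0 q.1) *
          (kQ k μ (extR0 q.1) (extR0 q.2) * toda k c' (extR0 q.2)))
        (volume.prod volume) := by
      refine integrable_prod_mul_of_le (continuous_kLam_right _ _ _ x).aestronglyMeasurable
        (stronglyMeasurable_kQ_mul_toda k _ _ _ _).aestronglyMeasurable
        (fun y => (hC' (extR0 y)).1) (fun y => (hC' (extR0 y)).2) ?_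
      simp_rw [norm_kLam_mul_exp]
      refine ((hD' x (fun j => x (j + 1)) (fun j => Real.exp (-x (j + 1)))
        fun j _ => Or.inl ⟨?_, rfl⟩).1).norm.const_mul _
      simp only [add_re, neg_re, ofReal_re]
      linarith [le_abs_self ((c 0).re - t' j)]
    calc ∫ y : Fin (k + 1) → ℝ, kQ (k + 1) μ x (extR0 y) * toda (k + 1) c (extR0 y)
        = ∫ y : Fin (k + 1) → ℝ, ∫ z : Fin k → ℝ, kQ (k + 1) μ x (extR0 y) *
          (kLam k (c 0) (extR0 y) (extR0 z) * toda k c' (extR0 z)) := by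
          simp_rw [toda_succ, integral_const_mul]; rfl
      _ = ∫ z : Fin k → ℝ, ∫ y : Fin (k + 1) → ℝ, kQ (k + 1) μ x (extR0 y) *
          (kLam k (c 0) (extR0 y) (extR0 z) * toda k c' (extR0 z)) :=
          integral_integral_swap hF1
      _ = Complex.Gamma (μ - c 0) * ∫ z : Fin k → ℝ, ∫ y : Fin k → ℝ,
          kLam k (c 0) x (extR0 y) * (kQ k μ (extR0 y) (extR0 z) * toda k c' (extR0 z)) := by
          rw [← integral_const_mul]
          congr 1 with z
          simp_rw [← mul_assoc]
          rw [integral_mul_const, integral_mul_const, exchange_relation k hμ0, mul_assoc]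
      _ = Complex.Gamma (μ - c 0) * ∫ y : Fin k → ℝ, ∫ z : Fin k → ℝ,
          kLam k (c 0) x (extR0 y) * (kQ k μ (extR0 y) (extR0 z) * toda k c' (extR0 z)) := by
          rw [(integral_integral_swap hF2).symm]
      _ = _ := by
          simp_rw [integral_const_mul, ih']
          rw [Finset.prod_range_succ', toda_succ, mul_comm (∏ j ∈ Finset.range k, _), mul_assoc,
            ← integral_const_mul (∏ j ∈ Finset.range k, Complex.Gamma (μ - c (j + 1)))]
          congr 1
          refine integral_congr_ae (Filter.Eventually.of_forall fun y => ?_)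
          simp only [hc']
          ring

/-! ### Duality -/

/-- The reflection `x_j ↦ -x_{n-1-j}`. -/
def reflSeq (n : ℕ) (x : ℕ → ℝ) (j : ℕ) : ℝ := -x (n - 1 - j)

theorem integral_comp_neg_rev {n : ℕ} (f : (Fin n → ℝ) → ℂ) :
    ∫ z : Fin n → ℝ, f (fun j => -z j.rev) = ∫ z : Fin n → ℝ, f z := by
  rw [← integral_neg_eq_self f]
  have h := volume_measurePreserving_piCongrLeft (fun _ : Fin n => ℝ) (Fin.revPerm)
  rw [← h.integral_comp (MeasurableEquiv.measurableEmbedding _)]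
  congr 1 with z
  congr 1 with j
  simp only [Pi.neg_apply, neg_inj]
  exact Equiv.piCongrLeft_apply_apply (fun _ => ℝ) Fin.revPerm z j

theorem extR0_neg_rev {n : ℕ} (z : Fin n → ℝ) {j : ℕ} (hj : j < n) :
    extR0 (fun j => -z j.rev) j = reflSeq n (extR0 z) j := by
  rw [extR0_of_lt _ hj, reflSeq, extR0_of_lt _ (by omega)]
  congr 2
  ext
  simp only [Fin.val_rev]
  omega

theorem sum_reflSeq (n : ℕ) (x : ℕ → ℝ) :
    ∑ j ∈ Finset.range n, reflSeq n x j = -∑ j ∈ Finset.range n, x j := by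
  simp only [reflSeq, Finset.sum_neg_distrib]
  rw [Finset.sum_range_reflect]

theorem kLam_reflSeq (n : ℕ) (c : ℂ) (x z : ℕ → ℝ) :
    kLam n (-c) (reflSeq (n + 1) x) (reflSeq n z) = kLam n c x z := by
  rw [kLam_eq, kLam_eq, sum_reflSeq, sum_reflSeq]
  congr 2
  · congr 2
    rw [← Finset.sum_range_reflect]
    refine Finset.sum_congr rfl fun j hj => ?_
    have hj := Finset.mem_range.1 hj
    simp only [reflSeq]
    rw [add_comm]
    congr 2 <;> rw [neg_sub_neg] <;> congr 2 <;> omega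
  · push_cast
    ring

theorem kQ_reflSeq (n : ℕ) (μ : ℂ) (x y : ℕ → ℝ) :
    kQ n μ (reflSeq n x) (reflSeq n y) = kQ n μ y x := by
  rw [kQ_eq, kQ_eq, sum_reflSeq, sum_reflSeq]
  congr 2
  · congr 2
    rw [Finset.sum_add_distrib, Finset.sum_add_distrib]
    congr 1
    · rw [← Finset.sum_range_reflect]
      refine Finset.sum_congr rfl fun j hj => ?_
      have hj := Finset.mem_range.1 hj
      simp only [reflSeq]
      rw [neg_sub_neg]
      congr 3 <;> omega
    · rcases n with _ | n
      · simp
      · rw [Finset.sum_range_succ, Finset.sum_range_succ]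
        simp only [lt_irrefl, if_false, add_zero]
        rw [← Finset.sum_range_reflect]
        refine Finset.sum_congr rfl fun j hj => ?_
        have hj := Finset.mem_range.1 hj
        rw [if_pos (by omega), if_pos (by omega)]
        simp only [reflSeq]
        rw [neg_sub_neg]
        congr 3 <;> omega
  · push_cast
    ring

theorem kLam_congr_right {n : ℕ} {c : ℂ} (x : ℕ → ℝ) {z z' : ℕ → ℝ} (h : ∀ j < n, z j = z' j) :
    kLam n c x z = kLam n c x z' := by
  unfold kLam prodKer
  congr 1
  exact Finset.prod_congr rfl fun j hj => by rw [h j (Finset.mem_range.1 hj)]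

theorem kQ_congr_right {n : ℕ} {c : ℂ} (x : ℕ → ℝ) {z z' : ℕ → ℝ} (h : ∀ j < n, z j = z' j) :
    kQ n c x z = kQ n c x z' := by
  unfold kQ prodKer
  congr 1
  exact Finset.prod_congr rfl fun j hj => by rw [h j (Finset.mem_range.1 hj)]

theorem toda_reflSeq (n : ℕ) (c : ℕ → ℂ) (x : ℕ → ℝ) :
    toda n (fun j => -c j) (reflSeq n x) = toda n c x := by
  induction n generalizing c x with
  | zero => rfl
  | succ n ih =>
    rw [toda_succ, toda_succ, ← integral_comp_neg_rev]
    congr 1 with z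
    rw [kLam_congr_right _ (fun j hj => extR0_neg_rev z hj),
      toda_congr (fun _ _ => rfl) (fun j hj => extR0_neg_rev z hj), kLam_reflSeq,
      ih (fun j => c (j + 1))]

theorem baxter_transpose_eigen {n : ℕ} {c : ℕ → ℂ} {μ : ℂ}
    (hc : ∀ j, 0 < j → j < n → (c j).re = 0) (hμ : 0 < μ.re) (hμ' : n = 0 ∨ 0 < (μ + c 0).re)
    (x : ℕ → ℝ) :
    ∫ y : Fin n → ℝ, kQ n μ (extR0 y) x * toda n c (extR0 y) =
      (∏ j ∈ Finset.range n, Complex.Gamma (μ + c j)) * toda n c x := by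
  have h := baxter_eigen (n := n) (c := fun j => -c j) (μ := μ)
    (fun j h1 h2 => by simp [hc j h1 h2]) hμ
    (hμ'.imp_right fun h => by simp at h ⊢; linarith) (reflSeq n x)
  simp only [sub_neg_eq_add] at h
  rw [toda_reflSeq] at h
  rw [← h, ← integral_comp_neg_rev
    fun z => kQ n μ (reflSeq n x) (extR0 z) * toda n (fun j => -c j) (extR0 z)]
  congr 1 with z
  rw [kQ_congr_right _ (fun j hj => extR0_neg_rev z hj),
    toda_congr (fun _ _ => rfl) (fun j hj => extR0_neg_rev z hj), kQ_reflSeq, toda_reflSeq]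

/-! ### Exponential decay -/

theorem integrable_exp_neg_mul_abs {ε : ℝ} (hε : 0 < ε) :
    Integrable fun x : ℝ => Real.exp (-(ε * |x|)) := by
  have h1 : IntegrableOn (fun x : ℝ => Real.exp (-(ε * |x|))) (Set.Ioi 0) := by
    refine (exp_neg_integrableOn_Ioi 0 hε).congr_fun (fun x hx => ?_) measurableSet_Ioi
    simp only [abs_of_pos (Set.mem_Ioi.1 hx), neg_mul]
  have h2 : IntegrableOn (fun x : ℝ => Real.exp (-(ε * |x|))) (Set.Iic 0) := by
    refine (integrableOn_exp_mul_Iic hε 0).congr_fun (fun x hx => ?_) measurableSet_Iic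
    simp only [abs_of_nonpos (Set.mem_Iic.1 hx), mul_neg, neg_neg]
  rw [← integrableOn_univ, ← Set.Iic_union_Ioi (a := (0 : ℝ))]
  exact h2.union h1

/-- Exponential weight on `ℝ^n`. -/
def expWt (n : ℕ) (ε : ℝ) (x : ℕ → ℝ) : ℝ :=
  Real.exp (-(ε * ∑ j ∈ Finset.range n, |x j|))

theorem integrable_expWt (n : ℕ) {ε : ℝ} (hε : 0 < ε) :
    Integrable fun x : Fin n → ℝ => expWt n ε (extR0 x) := by
  have := integrable_prod_extR0_real (n := n) (f := fun _ x => Real.exp (-(ε * |x|)))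
    fun j _ => integrable_exp_neg_mul_abs hε
  refine this.congr (Filter.Eventually.of_forall fun x => ?_)
  simp only [expWt]
  rw [← Real.exp_sum, Finset.mul_sum, Finset.sum_neg_distrib]

theorem sum_by_parts (N : ℕ) (s P : ℕ → ℝ) (hs : s 0 = 0) :
    ∑ j ∈ Finset.range N, (s (j + 1) - s j) * P j =
      ∑ j ∈ Finset.range N, s (j + 1) * (P j - if j + 1 < N then P (j + 1) else 0) := by
  rcases N with _ | N
  · simp
  · have h1 : ∑ j ∈ Finset.range (N + 1), s j * P j =
        ∑ j ∈ Finset.range (N + 1), s (j + 1) * (if j + 1 < N + 1 then P (j + 1) else 0) := by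
      rw [Finset.sum_range_succ', Finset.sum_range_succ, hs]
      simp only [lt_irrefl, if_false, mul_zero, add_zero, zero_mul]
      exact Finset.sum_congr rfl fun j hj => by rw [if_pos (by simpa using hj)]
    simp only [sub_mul, mul_sub, Finset.sum_sub_distrib]
    rw [h1]

theorem abs_le_sum_diff (N : ℕ) (P : ℕ → ℝ) (i : ℕ) (hi : i < N) :
    |P i| ≤ ∑ j ∈ Finset.range N, |P j - if j + 1 < N then P (j + 1) else 0| := by
  have key : ∀ k, ∀ i, i + k + 1 = N → |P i| ≤ ∑ j ∈ Finset.Ico i N,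
      |P j - if j + 1 < N then P (j + 1) else 0| := by
    intro k
    induction k with
    | zero =>
      intro i h
      obtain rfl : N = i + 1 := by omega
      simp
    | succ k ih =>
      intro i h
      rw [Finset.sum_eq_sum_Ico_succ_bot (by omega), if_pos (by omega)]
      have := ih (i + 1) (by omega)
      have h2 : |P i| ≤ |P i - P (i + 1)| + |P (i + 1)| := by
        have := abs_add_le (P i - P (i + 1)) (P (i + 1)); simpa using this
      linarith
  refine (key (N - i - 1) i (by omega)).trans ?_
  exact Finset.sum_le_sum_of_subset_of_nonneg
    (fun j hj => by simp at hj ⊢; omega) fun j _ _ => abs_nonneg _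

/-- Growth bounds with arbitrary negative exponents imply exponential decay. -/
theorem exists_expWt_bound (N : ℕ) (g : (Fin N → ℝ) → ℝ)
    (hg : ∀ s : ℕ → ℝ, s 0 = 0 → (∀ j, 0 < j → j ≤ N → s j < 0) → ∃ C : ℝ, 0 ≤ C ∧
      ∀ P : Fin N → ℝ, g P ≤ C * Real.exp (∑ j ∈ Finset.range N, (s (j + 1) - s j) * extR0 P j))
    (E : ℕ → ℝ) (hE0 : E 0 = 0) (hE : ∀ j, 0 < j → j ≤ N → 0 < E j) :
    ∃ C : ℝ, 0 ≤ C ∧ ∃ ε : ℝ, 0 < ε ∧ ∀ P : Fin N → ℝ,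
      g P * Real.exp (∑ j ∈ Finset.range N, (E (j + 1) - E j) * extR0 P j) ≤
        C * expWt N ε (extR0 P) := by
  obtain ⟨ε, hε, hεE⟩ : ∃ ε > 0, ∀ j, 0 < j → j ≤ N → 2 * ε ≤ E j := by
    have : ∀ᶠ ε in nhdsWithin (0 : ℝ) (Set.Ioi 0), ∀ j ∈ Finset.Icc 1 N, 2 * ε ≤ E j := by
      rw [Filter.eventually_all_finset]
      intro j hj
      have hj := Finset.mem_Icc.1 hj
      have := hE j (by omega) hj.2
      filter_upwards [Ioo_mem_nhdsGT (half_pos this)] with ε hε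
      linarith [hε.2]
    obtain ⟨ε, h1, h2⟩ := (this.and self_mem_nhdsWithin).exists
    exact ⟨ε, h2, fun j h h' => h1 j (Finset.mem_Icc.2 ⟨h, h'⟩)⟩
  set S : Finset ℕ → ℕ → ℝ := fun A j =>
    if j = 0 then 0 else if j ∈ A then -(|E j| + ε) else -ε with hS
  have hSg : ∀ A, ∃ C : ℝ, 0 ≤ C ∧ ∀ P : Fin N → ℝ, g P ≤
      C * Real.exp (∑ j ∈ Finset.range N, (S A (j + 1) - S A j) * extR0 P j) := by
    intro A
    refine hg _ (by simp [hS]) fun j h1 h2 => ?_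
    simp only [hS, h1.ne', if_false]
    split_ifs
    · linarith [abs_nonneg (E j)]
    · linarith
  choose C hC0 hC using hSg
  refine ⟨∑ A ∈ (Finset.range (N + 1)).powerset, C A, Finset.sum_nonneg fun A _ => hC0 A,
    ε / (N + 1), by positivity, fun P => ?_⟩
  set u : ℕ → ℝ := fun j => extR0 P j - if j + 1 < N then extR0 P (j + 1) else 0 with hu
  set A : Finset ℕ := (Finset.range (N + 1)).filter fun j => 0 ≤ u (j - 1) with hA
  have hAm : A ∈ (Finset.range (N + 1)).powerset := Finset.mem_powerset.2 (Finset.filter_subset _ _)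
  have h1 := mul_le_mul_of_nonneg_right (hC A P)
    (Real.exp_pos (∑ j ∈ Finset.range N, (E (j + 1) - E j) * extR0 P j)).le
  refine h1.trans ?_
  rw [mul_assoc, ← Real.exp_add]
  refine mul_le_mul (Finset.single_le_sum (fun A _ => hC0 A) hAm) ?_ (Real.exp_pos _).le
    (Finset.sum_nonneg fun A _ => hC0 A)
  rw [expWt, Real.exp_le_exp, sum_by_parts _ _ _ (by simp [hS]), sum_by_parts _ _ _ hE0,
    ← Finset.sum_add_distrib]
  have h2 : ∑ j ∈ Finset.range N, |extR0 P j| ≤ N * ∑ j ∈ Finset.range N, |u j| := by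
    refine (Finset.sum_le_card_nsmul _ _ (∑ j ∈ Finset.range N, |u j|) fun i hi =>
      abs_le_sum_diff N _ i (Finset.mem_range.1 hi)).trans_eq (by simp)
  have h3 : ∑ j ∈ Finset.range N, (S A (j + 1) * u j + E (j + 1) * u j) ≤
      ∑ j ∈ Finset.range N, -(ε * |u j|) := by
    refine Finset.sum_le_sum fun j hj => ?_
    have hj := Finset.mem_range.1 hj
    have hEj := hεE (j + 1) (by omega) (by omega)
    by_cases h : 0 ≤ u j
    · have : j + 1 ∈ A := by simp [hA, h, hj]
      simp only [hS, this, if_true, Nat.succ_ne_zero, if_false, abs_of_nonneg h]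
      nlinarith [le_abs_self (E (j + 1))]
    · have h' : j + 1 ∉ A := by simp [hA, h]
      simp only [hS, h', Nat.succ_ne_zero, if_false, abs_of_neg (not_le.1 h)]
      nlinarith
  refine h3.trans ?_
  rw [Finset.sum_neg_distrib, ← Finset.mul_sum, neg_le_neg_iff, div_mul_eq_mul_div,
    div_le_iff₀ (by positivity), mul_assoc]
  refine mul_le_mul_of_nonneg_left ?_ hε.le
  have : 0 ≤ ∑ j ∈ Finset.range N, |u j| := Finset.sum_nonneg fun j _ => abs_nonneg _
  nlinarith

theorem exists_le_neg {N : ℕ} {s : ℕ → ℝ} (hs : ∀ j, 0 < j → j ≤ N → s j < 0) :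
    ∃ η > 0, ∀ j, 0 < j → j ≤ N → s j ≤ -η := by
  have : ∀ᶠ ε in nhdsWithin (0 : ℝ) (Set.Ioi 0), ∀ j ∈ Finset.Icc 1 N, s j ≤ -ε := by
    rw [Filter.eventually_all_finset]
    intro j hj
    have hj := Finset.mem_Icc.1 hj
    have := hs j (by omega) hj.2
    filter_upwards [Ioo_mem_nhdsGT (neg_pos.2 this)] with ε hε
    linarith [hε.2]
  obtain ⟨ε, h1, h2⟩ := (this.and self_mem_nhdsWithin).exists
  exact ⟨ε, h2, fun j h h' => h1 j (Finset.mem_Icc.2 ⟨h, h'⟩)⟩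

theorem sum_extR0_succ {N : ℕ} (s : ℕ → ℝ) (P : Fin N → ℝ) :
    ∑ j ∈ Finset.range (N + 1), ((if j + 1 ≤ N then s (j + 1) else 0) -
      (if j ≤ N then s j else 0)) * extR0 P j =
    ∑ j ∈ Finset.range N, (s (j + 1) - s j) * extR0 P j := by
  rw [Finset.sum_range_succ, extR0_of_le P le_rfl, mul_zero, add_zero]
  refine Finset.sum_congr rfl fun j hj => ?_
  have hj := Finset.mem_range.1 hj
  rw [if_pos (by omega), if_pos (by omega)]

theorem toda_expWt_bound {N : ℕ} {b : ℕ → ℂ} (hb : ∀ j < N + 1, (b j).re = 0)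
    (E : ℕ → ℝ) (hE0 : E 0 = 0) (hE : ∀ j, 0 < j → j ≤ N → 0 < E j) :
    ∃ C : ℝ, 0 ≤ C ∧ ∃ ε : ℝ, 0 < ε ∧ ∀ P : Fin N → ℝ,
      ‖toda (N + 1) b (extR0 P)‖ *
        Real.exp (∑ j ∈ Finset.range N, (E (j + 1) - E j) * extR0 P j) ≤
        C * expWt N ε (extR0 P) := by
  refine exists_expWt_bound N _ (fun s hs0 hs => ?_) E hE0 hE
  obtain ⟨η, hη, hs'⟩ := exists_le_neg hs
  obtain ⟨C, hC0, hC⟩ := toda_bound (n := N + 1) (c := b)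
    (s := fun j => if j ≤ N then s j else 0) hη (fun j _ h => hb j h) (by simp [hs0])
    (by simp [hb 0]) fun j h1 h2 => by
      rw [hb 0 (by omega), if_pos (by omega)]; simpa using hs' j h1 (by omega)
  exact ⟨C, hC0, fun P => by simpa only [sum_extR0_succ] using hC (extR0 P)⟩

theorem toda_integrand_expWt_bound {N : ℕ} {b : ℕ → ℂ} (hb : ∀ j < N + 1, (b j).re = 0)
    (E : ℕ → ℝ) (hE0 : E 0 = 0) (hE : ∀ j, 0 < j → j ≤ N → 0 < E j) :
    ∃ C : ℝ, 0 ≤ C ∧ ∃ ε : ℝ, 0 < ε ∧ ∀ P : Fin N → ℝ,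
      (∫ z : Fin N → ℝ, ‖kLam N (b 0) (extR0 P) (extR0 z) *
          toda N (fun j => b (j + 1)) (extR0 z)‖) *
        Real.exp (∑ j ∈ Finset.range N, (E (j + 1) - E j) * extR0 P j) ≤
        C * expWt N ε (extR0 P) := by
  refine exists_expWt_bound N _ (fun s hs0 hs => ?_) E hE0 hE
  obtain ⟨η, hη, hs'⟩ := exists_le_neg hs
  obtain ⟨C, hC0, hC⟩ := toda_integrand_bound (n := N) (c := b)
    (s := fun j => if j ≤ N then s j else 0) hη (fun j _ h => hb j h) (by simp [hs0])
    (by simp [hb 0]) fun j h1 h2 => by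
      rw [hb 0 (by omega), if_pos (by omega)]; simpa using hs' j h1 (by omega)
  exact ⟨C, hC0, fun P => by simpa only [sum_extR0_succ] using (hC (extR0 P)).2⟩

theorem toda_cut_expWt_bound {n : ℕ} {b : ℕ → ℂ} (hb : ∀ j < n + 1, (b j).re = 0)
    (E : ℕ → ℝ) (hE0 : E 0 = 0) (hE : ∀ j, 0 < j → j ≤ n + 1 → 0 < E j) :
    ∃ C : ℝ, 0 ≤ C ∧ ∃ ε : ℝ, 0 < ε ∧ ∀ x : Fin (n + 1) → ℝ,
      (Real.exp (-Real.exp (extR0 x n)) * ‖toda (n + 1) b (extR0 x)‖) *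
        Real.exp (∑ j ∈ Finset.range (n + 1), (E (j + 1) - E j) * extR0 x j) ≤
        C * expWt (n + 1) ε (extR0 x) := by
  refine exists_expWt_bound (n + 1) _ (fun s hs0 hs => ?_) E hE0 hE
  obtain ⟨η, hη, hs'⟩ := exists_le_neg hs
  obtain ⟨C, hC0, hC⟩ := toda_bound (n := n + 1) (c := b)
    (s := fun j => if j ≤ n then s j else 0) hη (fun j _ h => hb j h) (by simp [hs0])
    (by simp [hb 0]) fun j h1 h2 => by
      rw [hb 0 (by omega), if_pos (by omega)]; simpa using hs' j h1 (by omega)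
  have hk : 0 ≤ -s (n + 1) := by linarith [hs (n + 1) (by omega) le_rfl]
  refine ⟨Real.exp (-s (n + 1) * Real.log (-s (n + 1)) - -s (n + 1)) * C, by positivity,
    fun x => (mul_le_mul (exp_neg_exp_le hk _) (hC _) (norm_nonneg _) (by positivity)).trans_eq ?_⟩
  rw [mul_mul_mul_comm, ← Real.exp_add]
  congr 2
  rw [Finset.sum_range_succ, Finset.sum_range_succ]
  simp only [Nat.not_succ_le_self, if_false, le_refl, if_true]
  have : ∑ j ∈ Finset.range n, ((if j + 1 ≤ n then s (j + 1) else 0) -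
      (if j ≤ n then s j else 0)) * extR0 x j =
      ∑ j ∈ Finset.range n, (s (j + 1) - s j) * extR0 x j :=
    Finset.sum_congr rfl fun j hj => by
      have hj := Finset.mem_range.1 hj
      rw [if_pos (by omega), if_pos (by omega)]
  rw [this]
  ring

/-- The exponents `E_j = jσ + s_j` with `s` the a priori exponents. -/
theorem bdExp_add_pos {n : ℕ} {δ η σ : ℝ} (hδ : 0 ≤ δ) (hη : η < σ) (h0 : 0 < η) (j : ℕ)
    (hj : 0 < j) : 0 < j * σ + bdExp n δ η j := by
  have : (1 : ℝ) ≤ j := by exact_mod_cast hj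
  unfold bdExp
  rw [if_neg hj.ne']
  split_ifs
  · rw [min_eq_left hδ]; nlinarith
  · nlinarith

theorem norm_cexp_mul_sum (σ : ℂ) (n : ℕ) (x : ℕ → ℝ) :
    ‖cexp (σ * ((∑ j ∈ Finset.range n, x j : ℝ) : ℂ))‖ =
      Real.exp (∑ j ∈ Finset.range n, σ.re * x j) := by
  rw [Complex.norm_exp, re_mul_ofReal, Finset.mul_sum]

/-! ### Stade's formula -/

/-- The `GL_{n+1} × GL_n` zeta integral of two Toda eigenfunctions. -/
def stadeA (n : ℕ) (σ : ℂ) (b b' : ℕ → ℂ) : ℂ :=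
  ∫ P : Fin n → ℝ, cexp (σ * ((∑ j ∈ Finset.range n, extR0 P j : ℝ) : ℂ)) *
    toda (n + 1) b (extR0 P) * toda n b' (extR0 P)

/-- The `GL_{n+1} × GL_{n+1}` zeta integral of two Toda eigenfunctions. -/
def stadeB (n : ℕ) (σ : ℂ) (b b' : ℕ → ℂ) : ℂ :=
  ∫ x : Fin (n + 1) → ℝ, cexp (σ * ((∑ j ∈ Finset.range (n + 1), extR0 x j : ℝ) : ℂ)) *
    Real.exp (-Real.exp (extR0 x n)) * toda (n + 1) b (extR0 x) * toda (n + 1) b' (extR0 x)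

theorem cexp_mul_kLam_eq_kQ (n : ℕ) (σ l : ℂ) (x z : ℕ → ℝ) (hz : z n = 0) :
    cexp (σ * ((∑ j ∈ Finset.range (n + 1), x j : ℝ) : ℂ)) * Real.exp (-Real.exp (x n)) *
      kLam n l x z =
    cexp (σ * ((∑ j ∈ Finset.range n, z j : ℝ) : ℂ)) * kQ (n + 1) (σ + l) x z := by
  rw [kLam_eq, kQ_eq, ofReal_exp, ← Complex.exp_add, ← Complex.exp_add, ← Complex.exp_add]
  congr 1
  have h : ∑ j ∈ Finset.range (n + 1), (Real.exp (x j - z j) +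
      if j + 1 < n + 1 then Real.exp (z j - x (j + 1)) else 0) =
      ∑ j ∈ Finset.range n, (Real.exp (x j - z j) + Real.exp (z j - x (j + 1))) +
        Real.exp (x n) := by
    rw [Finset.sum_range_succ, hz]
    simp only [lt_irrefl, if_false, add_zero, sub_zero]
    congr 1
    exact Finset.sum_congr rfl fun j hj => by rw [if_pos (by simpa using hj)]
  rw [h, Finset.sum_range_succ z, hz]
  push_cast
  ring

theorem cexp_mul_kLam_eq_kQ' (n : ℕ) (σ l : ℂ) (x z : ℕ → ℝ) (hx : x (n + 1) = 0) :
    cexp (σ * ((∑ j ∈ Finset.range (n + 1), x j : ℝ) : ℂ)) * kLam (n + 1) l x z =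
    cexp (σ * ((∑ j ∈ Finset.range (n + 1), z j : ℝ) : ℂ)) * Real.exp (-Real.exp (z n)) *
      kQ (n + 1) (σ + l) x z := by
  rw [kLam_eq, kQ_eq, ofReal_exp, ← Complex.exp_add, ← Complex.exp_add, ← Complex.exp_add]
  congr 1
  have h : ∑ j ∈ Finset.range (n + 1), (Real.exp (x j - z j) + Real.exp (z j - x (j + 1))) =
      ∑ j ∈ Finset.range (n + 1), (Real.exp (x j - z j) +
        if j + 1 < n + 1 then Real.exp (z j - x (j + 1)) else 0) + Real.exp (z n) := by
    rw [Finset.sum_range_succ, Finset.sum_range_succ _ n, hx]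
    simp only [lt_irrefl, if_false, add_zero, sub_zero, ← add_assoc]
    congr 2
    exact Finset.sum_congr rfl fun j hj => by rw [if_pos (by simpa using hj)]
  rw [h, Finset.sum_range_succ x (n + 1), hx]
  push_cast
  ring

theorem continuous_cexp_sum (σ : ℂ) (n m : ℕ) : Continuous fun x : Fin m → ℝ =>
    cexp (σ * ((∑ j ∈ Finset.range n, extR0 x j : ℝ) : ℂ)) := by
  fun_prop

theorem stadeB_eq (n : ℕ) {σ : ℂ} {b b' : ℕ → ℂ} (hσ : 0 < σ.re)
    (hb : ∀ j < n + 1, (b j).re = 0) (hb' : ∀ j, 0 < j → j < n + 1 → (b' j).re = 0)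
    (hb0 : 0 ≤ (b' 0).re) :
    stadeB n σ b b' = (∏ j ∈ Finset.range (n + 1), Complex.Gamma (σ + b' 0 + b j)) *
      stadeA n σ b (fun j => b' (j + 1)) := by
  have hη : 0 < σ.re / 2 := half_pos hσ
  obtain ⟨C, hC0, hC⟩ := toda_integrand_bound' (n := n) (c := b') hη hb'
  obtain ⟨D, hD0, ε, hε, hD⟩ := toda_cut_expWt_bound hb
    (fun j => j * σ.re + bdExp (n + 1) (b' 0).re (σ.re / 2) j) (by simp [bdExp])
    (fun j h _ => bdExp_add_pos hb0 (by linarith) hη j h)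
  set f : (Fin (n + 1) → ℝ) → ℂ := fun x =>
    cexp (σ * ((∑ j ∈ Finset.range (n + 1), extR0 x j : ℝ) : ℂ)) *
    Real.exp (-Real.exp (extR0 x n)) * toda (n + 1) b (extR0 x) with hf
  have hfm : AEStronglyMeasurable f :=
    (((continuous_cexp_sum σ _ _).mul (by fun_prop)).stronglyMeasurable.mul
      (stronglyMeasurable_toda_extR0 _ _ _)).aestronglyMeasurable
  have hF : Integrable (fun q : (Fin (n + 1) → ℝ) × (Fin n → ℝ) =>
      f q.1 * (kLam n (b' 0) (extR0 q.1) (extR0 q.2) *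
        toda n (fun j => b' (j + 1)) (extR0 q.2))) (volume.prod volume) := by
    refine integrable_prod_mul_of_le hfm
      (stronglyMeasurable_kLam_mul_toda _ _ _ _ _).aestronglyMeasurable
      (fun y => (hC (extR0 y)).1) (fun y => (hC (extR0 y)).2) ?_
    refine ((integrable_expWt (n + 1) hε).const_mul D).mono'
      (hfm.norm.mul (by fun_prop)) (Filter.Eventually.of_forall fun x => ?_)
    refine le_trans (le_of_eq ?_) (hD x)
    rw [Real.norm_of_nonneg (by positivity)]
    simp only [hf, norm_mul, norm_cexp_mul_sum, Complex.norm_real, Real.norm_eq_abs, Real.abs_exp]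
    have : ∑ j ∈ Finset.range (n + 1), ((((j + 1 : ℕ) : ℝ) * σ.re +
        bdExp (n + 1) (b' 0).re (σ.re / 2) (j + 1)) - (j * σ.re +
        bdExp (n + 1) (b' 0).re (σ.re / 2) j)) * extR0 x j =
        ∑ j ∈ Finset.range (n + 1), σ.re * extR0 x j + ∑ j ∈ Finset.range (n + 1),
        (bdExp (n + 1) (b' 0).re (σ.re / 2) (j + 1) -
          bdExp (n + 1) (b' 0).re (σ.re / 2) j) * extR0 x j := by
      rw [← Finset.sum_add_distrib]
      refine Finset.sum_congr rfl fun j _ => ?_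
      push_cast
      ring
    rw [this, Real.exp_add]
    ring
  calc stadeB n σ b b' = ∫ x : Fin (n + 1) → ℝ, ∫ z : Fin n → ℝ,
        f x * (kLam n (b' 0) (extR0 x) (extR0 z) * toda n (fun j => b' (j + 1)) (extR0 z)) := by
        simp_rw [stadeB, toda_succ n b', integral_const_mul, hf]
    _ = ∫ z : Fin n → ℝ, ∫ x : Fin (n + 1) → ℝ,
        f x * (kLam n (b' 0) (extR0 x) (extR0 z) * toda n (fun j => b' (j + 1)) (extR0 z)) :=
        integral_integral_swap hF
    _ = _ := by
        rw [stadeA, ← integral_const_mul]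
        congr 1 with z
        have : ∀ x : Fin (n + 1) → ℝ, f x * (kLam n (b' 0) (extR0 x) (extR0 z) *
            toda n (fun j => b' (j + 1)) (extR0 z)) =
            (cexp (σ * ((∑ j ∈ Finset.range n, extR0 z j : ℝ) : ℂ)) *
              toda n (fun j => b' (j + 1)) (extR0 z)) *
            (kQ (n + 1) (σ + b' 0) (extR0 x) (extR0 z) * toda (n + 1) b (extR0 x)) := fun x => by
          have := cexp_mul_kLam_eq_kQ n σ (b' 0) (extR0 x) (extR0 z) (extR0_of_le z le_rfl)
          simp only [hf]
          linear_combination (toda (n + 1) b (extR0 x) *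
            toda n (fun j => b' (j + 1)) (extR0 z)) * this
        simp_rw [this]
        rw [integral_const_mul, baxter_transpose_eigen (fun j _ h => hb j h)
          (by simp; linarith) (Or.inr (by simp [hb 0]; linarith))]
        ring

theorem stadeA_eq (n : ℕ) {σ : ℂ} {b b' : ℕ → ℂ} (hσ : 0 < σ.re)
    (hb : ∀ j < n + 2, (b j).re = 0) (hb' : ∀ j, 0 < j → j < n + 1 → (b' j).re = 0)
    (hb0 : 0 ≤ (b' 0).re) :
    stadeA (n + 1) σ b b' = (∏ j ∈ Finset.range (n + 1), Complex.Gamma (σ + b 0 + b' j)) *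
      stadeB n σ (fun j => b (j + 1)) b' := by
  have hη : 0 < σ.re / 2 := half_pos hσ
  obtain ⟨C, hC0, hC⟩ := toda_bound' (n := n + 1) (c := b') hη hb'
  obtain ⟨C', -, hC'⟩ := toda_integrand_bound' (n := n + 1) (c := b) hη fun j _ h => hb j h
  obtain ⟨D, hD0, ε, hε, hD⟩ := toda_integrand_expWt_bound (N := n + 1) hb
    (fun j => j * σ.re + bdExp (n + 1) (b' 0).re (σ.re / 2) j) (by simp [bdExp])
    (fun j h _ => bdExp_add_pos hb0 (by linarith) hη j h)
  set f : (Fin (n + 1) → ℝ) → ℂ := fun x =>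
    cexp (σ * ((∑ j ∈ Finset.range (n + 1), extR0 x j : ℝ) : ℂ)) *
      toda (n + 1) b' (extR0 x) with hf
  have hfm : AEStronglyMeasurable f :=
    ((continuous_cexp_sum σ _ _).stronglyMeasurable.mul
      (stronglyMeasurable_toda_extR0 _ _ _)).aestronglyMeasurable
  have hKm := (stronglyMeasurable_kLam_mul_toda (n + 1) (n + 1) (n + 1) (b 0)
    (fun j => b (j + 1))).norm
  have hF : Integrable (fun q : (Fin (n + 1) → ℝ) × (Fin (n + 1) → ℝ) =>
      f q.1 * (kLam (n + 1) (b 0) (extR0 q.1) (extR0 q.2) *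
        toda (n + 1) (fun j => b (j + 1)) (extR0 q.2))) (volume.prod volume) := by
    refine integrable_prod_mul_of_le (C := 1) (h := fun P => ∫ z : Fin (n + 1) → ℝ,
        ‖kLam (n + 1) (b 0) (extR0 P) (extR0 z) *
          toda (n + 1) (fun j => b (j + 1)) (extR0 z)‖) hfm
      (stronglyMeasurable_kLam_mul_toda _ _ _ _ _).aestronglyMeasurable
      (fun y => (hC' (extR0 y)).1) (fun y => by rw [one_mul]) ?_
    refine ((integrable_expWt (n + 1) hε).const_mul (C * D)).mono'
      (hfm.norm.mul hKm.integral_prod_right'.aestronglyMeasurable)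
      (Filter.Eventually.of_forall fun x => ?_)
    have hI : 0 ≤ ∫ z : Fin (n + 1) → ℝ, ‖kLam (n + 1) (b 0) (extR0 x) (extR0 z) *
          toda (n + 1) (fun j => b (j + 1)) (extR0 z)‖ := integral_nonneg fun _ => norm_nonneg _
    rw [Real.norm_of_nonneg (mul_nonneg (norm_nonneg _) hI), mul_assoc]
    refine le_trans ?_ (mul_le_mul_of_nonneg_left (hD x) hC0)
    rw [mul_comm ‖f x‖, mul_left_comm]
    refine mul_le_mul_of_nonneg_left ?_ hI
    simp only [hf, norm_mul, norm_cexp_mul_sum]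
    refine (mul_le_mul_of_nonneg_left (hC _) (Real.exp_pos _).le).trans_eq ?_
    rw [mul_left_comm, ← Real.exp_add, ← Finset.sum_add_distrib]
    congr 2
    refine Finset.sum_congr rfl fun j _ => ?_
    push_cast
    ring
  calc stadeA (n + 1) σ b b' = ∫ x : Fin (n + 1) → ℝ, ∫ z : Fin (n + 1) → ℝ,
        f x * (kLam (n + 1) (b 0) (extR0 x) (extR0 z) *
          toda (n + 1) (fun j => b (j + 1)) (extR0 z)) := by
        simp_rw [stadeA, toda_succ (n + 1) b, integral_const_mul, hf]
        congr 1 with x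
        ring
    _ = ∫ z : Fin (n + 1) → ℝ, ∫ x : Fin (n + 1) → ℝ,
        f x * (kLam (n + 1) (b 0) (extR0 x) (extR0 z) *
          toda (n + 1) (fun j => b (j + 1)) (extR0 z)) :=
        integral_integral_swap hF
    _ = _ := by
        rw [stadeB, ← integral_const_mul]
        congr 1 with z
        have : ∀ x : Fin (n + 1) → ℝ, f x * (kLam (n + 1) (b 0) (extR0 x) (extR0 z) *
            toda (n + 1) (fun j => b (j + 1)) (extR0 z)) =
            (cexp (σ * ((∑ j ∈ Finset.range (n + 1), extR0 z j : ℝ) : ℂ)) *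
              Real.exp (-Real.exp (extR0 z n)) *
              toda (n + 1) (fun j => b (j + 1)) (extR0 z)) *
            (kQ (n + 1) (σ + b 0) (extR0 x) (extR0 z) * toda (n + 1) b' (extR0 x)) := fun x => by
          have := cexp_mul_kLam_eq_kQ' n σ (b 0) (extR0 x) (extR0 z) (extR0_of_le x le_rfl)
          simp only [hf]
          linear_combination (toda (n + 1) b' (extR0 x) *
            toda (n + 1) (fun j => b (j + 1)) (extR0 z)) * this
        simp_rw [this]
        rw [integral_const_mul, baxter_transpose_eigen hb'
          (by simp [hb 0]; linarith) (Or.inr (by simp [hb 0]; linarith))]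
        ring

/-- Stade's formula for the archimedean `GL_{n+1} × GL_n` zeta integral. -/
theorem stade_formula (n : ℕ) {σ : ℂ} {b b' : ℕ → ℂ} (hσ : 0 < σ.re)
    (hb : ∀ j < n + 1, (b j).re = 0) (hb' : ∀ j, 0 < j → j < n → (b' j).re = 0)
    (hb0 : n = 0 ∨ 0 ≤ (b' 0).re) :
    stadeA n σ b b' = ∏ j ∈ Finset.range (n + 1), ∏ k ∈ Finset.range n,
      Complex.Gamma (σ + b j + b' k) := by
  induction n generalizing b b' with
  | zero =>
    simp [stadeA, toda, kLam, prodKer, measureReal_def, volume_pi, extR0]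
  | succ n ih =>
    have hb0' := hb0.resolve_left (by omega)
    rw [stadeA_eq n hσ hb hb' hb0', stadeB_eq n hσ (fun j hj => hb (j + 1) (by omega)) hb' hb0',
      ih (fun j hj => hb (j + 1) (by omega)) (fun j _ hj => hb' (j + 1) (by omega) (by omega)) ?_]
    · rw [Finset.prod_range_succ' _ (n + 1), mul_comm, ← Finset.prod_mul_distrib]
      congr 1
      refine Finset.prod_congr rfl fun j _ => ?_
      rw [Finset.prod_range_succ', mul_comm]
      congr 2
      ring
    · rcases Nat.eq_zero_or_pos n with h | h
      · exact Or.inl h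
      · right; rw [hb' (0 + 1) (by omega) (by omega)]

/-! ### Peeling off the last variable -/

theorem extR0_snoc_lt {n : ℕ} (y : Fin n → ℝ) (t : ℝ) {j : ℕ} (hj : j < n) :
    extR0 (Fin.snoc y t : Fin (n + 1) → ℝ) j = extR0 y j := by
  rw [extR0_of_lt _ (by omega : j < n + 1), extR0_of_lt _ hj]
  exact Fin.snoc_castSucc (α := fun _ => ℝ) t y ⟨j, hj⟩

theorem extR0_snoc_self {n : ℕ} (y : Fin n → ℝ) (t : ℝ) :
    extR0 (Fin.snoc y t : Fin (n + 1) → ℝ) n = t := by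
  rw [extR0_of_lt _ (by omega : n < n + 1)]
  exact Fin.snoc_last (α := fun _ => ℝ) t y

theorem measurePreserving_snoc (n : ℕ) :
    MeasurePreserving (fun q : ℝ × (Fin n → ℝ) => (Fin.snoc q.2 q.1 : Fin (n + 1) → ℝ))
      (volume.prod volume) volume := by
  have h := (volume_preserving_piFinSuccAbove (fun _ : Fin (n + 1) => ℝ) (Fin.last n)).symm
  have e : (fun q : ℝ × (Fin n → ℝ) => (Fin.snoc q.2 q.1 : Fin (n + 1) → ℝ)) =
      (MeasurableEquiv.piFinSuccAbove (fun _ : Fin (n + 1) => ℝ) (Fin.last n)).symm := by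
    funext q
    exact (Fin.insertNth_last' q.1 q.2).symm
  rw [e]
  exact h

theorem integral_eq_integral_snoc {n : ℕ} {f : (Fin (n + 1) → ℝ) → ℂ} (hf : Integrable f) :
    ∫ x, f x = ∫ t : ℝ, ∫ y : Fin n → ℝ, f (Fin.snoc y t) := by
  have h := measurePreserving_snoc n
  have h1 := (h.integrable_comp hf.aestronglyMeasurable).2 hf
  have h2 := integral_map h.measurable.aemeasurable (f := f)
    (by rw [h.map_eq]; exact hf.aestronglyMeasurable)
  rw [h.map_eq] at h2
  rw [h2]
  exact integral_prod _ h1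

/-! ### A chain of Gaussian integrals -/

theorem integral_gaussian_phase (p z θ : ℝ) :
    ∫ t : ℝ, cexp (-((Real.exp (p - z) * t ^ 2 : ℝ) : ℂ) +
      2 * I * ((Real.exp (p / 2) * t * θ : ℝ) : ℂ)) =
    ((Real.sqrt Real.pi * Real.exp ((z - p) / 2) * Real.exp (-(Real.exp z * θ ^ 2)) : ℝ) : ℂ) := by
  have h := fourierIntegral_gaussian (b := ((Real.exp (p - z) : ℝ) : ℂ))
    (by rw [ofReal_re]; exact Real.exp_pos _) ((2 * Real.exp (p / 2) * θ : ℝ) : ℂ)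
  have h1 : ((Real.pi : ℂ) / ((Real.exp (p - z) : ℝ) : ℂ)) ^ (1 / 2 : ℂ) =
      ((Real.sqrt Real.pi * Real.exp ((z - p) / 2) : ℝ) : ℂ) := by
    have : ((Real.pi : ℂ) / ((Real.exp (p - z) : ℝ) : ℂ)) =
        ((Real.pi * Real.exp (z - p) : ℝ) : ℂ) := by
      rw [← ofReal_div, div_eq_mul_inv, ← Real.exp_neg, neg_sub]
    rw [this, show (1 / 2 : ℂ) = ((1 / 2 : ℝ) : ℂ) by push_cast; rfl,
      ← ofReal_cpow (by positivity), ← Real.sqrt_eq_rpow, Real.sqrt_mul Real.pi_pos.le,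
      Real.exp_half]
  have h2 : -((2 * Real.exp (p / 2) * θ : ℝ) : ℂ) ^ 2 / (4 * ((Real.exp (p - z) : ℝ) : ℂ)) =
      ((-(Real.exp z * θ ^ 2) : ℝ) : ℂ) := by
    have : Real.exp z * Real.exp (p - z) = Real.exp (p / 2) ^ 2 := by
      rw [← Real.exp_add, ← Real.exp_nat_mul]; congr 1; push_cast; ring
    rw [div_eq_iff (by norm_cast; positivity)]
    norm_cast
    linear_combination (4 * θ ^ 2) * this
  rw [h1, h2, ← ofReal_exp, ← ofReal_mul] at h
  rw [← h]
  congr 1 with t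
  rw [← Complex.exp_add]
  congr 1
  push_cast
  ring

/-- The exponent of the chain of Gaussian integrals. -/
def chainExp (m : ℕ) (p z τ : ℕ → ℝ) : ℂ :=
  ∑ j ∈ Finset.range (m + 1), -((Real.exp (p j - z j) * τ j ^ 2 : ℝ) : ℂ) +
  ∑ j ∈ Finset.range m, (-((Real.exp (z j - p (j + 1)) / (1 + τ (j + 1) ^ 2) : ℝ) : ℂ) +
    2 * I * ((Real.exp ((p j - p (j + 1)) / 2) * (τ j * τ (j + 1)) /
      Real.sqrt (1 + τ (j + 1) ^ 2) : ℝ) : ℂ))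

theorem continuous_chainExp (m : ℕ) (p z : ℕ → ℝ) : Continuous (chainExp m p z) := by
  unfold chainExp
  have h : ∀ (τ : ℕ → ℝ) j, 1 + τ j ^ 2 ≠ 0 := fun τ j => by positivity
  have h' : ∀ (τ : ℕ → ℝ) j, Real.sqrt (1 + τ j ^ 2) ≠ 0 := fun τ j => by positivity
  refine Continuous.add (by fun_prop) (continuous_finsetSum _ fun j _ => ?_)
  refine Continuous.add (Continuous.neg (continuous_ofReal.comp ?_))
    (continuous_const.mul (continuous_ofReal.comp ?_))
  · exact Continuous.div (by fun_prop) (by fun_prop) fun τ => h τ _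
  · exact Continuous.div (by fun_prop) (by fun_prop) fun τ => h' τ _

theorem norm_cexp_chainExp_le (m : ℕ) (p z τ : ℕ → ℝ) (u : ℝ) :
    ‖cexp (chainExp m p z τ + 2 * I * (u : ℂ))‖ ≤
      ∏ j ∈ Finset.range (m + 1), Real.exp (-Real.exp (p j - z j) * τ j ^ 2) := by
  rw [Complex.norm_exp, ← Real.exp_sum, Real.exp_le_exp]
  have : (chainExp m p z τ + 2 * I * (u : ℂ)).re =
      ∑ j ∈ Finset.range (m + 1), -Real.exp (p j - z j) * τ j ^ 2 +
      ∑ j ∈ Finset.range m, -(Real.exp (z j - p (j + 1)) / (1 + τ (j + 1) ^ 2)) := by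
    simp only [chainExp, add_re, re_sum, neg_re, ofReal_re, mul_re, I_re, I_im, ofReal_im, mul_im,
      re_ofNat, im_ofNat]
    simp
  rw [this]
  have : ∑ j ∈ Finset.range m, -(Real.exp (z j - p (j + 1)) / (1 + τ (j + 1) ^ 2)) ≤ 0 :=
    Finset.sum_nonpos fun j _ => neg_nonpos.2 (by positivity)
  linarith

theorem integrable_cexp_chainExp (m : ℕ) (p z : ℕ → ℝ) (θ : ℝ) :
    Integrable fun τ : Fin (m + 1) → ℝ => cexp (chainExp m p z (extR0 τ) +
      2 * I * ((Real.exp (p m / 2) * extR0 τ m * θ : ℝ) : ℂ)) := by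
  have h := integrable_prod_extR0_real (n := m + 1)
    (f := fun j t => Real.exp (-Real.exp (p j - z j) * t ^ 2))
    fun j _ => integrable_exp_neg_mul_sq (Real.exp_pos _)
  refine h.mono' ?_ (Filter.Eventually.of_forall fun τ => norm_cexp_chainExp_le _ _ _ _ _)
  have := (continuous_chainExp m p z).comp (continuous_extR0 (m + 1))
  exact Continuous.aestronglyMeasurable (by fun_prop)

theorem chainExp_succ (m : ℕ) (p z τ : ℕ → ℝ) : chainExp (m + 1) p z τ = chainExp m p z τ +
    (-((Real.exp (p (m + 1) - z (m + 1)) * τ (m + 1) ^ 2 : ℝ) : ℂ) +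
    (-((Real.exp (z m - p (m + 1)) / (1 + τ (m + 1) ^ 2) : ℝ) : ℂ) +
    2 * I * ((Real.exp ((p m - p (m + 1)) / 2) * (τ m * τ (m + 1)) /
      Real.sqrt (1 + τ (m + 1) ^ 2) : ℝ) : ℂ))) := by
  unfold chainExp
  rw [Finset.sum_range_succ (fun j => -((Real.exp (p j - z j) * τ j ^ 2 : ℝ) : ℂ)) (m + 1)]
  conv_lhs => rhs; rw [Finset.sum_range_succ _ m]
  ring

theorem chainExp_congr {m : ℕ} (p z : ℕ → ℝ) {τ τ' : ℕ → ℝ} (h : ∀ j < m + 1, τ j = τ' j) :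
    chainExp m p z τ = chainExp m p z τ' := by
  unfold chainExp
  congr 1
  · exact Finset.sum_congr rfl fun j hj => by rw [h j (Finset.mem_range.1 hj)]
  · refine Finset.sum_congr rfl fun j hj => ?_
    have hj := Finset.mem_range.1 hj
    rw [h j (by omega), h (j + 1) (by omega)]

theorem integral_cexp_chainExp (m : ℕ) (p z : ℕ → ℝ) (θ : ℝ) :
    ∫ τ : Fin (m + 1) → ℝ, cexp (chainExp m p z (extR0 τ) +
      2 * I * ((Real.exp (p m / 2) * extR0 τ m * θ : ℝ) : ℂ)) =
    (((∏ j ∈ Finset.range (m + 1), (Real.sqrt Real.pi * Real.exp ((z j - p j) / 2))) *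
      Real.exp (-(∑ j ∈ Finset.range m, Real.exp (z j - p (j + 1)) + Real.exp (z m) * θ ^ 2)) :
      ℝ) : ℂ) := by
  induction m generalizing θ with
  | zero =>
    have h := integral_prod_extR0 (n := 1) fun _ t => cexp (-((Real.exp (p 0 - z 0) * t ^ 2 : ℝ) : ℂ) +
      2 * I * ((Real.exp (p 0 / 2) * t * θ : ℝ) : ℂ))
    simp only [Finset.prod_range_one] at h
    rw [integral_gaussian_phase] at h
    simpa [chainExp] using h
  | succ m ih =>
    rw [integral_eq_integral_snoc (integrable_cexp_chainExp (m + 1) p z θ)]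
    have key : ∀ t : ℝ, ∫ y : Fin m.succ → ℝ, cexp (chainExp (m + 1) p z
        (extR0 (Fin.snoc y t : Fin (m + 1 + 1) → ℝ)) + 2 * I * ((Real.exp (p (m + 1) / 2) *
          extR0 (Fin.snoc y t : Fin (m + 1 + 1) → ℝ) (m + 1) * θ : ℝ) : ℂ)) =
        (((∏ j ∈ Finset.range (m + 1), (Real.sqrt Real.pi * Real.exp ((z j - p j) / 2))) *
          Real.exp (-(∑ j ∈ Finset.range (m + 1), Real.exp (z j - p (j + 1)))) : ℝ) : ℂ) *
        cexp (-((Real.exp (p (m + 1) - z (m + 1)) * t ^ 2 : ℝ) : ℂ) +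
          2 * I * ((Real.exp (p (m + 1) / 2) * t * θ : ℝ) : ℂ)) := by
      intro t
      set θ' : ℝ := Real.exp (-(p (m + 1) / 2)) * t / Real.sqrt (1 + t ^ 2) with hθ'
      have h1 : ∀ y : Fin (m + 1) → ℝ, cexp (chainExp (m + 1) p z
          (extR0 (Fin.snoc y t : Fin (m + 1 + 1) → ℝ)) + 2 * I * ((Real.exp (p (m + 1) / 2) *
          extR0 (Fin.snoc y t : Fin (m + 1 + 1) → ℝ) (m + 1) * θ : ℝ) : ℂ)) =
          cexp (chainExp m p z (extR0 y) +
            2 * I * ((Real.exp (p m / 2) * extR0 y m * θ' : ℝ) : ℂ)) *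
          (cexp (-((Real.exp (z m - p (m + 1)) / (1 + t ^ 2) : ℝ) : ℂ)) *
          cexp (-((Real.exp (p (m + 1) - z (m + 1)) * t ^ 2 : ℝ) : ℂ) +
          2 * I * ((Real.exp (p (m + 1) / 2) * t * θ : ℝ) : ℂ))) := by
        intro y
        rw [chainExp_succ, extR0_snoc_self, extR0_snoc_lt y t (Nat.lt_succ_self m),
          chainExp_congr p z (fun j hj => extR0_snoc_lt y t hj), ← Complex.exp_add,
          ← Complex.exp_add]
        congr 1
        have : Real.exp ((p m - p (m + 1)) / 2) * (extR0 y m * t) / Real.sqrt (1 + t ^ 2) =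
            Real.exp (p m / 2) * extR0 y m * θ' := by
          rw [hθ', sub_div, Real.exp_sub, Real.exp_neg]
          ring
        rw [this]
        ring
      simp_rw [h1]
      rw [integral_mul_const, ih, ← mul_assoc]
      congr 1
      rw [← ofReal_neg, ← ofReal_exp, ← ofReal_mul, mul_assoc, ← Real.exp_add]
      congr 3
      rw [Finset.sum_range_succ _ m]
      have : Real.exp (z m) * θ' ^ 2 = Real.exp (z m - p (m + 1)) * (t ^ 2 / (1 + t ^ 2)) := by
        rw [hθ', div_pow, mul_pow, Real.sq_sqrt (by positivity), ← Real.exp_nat_mul, Real.exp_sub,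
          show ((2 : ℕ) : ℝ) * -(p (m + 1) / 2) = -p (m + 1) by push_cast; ring, Real.exp_neg]
        ring
      rw [this]
      field_simp
      ring
    simp_rw [key]
    rw [integral_const_mul, integral_gaussian_phase, ← ofReal_mul]
    congr 1
    rw [Finset.prod_range_succ _ (m + 1), neg_add, Real.exp_add]
    ring

theorem integrable_prodKer (n : ℕ) (κ : ℕ → ℂ) (u v : ℕ → ℝ) :
    Integrable fun z : Fin n → ℝ =>
      prodKer n (fun j => Real.exp (u j)) (fun j => Real.exp (v j)) κ (extR0 z) := by
  obtain ⟨C, _, hC⟩ := prodKer_bound n κ (fun j => |(κ j).re| + 1) fun j _ => by positivity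
  refine (hC u (fun j => -v j) _ fun j _ => Or.inl ⟨?_, by simp⟩).1
  linarith [neg_abs_le (κ j).re]

theorem norm_prodKer_le {n : ℕ} {α α' β β' : ℕ → ℝ} (κ : ℕ → ℂ) (z : ℕ → ℝ)
    (hα : ∀ j < n, α' j ≤ α j) (hβ : ∀ j < n, β' j ≤ β j) :
    ‖prodKer n α β κ z‖ ≤ ‖prodKer n α' β' κ z‖ := by
  unfold prodKer
  simp only [norm_prod, norm_expKer]
  refine Finset.prod_le_prod (fun j _ => (Real.exp_pos _).le) fun j hj => ?_
  have hj := Finset.mem_range.1 hj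
  rw [Real.exp_le_exp]
  nlinarith [mul_le_mul_of_nonneg_right (hα j hj) (Real.exp_pos (-z j)).le,
    mul_le_mul_of_nonneg_right (hβ j hj) (Real.exp_pos (z j)).le]

theorem continuous_toda {n : ℕ} {c : ℕ → ℂ} (hc : ∀ j, 0 < j → j < n → (c j).re = 0) :
    Continuous (toda n c) := by
  rcases n with _ | n
  · exact continuous_const
  rw [continuous_iff_continuousAt]
  intro x0
  have hs : Continuous fun x : ℕ → ℝ =>
      ‖cexp (c 0 * ((∑ j ∈ Finset.range (n + 1), x j : ℝ) : ℂ))‖ := by fun_prop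
  set M := ‖cexp (c 0 * ((∑ j ∈ Finset.range (n + 1), x0 j : ℝ) : ℂ))‖ + 1
  have hev : ∀ᶠ x in nhds x0,
      ‖cexp (c 0 * ((∑ j ∈ Finset.range (n + 1), x j : ℝ) : ℂ))‖ < M ∧
      ∀ j ∈ Finset.range (n + 1), x0 j - 1 < x j ∧ x j < x0 j + 1 := by
    refine (hs.continuousAt.eventually (gt_mem_nhds (lt_add_one _))).and ?_
    rw [Filter.eventually_all_finset]
    intro j _
    have h := (continuous_apply (A := fun _ : ℕ => ℝ) j).continuousAt (x := x0)
    exact (h.eventually (lt_mem_nhds (sub_one_lt _))).and (h.eventually (gt_mem_nhds (lt_add_one _)))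
  obtain ⟨C, hC0, hC⟩ := toda_bound' (n := n) (c := fun j => c (j + 1)) one_pos
    (fun j _ h => hc (j + 1) (by omega) (by omega))
  set e : ℕ → ℝ := fun j => bdExp n (c (0 + 1)).re 1 (j + 1) - bdExp n (c (0 + 1)).re 1 j
  have hbound : ∀ z : Fin n → ℝ, ‖prodKer n (fun j => Real.exp (x0 j - 1))
      (fun j => Real.exp (-(x0 (j + 1) + 1))) (fun _ => -c 0) (extR0 z)‖ *
      ‖toda n (fun j => c (j + 1)) (extR0 z)‖ ≤ C * ‖prodKer n (fun j => Real.exp (x0 j - 1))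
      (fun j => Real.exp (-(x0 (j + 1) + 1))) (fun j => -c 0 + e j) (extR0 z)‖ := by
    intro z
    rw [← norm_prodKer_mul_exp]
    calc _ ≤ _ * _ := mul_le_mul_of_nonneg_left (hC (extR0 z)) (norm_nonneg _)
      _ = _ := by ring
  have hi := integrable_prodKer n (fun j => -c 0 + e j) (fun j => x0 j - 1)
    (fun j => -(x0 (j + 1) + 1))
  change ContinuousAt (fun x => ∫ z : Fin n → ℝ,
    kLam n (c 0) x (extR0 z) * toda n (fun j => c (j + 1)) (extR0 z)) x0
  refine continuousAt_of_dominated (bound := fun z => M * (C * ‖prodKer n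
      (fun j => Real.exp (x0 j - 1)) (fun j => Real.exp (-(x0 (j + 1) + 1)))
      (fun j => -c 0 + e j) (extR0 z)‖)) ?_ ?_ ((hi.norm.const_mul C).const_mul M) ?_
  · exact Filter.Eventually.of_forall fun x =>
      (continuous_kLam_right n n _ x).aestronglyMeasurable.mul
        (stronglyMeasurable_toda_extR0 n n _).aestronglyMeasurable
  · filter_upwards [hev] with x hx
    refine Filter.Eventually.of_forall fun z => ?_
    rw [norm_mul, kLam, norm_mul, mul_assoc]
    refine mul_le_mul hx.1.le ?_ (by positivity) (by positivity)
    refine le_trans (mul_le_mul_of_nonneg_right ?_ (norm_nonneg _)) (hbound z)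
    refine norm_prodKer_le _ _ (fun j hj => ?_) fun j hj => ?_
    · exact Real.exp_le_exp.2 (hx.2 j (Finset.mem_range.2 (by omega))).1.le
    · exact Real.exp_le_exp.2 (neg_le_neg (hx.2 (j + 1) (Finset.mem_range.2 (by omega))).2.le)
  · refine Filter.Eventually.of_forall fun z => ContinuousAt.mul ?_ continuousAt_const
    exact ((continuous_kLam n (c 0)).comp (continuous_id.prodMk continuous_const)).continuousAt

/-! ### The integrand of the dual zeta integral in logarithmic coordinates -/

/-- Prepend a term to a sequence. -/
def consSeq (a : ℂ) (b : ℕ → ℂ) : ℕ → ℂ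
  | 0 => a
  | j + 1 => b j

/-- The coordinates `P_j + log (1 + τ_j²)`. -/
def shiftLog (P τ : ℕ → ℝ) : ℕ → ℝ := fun j => P j + Real.log (1 + τ j ^ 2)

/-- The logarithm of `∏_{j < n} (1 + τ_j²)`. -/
def sumLog (n : ℕ) (τ : ℕ → ℝ) : ℝ := ∑ j ∈ Finset.range n, Real.log (1 + τ j ^ 2)

/-- The phase of the integrand of the dual zeta integral. -/
def dualPhase (k : ℕ) (P τ : ℕ → ℝ) : ℝ :=
  2 * (∑ j ∈ Finset.range k, Real.exp ((P j - P (j + 1)) / 2) * (τ j * τ (j + 1)) /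
    Real.sqrt (1 + τ (j + 1) ^ 2) - Real.exp ((P k - P (k + 1)) / 2) * τ k)

theorem exp_log_one_add_sq (t : ℝ) : Real.exp (Real.log (1 + t ^ 2)) = 1 + t ^ 2 :=
  Real.exp_log (by positivity)

theorem exp_neg_log_one_add_sq (t : ℝ) : Real.exp (-Real.log (1 + t ^ 2)) = (1 + t ^ 2)⁻¹ := by
  rw [Real.exp_neg, exp_log_one_add_sq]

theorem continuous_log_one_add_sq : Continuous fun t : ℝ => Real.log (1 + t ^ 2) :=
  Continuous.log (by fun_prop) fun t => by positivity

theorem continuous_shiftLog : Continuous fun q : (ℕ → ℝ) × (ℕ → ℝ) => shiftLog q.1 q.2 :=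
  continuous_pi fun j => Continuous.add (by fun_prop)
    (continuous_log_one_add_sq.comp ((continuous_apply j).comp continuous_snd))

theorem continuous_sumLog (n : ℕ) : Continuous (sumLog n) :=
  continuous_finsetSum _ fun j _ => continuous_log_one_add_sq.comp (continuous_apply j)

theorem continuous_dualPhase (k : ℕ) :
    Continuous fun q : (ℕ → ℝ) × (ℕ → ℝ) => dualPhase k q.1 q.2 := by
  unfold dualPhase
  refine continuous_const.mul (Continuous.sub (continuous_finsetSum _ fun j _ => ?_) (by fun_prop))
  exact Continuous.div (by fun_prop) (by fun_prop) fun τ => by positivity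

theorem abs_bdExp_sub_le (n : ℕ) {η : ℝ} (hη : 0 ≤ η) (j : ℕ) :
    |bdExp n 0 η (j + 1) - bdExp n 0 η j| ≤ η := by
  unfold bdExp
  rw [abs_le]
  split_ifs <;> simp <;> linarith

theorem continuous_chainExp_prod (m : ℕ) (p : ℕ → ℝ) :
    Continuous fun q : (ℕ → ℝ) × (ℕ → ℝ) => chainExp m p q.1 q.2 := by
  unfold chainExp
  refine Continuous.add (by fun_prop) (continuous_finsetSum _ fun j _ => ?_)
  refine Continuous.add (Continuous.neg (continuous_ofReal.comp ?_))
    (continuous_const.mul (continuous_ofReal.comp ?_))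
  · exact Continuous.div (by fun_prop) (by fun_prop) fun q => by positivity
  · exact Continuous.div (by fun_prop) (by fun_prop) fun q => by positivity

theorem kQ_shiftLog (k : ℕ) (ν : ℂ) (P y τ : ℕ → ℝ) :
    cexp (I * dualPhase k P τ) * cexp (-ν * sumLog (k + 1) τ) *
      kQ (k + 1) ν (shiftLog P τ) y =
    cexp (-((∑ j ∈ Finset.range (k + 1), Real.exp (P j - y j) : ℝ) : ℂ) +
      ν * ((∑ j ∈ Finset.range (k + 1), P j - ∑ j ∈ Finset.range (k + 1), y j : ℝ) : ℂ)) *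
    cexp (chainExp k P y τ +
      2 * I * ((Real.exp (P k / 2) * τ k * (-Real.exp (-P (k + 1) / 2)) : ℝ) : ℂ)) := by
  have h1 : ∑ j ∈ Finset.range (k + 1), (Real.exp (shiftLog P τ j - y j) +
      if j + 1 < k + 1 then Real.exp (y j - shiftLog P τ (j + 1)) else 0) =
      ∑ j ∈ Finset.range (k + 1), Real.exp (P j - y j) +
      ∑ j ∈ Finset.range (k + 1), Real.exp (P j - y j) * τ j ^ 2 +
      ∑ j ∈ Finset.range k, Real.exp (y j - P (j + 1)) / (1 + τ (j + 1) ^ 2) := by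
    rw [Finset.sum_add_distrib, Finset.sum_range_succ (fun j => if j + 1 < k + 1 then _ else _),
      if_neg (lt_irrefl _), add_zero, ← Finset.sum_add_distrib]
    congr 1
    · refine Finset.sum_congr rfl fun j _ => ?_
      rw [shiftLog, add_sub_right_comm, Real.exp_add, exp_log_one_add_sq]; ring
    · refine Finset.sum_congr rfl fun j hj => ?_
      rw [if_pos (by simpa using hj), shiftLog, ← sub_sub, sub_eq_add_neg (_ - _), Real.exp_add,
        exp_neg_log_one_add_sq, div_eq_mul_inv]
  have h2 : ∑ j ∈ Finset.range (k + 1), shiftLog P τ j =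
      ∑ j ∈ Finset.range (k + 1), P j + sumLog (k + 1) τ := by
    simp only [shiftLog, sumLog, Finset.sum_add_distrib]
  have h3 : Real.exp ((P k - P (k + 1)) / 2) = Real.exp (P k / 2) * Real.exp (-P (k + 1) / 2) := by
    rw [← Real.exp_add]; ring_nf
  rw [kQ_eq, h1, h2, ← Complex.exp_add, ← Complex.exp_add, ← Complex.exp_add, dualPhase, chainExp, h3,
    Finset.sum_add_distrib, Finset.sum_neg_distrib, Finset.sum_neg_distrib, ← Finset.mul_sum]
  congr 1
  push_cast
  ring

theorem integral_dual_inner (k : ℕ) {ν : ℂ} {b' : ℕ → ℂ} (hν : 1 / 2 < ν.re)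
    (hb' : ∀ j < k + 1, (b' j).re = 0) (P : ℕ → ℝ) :
    (∏ j ∈ Finset.range (k + 1), Complex.Gamma (ν - b' j)) *
      ∫ τ : Fin (k + 1) → ℝ, cexp (I * dualPhase k P (extR0 τ)) *
        cexp (-ν * sumLog (k + 1) (extR0 τ)) * toda (k + 1) b' (shiftLog P (extR0 τ)) =
    ((Real.sqrt Real.pi ^ (k + 1) : ℝ) : ℂ) * cexp (-(ν - 1 / 2) * P (k + 1)) *
      toda (k + 2) (consSeq (ν - 1 / 2) b') P := by
  set A : (Fin (k + 1) → ℝ) → ℂ := fun y =>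
    cexp (-((∑ j ∈ Finset.range (k + 1), Real.exp (P j - extR0 y j) : ℝ) : ℂ) +
      ν * ((∑ j ∈ Finset.range (k + 1), P j - ∑ j ∈ Finset.range (k + 1), extR0 y j : ℝ) : ℂ))
  set K : (Fin (k + 1) → ℝ) → (Fin (k + 1) → ℝ) → ℂ := fun y τ =>
    cexp (chainExp k P (extR0 y) (extR0 τ) + 2 * I *
      ((Real.exp (P k / 2) * extR0 τ k * (-Real.exp (-P (k + 1) / 2)) : ℝ) : ℂ))
  set f : (Fin (k + 1) → ℝ) → ℂ := fun y => A y * toda (k + 1) b' (extR0 y)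
  have hAc : Continuous A := by fun_prop
  have hfc : Continuous f :=
    hAc.mul ((continuous_toda fun j _ h => hb' j h).comp (continuous_extR0 _))
  have hfub : Integrable (fun q : (Fin (k + 1) → ℝ) × (Fin (k + 1) → ℝ) => f q.1 * K q.1 q.2)
      (volume.prod volume) := by
    obtain ⟨C, hC0, hC⟩ := toda_bound' (n := k + 1) (c := b')
      (half_pos (sub_pos.2 hν)) (fun j _ h => hb' j h)
    rw [hb' 0 (by omega)] at hC
    have hη : 0 ≤ (ν.re - 1 / 2) / 2 := by linarith
    obtain ⟨D, _, hD⟩ := prodKer_bound (k + 1) (fun j => -ν + ((bdExp (k + 1) 0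
        ((ν.re - 1 / 2) / 2) (j + 1) - bdExp (k + 1) 0 ((ν.re - 1 / 2) / 2) j + 1 / 2 : ℝ) : ℂ))
      (fun j => ν.re - (bdExp (k + 1) 0 ((ν.re - 1 / 2) / 2) (j + 1) -
        bdExp (k + 1) 0 ((ν.re - 1 / 2) / 2) j + 1 / 2)) fun j _ => by
          linarith [(abs_le.1 (abs_bdExp_sub_le (k + 1) hη j)).2]
    have hDi := (hD P 0 (fun _ => 0) fun j _ => Or.inr ⟨by simp, by
          linarith [(abs_le.1 (abs_bdExp_sub_le (k + 1) hη j)).2], le_rfl⟩).1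
    refine integrable_prod_mul_of_le (C := 1) (h := fun y => ∏ j ∈ Finset.range (k + 1),
      Real.sqrt (Real.pi / Real.exp (P j - extR0 y j))) hfc.aestronglyMeasurable ?_
      (fun y => integrable_cexp_chainExp _ _ _ _) (fun y => ?_) ?_
    · have := (continuous_chainExp_prod k P).comp (((continuous_extR0 (k + 1)).comp
        continuous_fst).prodMk ((continuous_extR0 (k + 1)).comp continuous_snd))
      exact (continuous_exp.comp (this.add (by fun_prop))).aestronglyMeasurable
    · rw [one_mul]
      have hg : ∀ j < k + 1, Integrable fun t : ℝ =>
          Real.exp (-Real.exp (P j - extR0 y j) * t ^ 2) := fun j _ =>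
        integrable_exp_neg_mul_sq (Real.exp_pos _)
      refine (integral_mono (integrable_cexp_chainExp _ _ _ _).norm
        (integrable_prod_extR0_real hg) fun τ => norm_cexp_chainExp_le _ _ _ _ _).trans_eq ?_
      rw [integral_prod_extR0_real (n := k + 1)
        (fun j t => Real.exp (-Real.exp (P j - extR0 y j) * t ^ 2))]
      exact Finset.prod_congr rfl fun j _ => integral_gaussian _
    · refine (hDi.norm.const_mul (C * (Real.sqrt Real.pi ^ (k + 1) *
        Real.exp ((ν.re - 1 / 2) * ∑ j ∈ Finset.range (k + 1), P j)))).mono'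
        (hfc.norm.mul (continuous_finsetProd _ fun j _ => ?_)).aestronglyMeasurable
        (Filter.Eventually.of_forall fun y => ?_)
      · simp only [div_eq_mul_inv, ← Real.exp_neg]; fun_prop
      have hsq : ∀ j, Real.sqrt (Real.pi / Real.exp (P j - extR0 y j)) =
          Real.sqrt Real.pi * Real.exp ((extR0 y j - P j) / 2) := fun j => by
        rw [Real.sqrt_div Real.pi_pos.le, ← Real.exp_half, div_eq_mul_inv, ← Real.exp_neg]
        ring_nf
      rw [norm_mul, norm_norm, Real.norm_of_nonneg (Finset.prod_nonneg fun j _ =>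
        Real.sqrt_nonneg _)]
      simp only [f, norm_mul, hsq, Finset.prod_mul_distrib, Finset.prod_const, Finset.card_range]
      calc _ ≤ ‖A y‖ * (C * _) * (Real.sqrt Real.pi ^ (k + 1) *
            ∏ j ∈ Finset.range (k + 1), Real.exp ((extR0 y j - P j) / 2)) := by
            gcongr; exact hC (extR0 y)
        _ = C * Real.sqrt Real.pi ^ (k + 1) * (‖A y‖ * Real.exp (∑ j ∈ Finset.range (k + 1),
            (bdExp (k + 1) 0 ((ν.re - 1 / 2) / 2) (j + 1) -
              bdExp (k + 1) 0 ((ν.re - 1 / 2) / 2) j) * extR0 y j) *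
            ∏ j ∈ Finset.range (k + 1), Real.exp ((extR0 y j - P j) / 2)) := by ring
        _ = C * Real.sqrt Real.pi ^ (k + 1) * (Real.exp ((ν.re - 1 / 2) *
              ∑ j ∈ Finset.range (k + 1), P j) * ‖prodKer (k + 1) (fun j => Real.exp (P j))
              (fun _ => 0) (fun j => -ν + ((bdExp (k + 1) 0 ((ν.re - 1 / 2) / 2) (j + 1) -
                bdExp (k + 1) 0 ((ν.re - 1 / 2) / 2) j + 1 / 2 : ℝ) : ℂ)) (extR0 y)‖) := by
            congr 1
            simp only [A, prodKer, norm_prod, norm_expKer, Complex.norm_exp]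
            rw [← Real.exp_sum, ← Real.exp_sum, ← Real.exp_add, ← Real.exp_add, ← Real.exp_add]
            congr 1
            simp only [add_re, neg_re, ofReal_re, re_mul_ofReal, Finset.mul_sum,
              ← Finset.sum_sub_distrib, ← Finset.sum_add_distrib, ← Finset.sum_neg_distrib]
            refine Finset.sum_congr rfl fun j _ => ?_
            rw [sub_eq_add_neg (P j), Real.exp_add]
            ring
        _ = _ := by ring
  have hpt : ∀ τ : Fin (k + 1) → ℝ, (∏ j ∈ Finset.range (k + 1), Complex.Gamma (ν - b' j)) *
      (cexp (I * dualPhase k P (extR0 τ)) * cexp (-ν * sumLog (k + 1) (extR0 τ)) *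
        toda (k + 1) b' (shiftLog P (extR0 τ))) = ∫ y, f y * K y τ := by
    intro τ
    rw [mul_left_comm, ← baxter_eigen (fun j _ h => hb' j h) (by linarith)
      (Or.inr (by rw [hb' 0 (by omega)]; linarith)), ← integral_const_mul]
    congr 1 with y
    rw [← mul_assoc, kQ_shiftLog]
    simp only [f, A, K]
    ring
  rw [← integral_const_mul]
  simp_rw [hpt]
  rw [← integral_integral_swap (f := fun y τ => f y * K y τ) hfub, toda_succ, ← integral_const_mul]
  congr 1 with y
  rw [integral_const_mul]
  simp only [K]
  rw [integral_cexp_chainExp, kLam_eq]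
  have hth : Real.exp (extR0 y k) * (-Real.exp (-P (k + 1) / 2)) ^ 2 =
      Real.exp (extR0 y k - P (k + 1)) := by
    rw [neg_sq, ← Real.exp_nat_mul, ← Real.exp_add]; congr 1; push_cast; ring
  rw [hth, ← Finset.sum_range_succ (fun j => Real.exp (extR0 y j - P (j + 1))), 
    Finset.prod_mul_distrib, Finset.prod_const, Finset.card_range, ← Real.exp_sum]
  simp only [f, A, consSeq]
  have hs : ∑ i ∈ Finset.range (k + 1), (extR0 y i - P i) / 2 =
      (∑ j ∈ Finset.range (k + 1), extR0 y j - ∑ j ∈ Finset.range (k + 1), P j) / 2 := by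
    rw [← Finset.sum_div, Finset.sum_sub_distrib]
  rw [hs, Finset.sum_add_distrib, Finset.sum_range_succ P (k + 1)]
  have hcast : ∀ u v w : ℝ, ((u * Real.exp v * Real.exp w : ℝ) : ℂ) = u * cexp (v + w) := by
    intro u v w; push_cast; rw [Complex.exp_add]; ring
  rw [hcast]
  have hexp : ∀ u v w x : ℂ, u + v = w + x → cexp u * cexp v = cexp w * cexp x := by
    intro u v w x h; rw [← Complex.exp_add, ← Complex.exp_add, h]
  have halg : ∀ A B C D T u : ℂ, A * B = C * D → A * T * (u * B) = u * C * (D * T) := by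
    intro A B C D T u h; linear_combination u * T * h
  refine halg _ _ _ _ _ _ (hexp _ _ _ _ ?_)
  push_cast
  ring

/-- The integrand of the dual zeta integral in logarithmic coordinates, with the last
coordinate of `P` weighted by `κ` and the unipotent coordinates by `ν`. -/
def dualKer (k : ℕ) (σ κ ν : ℂ) (b b' : ℕ → ℂ) (P τ : ℕ → ℝ) : ℂ :=
  cexp (I * dualPhase k P τ) * cexp (σ * ((∑ j ∈ Finset.range (k + 1), P j : ℝ) : ℂ)) *
    cexp (κ * P (k + 1)) * cexp (-ν * sumLog (k + 1) τ) * toda (k + 3) b P *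
    toda (k + 1) b' (shiftLog P τ)

theorem continuous_dualKer (k : ℕ) (σ κ ν : ℂ) {b b' : ℕ → ℂ} (hb : ∀ j < k + 3, (b j).re = 0)
    (hb' : ∀ j < k + 1, (b' j).re = 0) :
    Continuous fun q : (ℕ → ℝ) × (ℕ → ℝ) => dualKer k σ κ ν b b' q.1 q.2 := by
  have h1 := (continuous_toda (n := k + 3) fun j _ h => hb j h).comp
    (continuous_fst (X := ℕ → ℝ) (Y := ℕ → ℝ))
  have h2 := (continuous_toda (n := k + 1) fun j _ h => hb' j h).comp continuous_shiftLog
  have h3 := (continuous_sumLog (k + 1)).comp (continuous_snd (X := ℕ → ℝ) (Y := ℕ → ℝ))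
  have h4 := continuous_dualPhase k
  simp only [Function.comp_def] at h1 h2 h3
  unfold dualKer
  fun_prop

theorem integrable_exp_neg_sumLog (n : ℕ) {r : ℝ} (hr : 1 / 2 < r) :
    Integrable fun τ : Fin n → ℝ => Real.exp (-(r * sumLog n (extR0 τ))) := by
  have h1 : Integrable fun t : ℝ => Real.exp (-(r * Real.log (1 + t ^ 2))) := by
    have := integrable_rpow_neg_one_add_norm_sq (E := ℝ) (μ := volume) (r := 2 * r) (by simp; linarith)
    refine this.congr (Filter.Eventually.of_forall fun t => ?_)
    simp only [Real.norm_eq_abs, sq_abs]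
    rw [Real.rpow_def_of_pos (by positivity)]
    congr 1; ring
  have := integrable_prod_extR0_real (n := n) fun j _ => h1
  refine this.congr (Filter.Eventually.of_forall fun τ => ?_)
  simp only [sumLog, ← Real.exp_sum, Finset.sum_neg_distrib, Finset.mul_sum]

theorem dualKer_bound (k : ℕ) {σ κ ν : ℂ} {b b' : ℕ → ℂ} (hσ : 0 < σ.re)
    (hκ : σ.re < κ.re) (hν : ν.re = 1) (hb : ∀ j < k + 3, (b j).re = 0)
    (hb' : ∀ j < k + 1, (b' j).re = 0) :
    ∃ C : ℝ, 0 ≤ C ∧ ∃ ε : ℝ, 0 < ε ∧ ∀ (P : Fin (k + 2) → ℝ) (τ : ℕ → ℝ),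
      ‖dualKer k σ κ ν b b' (extR0 P) τ‖ ≤
        C * expWt (k + 2) ε (extR0 P) * Real.exp (-(3 / 4 * sumLog (k + 1) τ)) := by
  obtain ⟨η, hη0, hη1, hη2⟩ : ∃ η : ℝ, 0 < η ∧ η ≤ 1 / 4 ∧ η < σ.re :=
    ⟨min (1 / 4) (σ.re / 2), by positivity, min_le_left _ _, by
      linarith [min_le_right (1 / 4) (σ.re / 2)]⟩
  obtain ⟨C1, hC1, h1⟩ := toda_bound' (n := k + 1) (c := b') hη0 (fun j _ h => hb' j h)
  rw [hb' 0 (by omega)] at h1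
  set e : ℕ → ℝ := fun j => bdExp (k + 1) 0 η (j + 1) - bdExp (k + 1) 0 η j with he
  obtain ⟨C2, hC2, ε, hε, h2⟩ := toda_expWt_bound (N := k + 2) (b := b) hb
    (fun j => j * σ.re + bdExp (k + 1) 0 η j + if j = k + 2 then κ.re - σ.re else 0)
    (by simp [bdExp]) (fun j hj _ => by
      have := bdExp_add_pos (n := k + 1) le_rfl hη2 hη0 j hj
      split_ifs <;> linarith)
  refine ⟨C1 * C2, by positivity, ε, hε, fun P τ => ?_⟩
  have hlog : ∀ j, 0 ≤ Real.log (1 + τ j ^ 2) := fun j =>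
    Real.log_nonneg (by nlinarith [sq_nonneg (τ j)])
  have hs : ∑ j ∈ Finset.range (k + 1), e j * shiftLog (extR0 P) τ j ≤
      ∑ j ∈ Finset.range (k + 1), e j * extR0 P j + 1 / 4 * sumLog (k + 1) τ := by
    simp only [shiftLog, mul_add, Finset.sum_add_distrib, sumLog, Finset.mul_sum]
    gcongr with j _
    · exact hlog j
    · exact (abs_le.1 (abs_bdExp_sub_le (k + 1) hη0.le j)).2.trans hη1
  have hE : ∑ j ∈ Finset.range (k + 2), ((((j + 1 : ℕ) : ℝ) * σ.re + bdExp (k + 1) 0 η (j + 1) +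
        if j + 1 = k + 2 then κ.re - σ.re else 0) -
      (j * σ.re + bdExp (k + 1) 0 η j + if j = k + 2 then κ.re - σ.re else 0)) * extR0 P j =
      ∑ j ∈ Finset.range (k + 1), σ.re * extR0 P j + ∑ j ∈ Finset.range (k + 1), e j * extR0 P j +
        κ.re * extR0 P (k + 1) := by
    rw [Finset.sum_range_succ, ← Finset.sum_add_distrib]
    congr 1
    · refine Finset.sum_congr rfl fun j hj => ?_
      have := Finset.mem_range.1 hj
      rw [if_neg (by omega), if_neg (by omega)]
      simp only [he]; push_cast; ring
    · have : bdExp (k + 1) 0 η (k + 1 + 1) = bdExp (k + 1) 0 η (k + 1) := by simp [bdExp]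
      rw [if_pos (by omega), if_neg (by omega), this]
      push_cast; ring
  have h2P := h2 P
  rw [hE] at h2P
  unfold dualKer
  simp only [norm_mul, norm_cexp_mul_sum]
  have n1 : ‖cexp (I * dualPhase k (extR0 P) τ)‖ = 1 := by
    rw [mul_comm]; exact norm_exp_ofReal_mul_I _
  have n2 : ‖cexp (κ * extR0 P (k + 1))‖ = Real.exp (κ.re * extR0 P (k + 1)) := by
    rw [Complex.norm_exp, re_mul_ofReal]
  have n3 : ‖cexp (-ν * sumLog (k + 1) τ)‖ = Real.exp (-sumLog (k + 1) τ) := by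
    rw [Complex.norm_exp, re_mul_ofReal, neg_re, hν]; ring_nf
  rw [n1, n2, n3, one_mul]
  calc _ ≤ Real.exp (∑ j ∈ Finset.range (k + 1), σ.re * extR0 P j) *
        Real.exp (κ.re * extR0 P (k + 1)) * Real.exp (-sumLog (k + 1) τ) *
        ‖toda (k + 3) b (extR0 P)‖ * (C1 * Real.exp (∑ j ∈ Finset.range (k + 1), e j * extR0 P j +
          1 / 4 * sumLog (k + 1) τ)) := by
        gcongr
        exact (h1 _).trans (mul_le_mul_of_nonneg_left (Real.exp_le_exp.2 hs) hC1)
    _ = C1 * (‖toda (k + 3) b (extR0 P)‖ * Real.exp (∑ j ∈ Finset.range (k + 1),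
        σ.re * extR0 P j + ∑ j ∈ Finset.range (k + 1), e j * extR0 P j +
        κ.re * extR0 P (k + 1))) * Real.exp (-(3 / 4 * sumLog (k + 1) τ)) := by
        have : Real.exp (-(3 / 4 * sumLog (k + 1) τ)) = Real.exp (-sumLog (k + 1) τ) *
            Real.exp (1 / 4 * sumLog (k + 1) τ) := by rw [← Real.exp_add]; ring_nf
        rw [this, Real.exp_add, Real.exp_add, Real.exp_add]
        ring
    _ ≤ C1 * (C2 * expWt (k + 2) ε (extR0 P)) * Real.exp (-(3 / 4 * sumLog (k + 1) τ)) := by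
        gcongr
    _ = _ := by ring

theorem integrable_dualKer (k : ℕ) {σ κ ν : ℂ} {b b' : ℕ → ℂ} (hσ : 0 < σ.re)
    (hκ : σ.re < κ.re) (hν : ν.re = 1) (hb : ∀ j < k + 3, (b j).re = 0)
    (hb' : ∀ j < k + 1, (b' j).re = 0) :
    Integrable fun q : (Fin (k + 2) → ℝ) × (Fin (k + 1) → ℝ) =>
      dualKer k σ κ ν b b' (extR0 q.1) (extR0 q.2) := by
  obtain ⟨C, _, ε, hε, h⟩ := dualKer_bound k hσ hκ hν hb hb'
  refine (((integrable_expWt (k + 2) hε).const_mul C).mul_prod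
    (integrable_exp_neg_sumLog (k + 1) (r := 3 / 4) (by norm_num))).mono' ?_
    (Filter.Eventually.of_forall fun q => h q.1 (extR0 q.2))
  exact ((continuous_dualKer k σ κ ν hb hb').comp (((continuous_extR0 _).comp
    continuous_fst).prodMk ((continuous_extR0 _).comp continuous_snd))).aestronglyMeasurable

theorem integral_dualKer (k : ℕ) {σ κ ν : ℂ} {b b' : ℕ → ℂ} (hσ : 0 < σ.re)
    (hκ : σ.re < κ.re) (hν : ν.re = 1) (hνκ : ν = κ + 1 / 2 - σ) (hb : ∀ j < k + 3, (b j).re = 0)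
    (hb' : ∀ j < k + 1, (b' j).re = 0) :
    (∏ j ∈ Finset.range (k + 1), Complex.Gamma (ν - b' j)) *
    ∫ q : (Fin (k + 2) → ℝ) × (Fin (k + 1) → ℝ), dualKer k σ κ ν b b' (extR0 q.1) (extR0 q.2) =
    ((Real.sqrt Real.pi ^ (k + 1) : ℝ) : ℂ) * ((∏ j ∈ Finset.range (k + 3), Complex.Gamma (κ + b j)) *
      ∏ j ∈ Finset.range (k + 3), ∏ l ∈ Finset.range (k + 1), Complex.Gamma (σ + b j + b' l)) := by
  have hst := stade_formula (k + 2) (b := b) (b' := consSeq (ν - 1 / 2) b') hσ hb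
    (fun j h0 hj => by
      obtain ⟨i, rfl⟩ := Nat.exists_eq_succ_of_ne_zero h0.ne'
      exact hb' i (by omega)) (Or.inr (by simp [consSeq, hν]; norm_num))
  have hR : ∏ j ∈ Finset.range (k + 2 + 1), ∏ l ∈ Finset.range (k + 2),
      Complex.Gamma (σ + b j + consSeq (ν - 1 / 2) b' l) =
      (∏ j ∈ Finset.range (k + 3), Complex.Gamma (κ + b j)) *
      ∏ j ∈ Finset.range (k + 3), ∏ l ∈ Finset.range (k + 1), Complex.Gamma (σ + b j + b' l) := by
    rw [← Finset.prod_mul_distrib]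
    refine Finset.prod_congr rfl fun j _ => ?_
    rw [Finset.prod_range_succ', mul_comm]
    simp only [consSeq]
    congr 2
    rw [hνκ]; ring
  rw [← hR, ← hst, stadeA, Measure.volume_eq_prod,
    integral_prod _ (integrable_dualKer k hσ hκ hν hb hb'), ← integral_const_mul,
    ← integral_const_mul]
  congr 1 with P
  have hin := integral_dual_inner k (b' := b') (ν := ν) (by rw [hν]; norm_num) hb' (extR0 P)
  have h1 : ∀ τ : Fin (k + 1) → ℝ, dualKer k σ κ ν b b' (extR0 P) (extR0 τ) =
      (cexp (σ * ((∑ j ∈ Finset.range (k + 1), extR0 P j : ℝ) : ℂ)) *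
        cexp (κ * extR0 P (k + 1)) * toda (k + 3) b (extR0 P)) *
      (cexp (I * dualPhase k (extR0 P) (extR0 τ)) * cexp (-ν * sumLog (k + 1) (extR0 τ)) *
        toda (k + 1) b' (shiftLog (extR0 P) (extR0 τ))) := fun τ => by
    unfold dualKer; ring
  simp_rw [h1]
  rw [integral_const_mul, mul_left_comm, hin, Finset.sum_range_succ _ (k + 1)]
  have h2 : cexp (σ * ((∑ j ∈ Finset.range (k + 1), extR0 P j + extR0 P (k + 1) : ℝ) : ℂ)) =
      cexp (σ * ((∑ j ∈ Finset.range (k + 1), extR0 P j : ℝ) : ℂ)) *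
        (cexp (κ * extR0 P (k + 1)) * cexp (-(ν - 1 / 2) * extR0 P (k + 1))) := by
    rw [← Complex.exp_add, ← Complex.exp_add, hνκ]
    congr 1
    push_cast
    ring
  rw [h2]
  ring

/-! ### The dual integral as an inverse Mellin transform -/

/-- The coordinate change that replaces the last coordinate by its shift. -/
def shearMap (k : ℕ) (w : ℝ × (Fin (k + 1) → ℝ) × (Fin (k + 1) → ℝ)) :
    (Fin (k + 2) → ℝ) × (Fin (k + 1) → ℝ) :=
  (Fin.snoc w.2.1 (w.1 + sumLog (k + 1) (extR0 w.2.2)), w.2.2)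

theorem continuous_sumLog_extR0 (n m : ℕ) : Continuous fun τ : Fin m → ℝ => sumLog n (extR0 τ) :=
  (continuous_sumLog n).comp (continuous_extR0 m)

theorem continuous_snoc (n : ℕ) :
    Continuous fun q : ℝ × (Fin n → ℝ) => (Fin.snoc q.2 q.1 : Fin (n + 1) → ℝ) :=
  Continuous.finSnoc (A := fun _ => ℝ) continuous_snd continuous_fst

theorem continuous_shearMap (k : ℕ) : Continuous (shearMap k) := by
  have h : Continuous fun w : ℝ × (Fin (k + 1) → ℝ) × (Fin (k + 1) → ℝ) =>
      w.1 + sumLog (k + 1) (extR0 w.2.2) :=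
    continuous_fst.add ((continuous_sumLog_extR0 (k + 1) (k + 1)).comp
      (continuous_snd.comp continuous_snd))
  exact ((continuous_snoc (k + 1)).comp (h.prodMk (continuous_fst.comp continuous_snd))).prodMk
    (continuous_snd.comp continuous_snd)

theorem MeasureTheory.MeasurePreserving.comp_shear {α β γ : Type*} [MeasureSpace α]
    [MeasureSpace β] [MeasureSpace γ] [SFinite (volume : Measure α)] [SFinite (volume : Measure β)]
    [SFinite (volume : Measure γ)] {e : ℝ × α → β}
    (he : MeasurePreserving e (volume.prod volume) volume) {g : γ → ℝ} (hg : Measurable g) :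
    MeasurePreserving (fun w : ℝ × α × γ => (e (w.1 + g w.2.2, w.2.1), w.2.2)) := by
  have hs : MeasurePreserving (fun q : (α × γ) × ℝ => (q.1, q.2 + g q.1.2)) :=
    (MeasurePreserving.id volume).skew_product
      (g := fun (q : α × γ) (r : ℝ) => r + g q.2)
      (measurable_snd.add (hg.comp (measurable_snd.comp measurable_fst)))
      (Filter.Eventually.of_forall fun q => (measurePreserving_add_right volume _).map_eq)
  exact ((he.prod (MeasurePreserving.id volume)).comp volume_preserving_prodAssoc.symm).comp
    (Measure.measurePreserving_swap.comp (hs.comp Measure.measurePreserving_swap))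

theorem measurePreserving_shearMap (k : ℕ) : MeasurePreserving (shearMap k) :=
  (measurePreserving_snoc (k + 1)).comp_shear
    (continuous_sumLog_extR0 (k + 1) (k + 1)).measurable

theorem integral_comp_shearMap (k : ℕ) {f : (Fin (k + 2) → ℝ) × (Fin (k + 1) → ℝ) → ℂ}
    (hf : Integrable f) : Integrable (fun w => f (shearMap k w)) ∧
      ∫ w, f (shearMap k w) = ∫ q, f q := by
  have h := measurePreserving_shearMap k
  refine ⟨(h.integrable_comp hf.aestronglyMeasurable).2 hf, ?_⟩
  have h2 := integral_map h.measurable.aemeasurable (f := f)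
    (by rw [h.map_eq]; exact hf.aestronglyMeasurable)
  rw [h.map_eq] at h2
  exact h2.symm

/-- The dual zeta integral in logarithmic coordinates, at the radial parameter `r`. -/
def dualJ (k : ℕ) (σ : ℂ) (b b' : ℕ → ℂ) (r : ℝ) : ℂ :=
  ∫ q : (Fin (k + 1) → ℝ) × (Fin (k + 1) → ℝ), dualKer k σ 0 (1 / 2 - σ) b b'
    (extR0 (shearMap k (r, q)).1) (extR0 q.2)

theorem dualKer_shearMap (k : ℕ) (σ κ : ℂ) (b b' : ℕ → ℂ) (r : ℝ)
    (q : (Fin (k + 1) → ℝ) × (Fin (k + 1) → ℝ)) :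
    dualKer k σ κ (κ + 1 / 2 - σ) b b' (extR0 (shearMap k (r, q)).1) (extR0 q.2) =
    cexp (κ * r) * dualKer k σ 0 (1 / 2 - σ) b b' (extR0 (shearMap k (r, q)).1) (extR0 q.2) := by
  have h : cexp (κ * extR0 (shearMap k (r, q)).1 (k + 1)) *
      cexp (-(κ + 1 / 2 - σ) * sumLog (k + 1) (extR0 q.2)) = cexp (κ * r) *
      (cexp (0 * extR0 (shearMap k (r, q)).1 (k + 1)) *
        cexp (-(1 / 2 - σ) * sumLog (k + 1) (extR0 q.2))) := by
    rw [← Complex.exp_add, ← Complex.exp_add, ← Complex.exp_add, shearMap, extR0_snoc_self]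
    congr 1
    push_cast
    ring
  unfold dualKer
  linear_combination (cexp (I * dualPhase k (extR0 (shearMap k (r, q)).1) (extR0 q.2)) *
    cexp (σ * ((∑ j ∈ Finset.range (k + 1), extR0 (shearMap k (r, q)).1 j : ℝ) : ℂ)) *
    toda (k + 3) b (extR0 (shearMap k (r, q)).1) *
    toda (k + 1) b' (shiftLog (extR0 (shearMap k (r, q)).1) (extR0 q.2))) * h

theorem exp_mul_dualJ (k : ℕ) (σ κ : ℂ) (b b' : ℕ → ℂ) (r : ℝ) :
    cexp (κ * r) * dualJ k σ b b' r = ∫ q : (Fin (k + 1) → ℝ) × (Fin (k + 1) → ℝ),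
      dualKer k σ κ (κ + 1 / 2 - σ) b b' (extR0 (shearMap k (r, q)).1) (extR0 q.2) := by
  rw [dualJ, ← integral_const_mul]
  simp_rw [dualKer_shearMap k σ κ]

theorem integral_exp_mul_dualJ (k : ℕ) {σ κ : ℂ} {b b' : ℕ → ℂ} (hσ : 0 < σ.re)
    (hκ : κ.re = σ.re + 1 / 2) (hb : ∀ j < k + 3, (b j).re = 0)
    (hb' : ∀ j < k + 1, (b' j).re = 0) :
    Integrable (fun r : ℝ => cexp (κ * r) * dualJ k σ b b' r) ∧
    (∏ j ∈ Finset.range (k + 1), Complex.Gamma (κ + 1 / 2 - σ - b' j)) *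
      ∫ r : ℝ, cexp (κ * r) * dualJ k σ b b' r =
    ((Real.sqrt Real.pi ^ (k + 1) : ℝ) : ℂ) * ((∏ j ∈ Finset.range (k + 3), Complex.Gamma (κ + b j)) *
      ∏ j ∈ Finset.range (k + 3), ∏ l ∈ Finset.range (k + 1), Complex.Gamma (σ + b j + b' l)) := by
  have hν : (κ + 1 / 2 - σ).re = 1 := by simp [hκ]; ring
  have hi := integrable_dualKer k (κ := κ) hσ (by linarith) hν hb hb'
  obtain ⟨h1, h2⟩ := integral_comp_shearMap k hi
  simp_rw [exp_mul_dualJ]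
  refine ⟨h1.integral_prod_left, ?_⟩
  rw [← integral_dualKer k hσ (by linarith) hν rfl hb hb', ← h2]
  congr 1
  exact (integral_prod _ h1).symm

theorem Continuous.comp_fst_snd {X A B E F Z : Type*} [TopologicalSpace X] [TopologicalSpace A]
    [TopologicalSpace B] [TopologicalSpace E] [TopologicalSpace F] [TopologicalSpace Z]
    {G : E × F → Z} (hG : Continuous G) {f : A → E} (hf : Continuous f) {g : B → F}
    (hg : Continuous g) {u : X → A × B} (hu : Continuous u) :
    Continuous fun w => G (f (u w).1, g (u w).2) :=
  hG.comp ((hf.comp (continuous_fst.comp hu)).prodMk (hg.comp (continuous_snd.comp hu)))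

theorem continuous_dualKer_shearMap (k : ℕ) (σ κ ν : ℂ) {b b' : ℕ → ℂ}
    (hb : ∀ j < k + 3, (b j).re = 0) (hb' : ∀ j < k + 1, (b' j).re = 0) :
    Continuous fun w : ℝ × (Fin (k + 1) → ℝ) × (Fin (k + 1) → ℝ) =>
      dualKer k σ κ ν b b' (extR0 (shearMap k w).1) (extR0 w.2.2) := by
  have h := (continuous_dualKer k σ κ ν hb hb').comp_fst_snd (continuous_extR0 (k + 2))
    (continuous_extR0 (k + 1)) (continuous_shearMap k)
  exact h

theorem exists_integrable_bound_dualKer_shearMap (k : ℕ) {σ : ℂ} {b b' : ℕ → ℂ} (hσ : 0 < σ.re)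
    (hb : ∀ j < k + 3, (b j).re = 0) (hb' : ∀ j < k + 1, (b' j).re = 0) :
    ∃ B : (Fin (k + 1) → ℝ) × (Fin (k + 1) → ℝ) → ℝ, Integrable B ∧ ∀ r q,
      ‖dualKer k σ (σ + 1 / 2) (σ + 1 / 2 + 1 / 2 - σ) b b' (extR0 (shearMap k (r, q)).1)
        (extR0 q.2)‖ ≤ B q := by
  have hν : (σ + 1 / 2 + 1 / 2 - σ).re = 1 := by simp; ring
  obtain ⟨C, hC, ε, hε, hB⟩ := dualKer_bound k hσ (κ := σ + 1 / 2) (by simp) hν hb hb'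
  refine ⟨fun q => C * expWt (k + 1) ε (extR0 q.1) *
      Real.exp (-(3 / 4 * sumLog (k + 1) (extR0 q.2))),
    ((integrable_expWt (k + 1) hε).const_mul C).mul_prod
      (integrable_exp_neg_sumLog (k + 1) (r := 3 / 4) (by norm_num)), fun r q => ?_⟩
  refine (hB _ _).trans ?_
  refine mul_le_mul_of_nonneg_right (mul_le_mul_of_nonneg_left ?_ hC) (Real.exp_pos _).le
  unfold expWt
  rw [Real.exp_le_exp, neg_le_neg_iff]
  refine mul_le_mul_of_nonneg_left ?_ hε.le
  have hsum : ∑ j ∈ Finset.range (k + 1), |extR0 q.1 j| =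
      ∑ j ∈ Finset.range (k + 1), |extR0 (shearMap k (r, q)).1 j| :=
    Finset.sum_congr rfl fun j hj => by
      rw [shearMap, extR0_snoc_lt _ _ (Finset.mem_range.1 hj)]
  rw [hsum, Finset.sum_range_succ _ (k + 1)]
  exact le_add_of_nonneg_right (abs_nonneg _)

theorem integrable_dualKer_slice (k : ℕ) {σ : ℂ} {b b' : ℕ → ℂ} (hσ : 0 < σ.re)
    (hb : ∀ j < k + 3, (b j).re = 0) (hb' : ∀ j < k + 1, (b' j).re = 0) (r : ℝ) :
    Integrable fun q : (Fin (k + 1) → ℝ) × (Fin (k + 1) → ℝ) =>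
      dualKer k σ 0 (1 / 2 - σ) b b' (extR0 (shearMap k (r, q)).1) (extR0 q.2) := by
  obtain ⟨B, hBi, hB⟩ := exists_integrable_bound_dualKer_shearMap k hσ hb hb'
  have hcont := continuous_dualKer_shearMap k σ (σ + 1 / 2) (σ + 1 / 2 + 1 / 2 - σ) hb hb'
  have h := Integrable.mono' hBi (hcont.comp (continuous_const.prodMk
    continuous_id)).aestronglyMeasurable (Filter.Eventually.of_forall fun q => hB r q)
  refine (h.const_mul (cexp (-((σ + 1 / 2) * r)))).congr (Filter.Eventually.of_forall fun q => ?_)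
  refine (congrArg (cexp (-((σ + 1 / 2) * r)) * ·)
    (dualKer_shearMap k σ (σ + 1 / 2) b b' r q)).trans ?_
  simp only
  rw [← mul_assoc, ← Complex.exp_add, neg_add_cancel, Complex.exp_zero, one_mul]

theorem continuous_dualJ (k : ℕ) {σ : ℂ} {b b' : ℕ → ℂ} (hσ : 0 < σ.re)
    (hb : ∀ j < k + 3, (b j).re = 0) (hb' : ∀ j < k + 1, (b' j).re = 0) :
    Continuous (dualJ k σ b b') := by
  obtain ⟨B, hBi, hB⟩ := exists_integrable_bound_dualKer_shearMap k hσ hb hb'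
  have hc : Continuous fun r : ℝ => cexp ((σ + 1 / 2) * r) * dualJ k σ b b' r := by
    simp_rw [exp_mul_dualJ]
    have hcont := continuous_dualKer_shearMap k σ (σ + 1 / 2) (σ + 1 / 2 + 1 / 2 - σ) hb hb'
    refine continuous_of_dominated (bound := B) (fun r => ?_)
      (fun r => Filter.Eventually.of_forall fun q => hB r q) hBi ?_
    · exact (hcont.comp (continuous_const.prodMk continuous_id)).aestronglyMeasurable
    · exact Filter.Eventually.of_forall fun q =>
        hcont.comp (continuous_id.prodMk continuous_const)
  have h2 : dualJ k σ b b' = fun r : ℝ =>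
      cexp (-((σ + 1 / 2) * r)) * (cexp ((σ + 1 / 2) * r) * dualJ k σ b b' r) := by
    ext r
    rw [← mul_assoc, ← Complex.exp_add, neg_add_cancel, Complex.exp_zero, one_mul]
  rw [h2]
  exact (by fun_prop : Continuous fun r : ℝ => cexp (-((σ + 1 / 2) * r))).mul hc

/-! ### Growth of the Gamma function in vertical strips -/

theorem norm_Gamma_le_Gamma_re {z : ℂ} (hz : 0 < z.re) :
    ‖Complex.Gamma z‖ ≤ Real.Gamma z.re := by
  rw [Complex.Gamma_eq_integral hz, Complex.GammaIntegral, Real.Gamma_eq_integral hz]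
  refine (norm_integral_le_integral_norm _).trans (le_of_eq ?_)
  refine setIntegral_congr_fun measurableSet_Ioi fun x hx => ?_
  have hx : 0 < x := hx
  simp only [norm_mul, norm_cpow_eq_rpow_re_of_pos hx, norm_real, Real.norm_eq_abs,
    abs_of_pos (Real.exp_pos _), sub_re, one_re]

theorem exists_norm_Gamma_le {δ : ℝ} (hδ : 0 < δ) (M : ℝ) :
    ∃ C : ℝ, 0 ≤ C ∧ ∀ z : ℂ, δ ≤ z.re → z.re ≤ M → ‖Complex.Gamma z‖ ≤ C := by
  have hc : ContinuousOn Real.Gamma (Set.Icc δ M) := fun x hx =>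
    (Real.differentiableAt_Gamma fun m => by
      have : (0 : ℝ) ≤ m := m.cast_nonneg
      have := hx.1
      linarith).continuousAt.continuousWithinAt
  obtain ⟨C, hC⟩ := isCompact_Icc.exists_bound_of_continuousOn hc
  refine ⟨max C 0, le_max_right _ _, fun z h1 h2 => ?_⟩
  exact ((norm_Gamma_le_Gamma_re (hδ.trans_le h1)).trans
    ((le_abs_self _).trans (hC z.re ⟨h1, h2⟩))).trans (le_max_left _ _)

theorem Gamma_add_natCast_eq {z : ℂ} (hz : 0 < z.re) (N : ℕ) :
    Complex.Gamma (z + N) = (∏ i ∈ Finset.range N, (z + i)) * Complex.Gamma z := by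
  induction N with
  | zero => simp
  | succ N ih =>
    have h0 : z + N ≠ 0 := fun h => by
      have := congrArg Complex.re h
      simp only [add_re, natCast_re, zero_re] at this
      have : (0 : ℝ) ≤ N := N.cast_nonneg
      linarith
    rw [Finset.prod_range_succ, mul_right_comm, ← ih, mul_comm, ← Complex.Gamma_add_one _ h0]
    push_cast
    ring_nf

/-- Functions that are holomorphic and of polynomial growth in a vertical strip. -/
def PolyGrowth (l M : ℝ) (f : ℂ → ℂ) : Prop :=
  ∃ (C : ℝ) (N : ℕ), 0 ≤ C ∧ ∀ z : ℂ, l ≤ z.re → z.re ≤ M → ‖f z‖ ≤ C * (1 + |z.im|) ^ N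

theorem PolyGrowth.mul {l M : ℝ} {f g : ℂ → ℂ} (hf : PolyGrowth l M f) (hg : PolyGrowth l M g) :
    PolyGrowth l M fun z => f z * g z := by
  obtain ⟨C, N, hC, h⟩ := hf
  obtain ⟨C', N', hC', h'⟩ := hg
  refine ⟨C * C', N + N', mul_nonneg hC hC', fun z h1 h2 => ?_⟩
  rw [norm_mul, pow_add, mul_mul_mul_comm]
  exact mul_le_mul (h z h1 h2) (h' z h1 h2) (norm_nonneg _) (by positivity)

theorem PolyGrowth.prod {l M : ℝ} {f : ℕ → ℂ → ℂ} {n : ℕ} (hf : ∀ j < n, PolyGrowth l M (f j)) :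
    PolyGrowth l M fun z => ∏ j ∈ Finset.range n, f j z := by
  induction n with
  | zero => exact ⟨1, 0, by simp, fun z _ _ => by simp⟩
  | succ n ih =>
    simp_rw [Finset.prod_range_succ]
    exact (ih fun j hj => hf j (by omega)).mul (hf n (by omega))

theorem polyGrowth_add_const (l M : ℝ) (c : ℂ) : PolyGrowth l M fun z => z + c := by
  refine ⟨|l| + |M| + ‖c‖ + 1, 1, by positivity, fun z h1 h2 => ?_⟩
  have h3 := norm_add_le z c
  have h4 := Complex.norm_le_abs_re_add_abs_im z
  have h5 : |z.re| ≤ |l| + |M| := by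
    rcases abs_cases z.re with h | h <;> rcases abs_cases l with h' | h' <;>
      rcases abs_cases M with h'' | h'' <;> linarith
  have h6 := abs_nonneg z.im
  have h7 : 0 ≤ |l| + |M| + ‖c‖ := by positivity
  rw [pow_one]
  nlinarith

theorem norm_betaIntegral_le {δ : ℝ} (hδ : 0 < δ) {d : ℂ} (hd : 0 < d.re) :
    ∃ C : ℝ, 0 ≤ C ∧ ∀ z : ℂ, δ ≤ z.re → ‖Complex.betaIntegral z d‖ ≤ C := by
  have hi := (Complex.betaIntegral_convergent (u := δ) (by simpa using hδ) hd).norm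
  rw [intervalIntegrable_iff_integrableOn_Ioc_of_le zero_le_one] at hi
  refine ⟨∫ x in Set.Ioc (0 : ℝ) 1, ‖(x : ℂ) ^ ((δ : ℂ) - 1) * (1 - (x : ℂ)) ^ (d - 1)‖,
    integral_nonneg fun x => norm_nonneg _, fun z hz => ?_⟩
  rw [Complex.betaIntegral, intervalIntegral.integral_of_le zero_le_one]
  refine norm_integral_le_of_norm_le hi ?_
  refine (ae_restrict_iff' measurableSet_Ioc).2 (Filter.Eventually.of_forall fun x hx => ?_)
  rw [norm_mul, norm_mul]
  refine mul_le_mul_of_nonneg_right ?_ (norm_nonneg _)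
  rw [norm_cpow_eq_rpow_re_of_pos hx.1, norm_cpow_eq_rpow_re_of_pos hx.1]
  exact Real.rpow_le_rpow_of_exponent_ge hx.1 hx.2 (by simpa using hz)

theorem polyGrowth_Gamma_div {l M : ℝ} {p q : ℂ} (hp : 0 < l + p.re) (hq : 0 < l + q.re) :
    PolyGrowth l M fun z => Complex.Gamma (z + p) / Complex.Gamma (z + q) := by
  obtain ⟨K, hK⟩ := exists_nat_gt (p.re - q.re)
  have hd : 0 < (q + K - p).re := by simp; linarith
  obtain ⟨C, hC, hB⟩ := norm_betaIntegral_le hp hd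
  have hconst : PolyGrowth l M fun z =>
      Complex.betaIntegral (z + p) (q + K - p) / Complex.Gamma (q + K - p) := by
    refine ⟨C / ‖Complex.Gamma (q + K - p)‖, 0, by positivity, fun z h1 h2 => ?_⟩
    rw [norm_div, pow_zero, mul_one]
    exact div_le_div_of_nonneg_right (hB _ (by simpa using h1)) (norm_nonneg _)
  have hprod : PolyGrowth l M fun z => ∏ i ∈ Finset.range K, (z + (q + i)) :=
    PolyGrowth.prod fun i _ => polyGrowth_add_const l M (q + i)
  obtain ⟨C', N, hC', h⟩ := hconst.mul hprod
  refine ⟨C', N, hC', fun z h1 h2 => ?_⟩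
  have hz1 : 0 < (z + p).re := by simp; linarith
  have hz2 : 0 < (z + q).re := by simp; linarith
  have hz3 : 0 < (z + q + K).re := by
    have : (0 : ℝ) ≤ K := K.cast_nonneg
    simp at hz2 ⊢
    linarith
  have e1 := Complex.Gamma_mul_Gamma_eq_betaIntegral hz1 hd
  have e2 := Gamma_add_natCast_eq hz2 K
  rw [show z + p + (q + K - p) = z + q + K by ring, e2] at e1
  have n1 := Complex.Gamma_ne_zero_of_re_pos hd
  have n2 := Complex.Gamma_ne_zero_of_re_pos hz2
  refine le_trans (le_of_eq ?_) (h z h1 h2)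
  congr 1
  simp only []
  rw [div_eq_iff n2, div_mul_eq_mul_div, div_mul_eq_mul_div, eq_div_iff n1, e1]
  simp_rw [← add_assoc]
  ring

theorem exists_norm_Gamma_mul_pow_le {l M : ℝ} {p : ℂ} (hp : 0 < l + p.re) (N : ℕ) :
    ∃ C : ℝ, 0 ≤ C ∧ ∀ z : ℂ, l ≤ z.re → z.re ≤ M →
      ‖Complex.Gamma (z + p)‖ * (1 + |z.im|) ^ N ≤ C := by
  obtain ⟨C, hC, h⟩ := exists_norm_Gamma_le hp (M + p.re + N)
  set δ := l + p.re
  set A := (1 + |p.im|) * (1 + 1 / δ)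
  have hA : 0 ≤ A := by positivity
  refine ⟨C * A ^ N, by positivity, fun z h1 h2 => ?_⟩
  have hz : 0 < (z + p).re := by simp; linarith
  have e := Gamma_add_natCast_eq hz N
  have hg := h (z + p + N) (by simp; linarith [N.cast_nonneg (α := ℝ)]) (by simp; linarith)
  rw [e, norm_mul, norm_prod] at hg
  have hi : ∀ i ∈ Finset.range N, 1 + |z.im| ≤ ‖z + p + i‖ * A := fun i _ => by
    have h3 : δ ≤ ‖z + p + i‖ := by
      refine le_trans ?_ (Complex.re_le_norm _)
      simp
      linarith [i.cast_nonneg (α := ℝ)]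
    have h4 : |z.im + p.im| ≤ ‖z + p + i‖ := by simpa using Complex.abs_im_le_norm (z + p + i)
    have h5 : |z.im| ≤ |z.im + p.im| + |p.im| := by
      simpa using abs_sub (z.im + p.im) p.im
    have h6 : 1 ≤ ‖z + p + i‖ * (1 / δ) := by
      rw [mul_one_div, le_div_iff₀ hp, one_mul]
      exact h3
    have h7 := abs_nonneg p.im
    calc 1 + |z.im| ≤ (1 + |p.im|) * (1 + |z.im + p.im|) := by
          nlinarith [abs_nonneg (z.im + p.im)]
      _ ≤ (1 + |p.im|) * (‖z + p + i‖ * (1 / δ) + ‖z + p + i‖) := by gcongr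
      _ = _ := by ring
  have hle : (1 + |z.im|) ^ N ≤ (∏ i ∈ Finset.range N, ‖z + p + i‖) * A ^ N := by
    have := Finset.prod_le_prod (fun i _ => by positivity) hi
    rwa [Finset.prod_const, Finset.card_range, Finset.prod_mul_distrib, Finset.prod_const,
      Finset.card_range] at this
  calc _ ≤ ‖Complex.Gamma (z + p)‖ * ((∏ i ∈ Finset.range N, ‖z + p + i‖) * A ^ N) := by gcongr
    _ = ((∏ i ∈ Finset.range N, ‖z + p + i‖) * ‖Complex.Gamma (z + p)‖) * A ^ N := by ring
    _ ≤ _ := by gcongr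

/-! ### Shifting vertical contours and Mellin inversion -/

theorem integrable_vertical {f : ℂ → ℂ} {l M C : ℝ}
    (hf : ∀ z : ℂ, l ≤ z.re → z.re ≤ M → DifferentiableAt ℂ f z)
    (hC : ∀ z : ℂ, l ≤ z.re → z.re ≤ M → ‖f z‖ * (1 + |z.im|) ^ 2 ≤ C) {x : ℝ} (h1 : l ≤ x)
    (h2 : x ≤ M) : Integrable fun y : ℝ => f (x + y * I) := by
  refine (integrable_inv_one_add_sq.const_mul C).mono' ?_ (Filter.Eventually.of_forall fun y => ?_)
  · refine (continuous_iff_continuousAt.2 fun y => ?_).aestronglyMeasurable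
    exact ContinuousAt.comp (f := fun y : ℝ => (x + y * I : ℂ))
      (hf _ (by simpa using h1) (by simpa using h2)).continuousAt (by fun_prop)
  · have h := hC (x + y * I) (by simpa using h1) (by simpa using h2)
    simp only [add_im, ofReal_im, mul_im, ofReal_re, I_im, I_re, mul_one, mul_zero, zero_add,
      add_zero] at h
    rw [← div_eq_mul_inv, le_div_iff₀ (by positivity)]
    refine le_trans (mul_le_mul_of_nonneg_left ?_ (norm_nonneg _)) h
    nlinarith [sq_abs y, abs_nonneg y]

theorem integral_vertical_eq {f : ℂ → ℂ} {l M C : ℝ} (hlM : l ≤ M)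
    (hf : ∀ z : ℂ, l ≤ z.re → z.re ≤ M → DifferentiableAt ℂ f z)
    (hC : ∀ z : ℂ, l ≤ z.re → z.re ≤ M → ‖f z‖ * (1 + |z.im|) ^ 2 ≤ C) :
    ∫ y : ℝ, f (l + y * I) = ∫ y : ℝ, f (M + y * I) := by
  have hrect : ∀ T : ℝ, (∫ y in (-T)..T, f (M + y * I)) - (∫ y in (-T)..T, f (l + y * I)) =
      I * ((∫ x in l..M, f (x + (-T : ℝ) * I)) - ∫ x in l..M, f (x + T * I)) := by
    intro T
    have h := Complex.integral_boundary_rect_eq_zero_of_differentiableOn f (l + (-T : ℝ) * I)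
      (M + T * I) (fun z hz => by
        have h1 := hz.1
        simp [Set.uIcc_of_le hlM] at h1
        exact (hf z h1.1 h1.2).differentiableWithinAt)
    simp only [add_im, ofReal_im, mul_im, ofReal_re, I_im, I_re, mul_one, mul_zero, zero_add,
      add_zero, add_re, mul_re, sub_self, smul_eq_mul] at h
    have hI := Complex.I_mul_I
    linear_combination (-I) * h + ((∫ y in (-T)..T, f (M + y * I)) -
      (∫ y in (-T)..T, f (l + y * I))) * hI
  have hh : ∀ T : ℝ, ‖∫ x in l..M, f (x + T * I)‖ ≤ C * (1 + |T|)⁻¹ * |M - l| := fun T => by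
    refine intervalIntegral.norm_integral_le_of_norm_le_const fun x hx => ?_
    rw [Set.uIoc_of_le hlM] at hx
    have h := hC (x + T * I) (by simpa using hx.1.le) (by simpa using hx.2)
    simp only [add_im, ofReal_im, mul_im, ofReal_re, I_im, I_re, mul_one, mul_zero, zero_add,
      add_zero] at h
    rw [← div_eq_mul_inv, le_div_iff₀ (by positivity)]
    refine le_trans (mul_le_mul_of_nonneg_left ?_ (norm_nonneg _)) h
    nlinarith [abs_nonneg T]
  have hlim : Filter.Tendsto (fun T : ℝ => C * (1 + |T|)⁻¹ * |M - l|) Filter.atTop (nhds 0) := by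
    have : Filter.Tendsto (fun T : ℝ => (1 + |T|)⁻¹) Filter.atTop (nhds 0) :=
      (Filter.tendsto_atTop_add_const_left _ 1 Filter.tendsto_abs_atTop_atTop).inv_tendsto_atTop
    simpa using (this.const_mul C).mul_const |M - l|
  have hz : Filter.Tendsto (fun T : ℝ => I * ((∫ x in l..M, f (x + (-T : ℝ) * I)) -
      ∫ x in l..M, f (x + T * I))) Filter.atTop (nhds 0) := by
    have h1 := squeeze_zero_norm (fun T => by simpa only [abs_neg] using hh (-T)) hlim
    have h2 := squeeze_zero_norm hh hlim
    simpa using (h1.sub h2).const_mul I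
  have e1 := intervalIntegral_tendsto_integral (integrable_vertical hf hC le_rfl hlM)
    Filter.tendsto_neg_atTop_atBot Filter.tendsto_id
  have e2 := intervalIntegral_tendsto_integral (integrable_vertical hf hC hlM le_rfl)
    Filter.tendsto_neg_atTop_atBot Filter.tendsto_id
  have e3 := tendsto_nhds_unique ((e2.sub e1).congr hrect) hz
  exact (sub_eq_zero.1 e3).symm

/-- A quotient of products of Gamma functions with two more factors in the numerator. -/
def gammaQuot (k : ℕ) (b e : ℕ → ℂ) (z : ℂ) : ℂ :=
  (∏ j ∈ Finset.range (k + 3), Complex.Gamma (z + b j)) /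
    ∏ j ∈ Finset.range (k + 1), Complex.Gamma (z + e j)

theorem differentiableAt_Gamma_of_re_pos {z : ℂ} (hz : 0 < z.re) :
    DifferentiableAt ℂ Complex.Gamma z :=
  Complex.differentiableAt_Gamma _ fun m h => by
    have h1 := congrArg Complex.re h
    simp only [neg_re, natCast_re] at h1
    linarith [m.cast_nonneg (α := ℝ)]

theorem differentiableAt_gammaQuot (k : ℕ) {b e : ℕ → ℂ} {z : ℂ}
    (hb : ∀ j < k + 3, 0 < (z + b j).re) (he : ∀ j < k + 1, 0 < (z + e j).re) :
    DifferentiableAt ℂ (gammaQuot k b e) z := by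
  have hG : ∀ c : ℂ, 0 < (z + c).re →
      DifferentiableAt ℂ (fun z => Complex.Gamma (z + c)) z := fun c hc =>
    DifferentiableAt.comp z (g := Complex.Gamma) (f := fun z => z + c)
      (differentiableAt_Gamma_of_re_pos hc) (by fun_prop)
  refine DifferentiableAt.div ?_ ?_ ?_
  · exact DifferentiableAt.fun_finsetProd fun j hj => hG _ (hb j (Finset.mem_range.1 hj))
  · exact DifferentiableAt.fun_finsetProd fun j hj => hG _ (he j (Finset.mem_range.1 hj))
  · exact Finset.prod_ne_zero_iff.2 fun j hj =>
      Complex.Gamma_ne_zero_of_re_pos (he j (Finset.mem_range.1 hj))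

theorem gammaQuot_decay (k : ℕ) {b e : ℕ → ℂ} {l M : ℝ} (hb : ∀ j < k + 3, 0 < l + (b j).re)
    (he : ∀ j < k + 1, 0 < l + (e j).re) :
    ∃ C : ℝ, 0 ≤ C ∧ ∀ z : ℂ, l ≤ z.re → z.re ≤ M →
      ‖gammaQuot k b e z‖ * (1 + |z.im|) ^ 2 ≤ C := by
  obtain ⟨C, N, hC, h⟩ : PolyGrowth l M fun z =>
      ∏ j ∈ Finset.range (k + 1), Complex.Gamma (z + b j) / Complex.Gamma (z + e j) :=
    PolyGrowth.prod fun j hj => polyGrowth_Gamma_div (hb j (by omega)) (he j hj)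
  obtain ⟨C1, hC1, h1⟩ := exists_norm_Gamma_mul_pow_le (M := M) (hb (k + 1) (by omega)) N
  obtain ⟨C2, hC2, h2⟩ := exists_norm_Gamma_mul_pow_le (M := M) (hb (k + 2) (by omega)) 2
  refine ⟨C * C1 * C2, by positivity, fun z hz1 hz2 => ?_⟩
  have e1 : gammaQuot k b e z =
      (∏ j ∈ Finset.range (k + 1), Complex.Gamma (z + b j) / Complex.Gamma (z + e j)) *
        (Complex.Gamma (z + b (k + 1)) * Complex.Gamma (z + b (k + 2))) := by
    rw [gammaQuot, Finset.prod_range_succ, Finset.prod_range_succ, Finset.prod_div_distrib]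
    ring
  rw [e1, norm_mul, norm_mul]
  calc _ ≤ (C * (1 + |z.im|) ^ N) * (‖Complex.Gamma (z + b (k + 1))‖ *
        ‖Complex.Gamma (z + b (k + 2))‖) * (1 + |z.im|) ^ 2 := by
        gcongr
        exact h z hz1 hz2
    _ = C * (‖Complex.Gamma (z + b (k + 1))‖ * (1 + |z.im|) ^ N) *
        (‖Complex.Gamma (z + b (k + 2))‖ * (1 + |z.im|) ^ 2) := by ring
    _ ≤ _ := by
        gcongr
        · exact h1 z hz1 hz2
        · exact h2 z hz1 hz2

theorem integral_gammaQuot_eq (k : ℕ) {b e : ℕ → ℂ} {l M : ℝ} (hlM : l ≤ M)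
    (hb : ∀ j < k + 3, 0 < l + (b j).re) (he : ∀ j < k + 1, 0 < l + (e j).re) (r : ℝ) :
    ∫ y : ℝ, cexp (-((l + y * I) * r)) * gammaQuot k b e (l + y * I) =
      ∫ y : ℝ, cexp (-((M + y * I) * r)) * gammaQuot k b e (M + y * I) := by
  obtain ⟨C, hC, h⟩ := gammaQuot_decay k (M := M) hb he
  refine integral_vertical_eq (f := fun z => cexp (-(z * r)) * gammaQuot k b e z)
    (C := Real.exp ((|l| + |M|) * |r|) * C) hlM (fun z h1 h2 => ?_) (fun z h1 h2 => ?_)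
  · exact DifferentiableAt.mul (by fun_prop) (differentiableAt_gammaQuot k
      (fun j hj => by simp; linarith [hb j hj]) fun j hj => by simp; linarith [he j hj])
  · rw [norm_mul, mul_assoc]
    refine mul_le_mul ?_ (h z h1 h2) (by positivity) (Real.exp_pos _).le
    rw [Complex.norm_exp, Real.exp_le_exp]
    simp only [neg_re, mul_re, ofReal_re, ofReal_im, mul_zero, sub_zero]
    refine (neg_le_abs _).trans ?_
    rw [abs_mul]
    refine mul_le_mul_of_nonneg_right ?_ (abs_nonneg r)
    rcases abs_cases z.re with h | h <;> rcases abs_cases l with h' | h' <;>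
      rcases abs_cases M with h'' | h'' <;> linarith

theorem dualJ_eq (k : ℕ) {σ : ℂ} {b b' : ℕ → ℂ} (hσ : 0 < σ.re)
    (hb : ∀ j < k + 3, (b j).re = 0) (hb' : ∀ j < k + 1, (b' j).re = 0) (r : ℝ) {c : ℝ}
    (hc : 0 < c) (hc' : 0 < c + 1 / 2 - σ.re) :
    dualJ k σ b b' r = ((Real.sqrt Real.pi ^ (k + 1) : ℝ) : ℂ) *
      (∏ j ∈ Finset.range (k + 3), ∏ l ∈ Finset.range (k + 1), Complex.Gamma (σ + b j + b' l)) *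
      ((2 * Real.pi : ℂ)⁻¹ * ∫ y : ℝ, cexp (-((c + y * I) * r)) *
        gammaQuot k b (fun j => 1 / 2 - σ - b' j) (c + y * I)) := by
  set K : ℂ := ((Real.sqrt Real.pi ^ (k + 1) : ℝ) : ℂ) *
      (∏ j ∈ Finset.range (k + 3), ∏ l ∈ Finset.range (k + 1), Complex.Gamma (σ + b j + b' l))
  set e : ℕ → ℂ := fun j => 1 / 2 - σ - b' j with he
  set c₀ : ℝ := σ.re + 1 / 2 with hc₀
  have hbl : ∀ l : ℝ, 0 < l → ∀ j < k + 3, 0 < l + (b j).re := fun l hl j hj => by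
    rw [hb j hj]; linarith
  have hel : ∀ l : ℝ, 0 < l + 1 / 2 - σ.re → ∀ j < k + 1, 0 < l + (e j).re := fun l hl j hj => by
    simp [he, hb' j hj]; linarith
  have hshift : ∫ y : ℝ, cexp (-((c + y * I) * r)) * gammaQuot k b e (c + y * I) =
      ∫ y : ℝ, cexp (-((c₀ + y * I) * r)) * gammaQuot k b e (c₀ + y * I) := by
    rcases le_total c c₀ with h | h
    · exact integral_gammaQuot_eq k h (hbl c hc) (hel c hc') r
    · exact (integral_gammaQuot_eq k h (hbl c₀ (by linarith)) (hel c₀ (by linarith)) r).symm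
  rw [hshift]
  set f : ℝ → ℂ := fun t => dualJ k σ b b' (Real.log t)
  have hfun : ∀ (κ : ℂ) (y : ℝ), Real.exp y • (((Real.exp y : ℝ) : ℂ) ^ (κ - 1) • f (Real.exp y)) =
      cexp (κ * y) * dualJ k σ b b' y := fun κ y => by
    simp only [f, Real.log_exp, smul_eq_mul, ofReal_exp_cpow, real_smul]
    rw [ofReal_exp, ← mul_assoc, ← Complex.exp_add]
    ring_nf
  have hmel : ∀ κ : ℂ, mellin f κ = ∫ y : ℝ, cexp (κ * y) * dualJ k σ b b' y := fun κ => by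
    rw [mellin, integral_Ioi_eq_integral_comp_exp]
    simp_rw [hfun]
  have hconv : MellinConvergent f c₀ := by
    rw [MellinConvergent, integrableOn_Ioi_iff_integrable_comp_exp]
    simp_rw [hfun]
    exact (integral_exp_mul_dualJ k hσ (by simp [hc₀]) hb hb').1
  have hval : ∀ y : ℝ, mellin f (c₀ + y * I) = K * gammaQuot k b e (c₀ + y * I) := fun y => by
    have h := (integral_exp_mul_dualJ k (κ := c₀ + y * I) hσ (by simp [hc₀]) hb hb').2
    rw [← hmel] at h
    have hne : (∏ j ∈ Finset.range (k + 1), Complex.Gamma (c₀ + y * I + e j)) ≠ 0 :=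
      Finset.prod_ne_zero_iff.2 fun j hj => Complex.Gamma_ne_zero_of_re_pos (by
        have := hel c₀ (by linarith) j (Finset.mem_range.1 hj)
        simpa using this)
    have hee : ∀ j, (c₀ + y * I + 1 / 2 - σ - b' j : ℂ) = c₀ + y * I + e j := fun j => by
      simp only [he]; ring
    simp_rw [hee] at h
    rw [gammaQuot, mul_div_assoc', eq_div_iff hne, mul_comm, h]
    ring
  have hvert : VerticalIntegrable (mellin f) c₀ := by
    obtain ⟨C, hC, h⟩ := gammaQuot_decay k (M := c₀) (hbl c₀ (by linarith)) (hel c₀ (by linarith))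
    have := integrable_vertical (f := gammaQuot k b e) (fun z h1 h2 => differentiableAt_gammaQuot k
      (fun j hj => by simp; linarith [hbl c₀ (by linarith) j hj])
      fun j hj => by
        have := hel c₀ (by linarith) j hj
        rw [add_re]; linarith) h le_rfl le_rfl
    exact (this.const_mul K).congr (Filter.Eventually.of_forall fun y => (hval y).symm)
  have hcont : ContinuousAt f (Real.exp r) :=
    (continuous_dualJ k hσ hb hb').continuousAt.comp (Real.continuousAt_log (Real.exp_pos r).ne')
  have hinv := mellinInv_mellin_eq c₀ f (Real.exp_pos r) hconv hvert hcont
  have hr : f (Real.exp r) = dualJ k σ b b' r := by simp [f]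
  rw [← hr, ← hinv, mellinInv]
  simp_rw [hval, ofReal_exp_cpow, smul_eq_mul]
  rw [real_smul, mul_left_comm K, ← integral_const_mul K]
  push_cast
  rw [one_div]
  congr 1
  refine integral_congr_ae (Filter.Eventually.of_forall fun y => ?_)
  simp only [neg_mul]
  ring

/-! ### Class one Whittaker functions in logarithmic coordinates -/

theorem hasFDerivAt_exp_comp {k : ℕ} (z : Fin k → ℝ) :
    HasFDerivAt (fun (z : Fin k → ℝ) i => Real.exp (z i))
      (Matrix.toLin' (Matrix.diagonal fun i => Real.exp (z i))).toContinuousLinearMap z := by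
  rw [hasFDerivAt_pi']
  intro i
  have h : HasFDerivAt (fun z : Fin k → ℝ => z i)
      (ContinuousLinearMap.proj (R := ℝ) (φ := fun _ : Fin k => ℝ) i) z := hasFDerivAt_apply i z
  refine h.exp.congr_fderiv ?_
  ext v
  simp [Matrix.mulVec_diagonal]

theorem integral_posSet {k : ℕ} (f : (Fin k → ℝ) → ℂ) : ∫ t in posSet k, f t =
    ∫ z : Fin k → ℝ, ((∏ i, Real.exp (z i) : ℝ) : ℂ) * f fun i => Real.exp (z i) := by
  have himg : (fun (z : Fin k → ℝ) i => Real.exp (z i)) '' Set.univ = posSet k := by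
    ext t
    simp only [Set.image_univ, Set.mem_range, posSet, Set.mem_ofPred_eq]
    refine ⟨fun ⟨z, hz⟩ j => hz ▸ Real.exp_pos _, fun h => ⟨fun j => Real.log (t j), ?_⟩⟩
    ext j
    exact Real.exp_log (h j)
  rw [← himg, integral_image_eq_integral_abs_det_fderiv_smul volume MeasurableSet.univ
    (fun z _ => (hasFDerivAt_exp_comp z).hasFDerivWithinAt) (fun z _ w _ h => by
      ext i; exact Real.exp_injective (congrFun h i)), setIntegral_univ]
  congr 1 with z
  rw [ContinuousLinearMap.det, LinearMap.coe_toContinuousLinearMap, LinearMap.det_toLin',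
    Matrix.det_diagonal, abs_of_pos (Finset.prod_pos fun i _ => Real.exp_pos _), real_smul]

theorem integral_posSet_mul_inv {k : ℕ} (f : (Fin k → ℝ) → ℂ) :
    ∫ t in posSet k, f t * (∏ j ∈ Finset.range k, ((extR t j : ℝ) : ℂ))⁻¹ =
      ∫ z : Fin k → ℝ, f fun i => Real.exp (z i) := by
  rw [integral_posSet]
  congr 1 with z
  have h : ∏ j ∈ Finset.range k, ((extR (fun i => Real.exp (z i)) j : ℝ) : ℂ) =
      ((∏ i, Real.exp (z i) : ℝ) : ℂ) := by
    rw [Finset.prod_range, ofReal_prod]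
    exact Finset.prod_congr rfl fun i _ => by simp [extR]
  have hne : ((∏ i, Real.exp (z i) : ℝ) : ℂ) ≠ 0 :=
    ofReal_ne_zero.2 (Finset.prod_pos fun i _ => Real.exp_pos _).ne'
  rw [h, mul_comm, mul_assoc, inv_mul_cancel₀ hne, mul_one]

theorem kLam_add_const (n : ℕ) (c : ℂ) (x z : ℕ → ℝ) (l : ℝ) :
    kLam n c (fun j => x j + l) (fun j => z j + l) = cexp (c * l) * kLam n c x z := by
  rw [kLam_eq, kLam_eq, ← Complex.exp_add]
  congr 1
  simp only [add_sub_add_right_eq_sub, Finset.sum_add_distrib, Finset.sum_const,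
    Finset.card_range, nsmul_eq_mul]
  push_cast
  ring

theorem toda_add_const (n : ℕ) (c : ℕ → ℂ) (x : ℕ → ℝ) (l : ℝ) :
    toda n c (fun j => x j + l) = cexp ((∑ j ∈ Finset.range n, c j) * l) * toda n c x := by
  induction n generalizing c x with
  | zero => simp [toda_zero]
  | succ n ih =>
    rw [toda_succ, toda_succ, ← integral_const_mul, ← integral_add_right_eq_self _ fun _ => l]
    congr 1 with z
    have hz : ∀ j < n, extR0 (z + fun _ => l) j = extR0 z j + l := fun j hj => by
      rw [extR0_of_lt _ hj, extR0_of_lt _ hj]; rfl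
    rw [kLam_congr_right _ hz, toda_congr (fun _ _ => rfl) hz, kLam_add_const, ih,
      Finset.sum_range_succ', add_mul, Complex.exp_add]
    ring

theorem kLam_add_param (n : ℕ) (c t : ℂ) (x z : ℕ → ℝ) :
    kLam n (c + t) x z = cexp (t * ((∑ j ∈ Finset.range (n + 1), x j : ℝ) : ℂ)) *
      cexp (-(t * ((∑ j ∈ Finset.range n, z j : ℝ) : ℂ))) * kLam n c x z := by
  rw [kLam_eq, kLam_eq, ← Complex.exp_add, ← Complex.exp_add]
  congr 1
  push_cast
  ring

theorem toda_add_param (n : ℕ) (c : ℕ → ℂ) (t : ℂ) (x : ℕ → ℝ) :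
    toda n (fun j => c j + t) x =
      cexp (t * ((∑ j ∈ Finset.range n, x j : ℝ) : ℂ)) * toda n c x := by
  induction n generalizing c x with
  | zero => simp [toda_zero]
  | succ n ih =>
    rw [toda_succ, toda_succ, ← integral_const_mul]
    congr 1 with z
    rw [ih, kLam_add_param]
    have h : cexp (-(t * ((∑ j ∈ Finset.range n, extR0 z j : ℝ) : ℂ))) *
        cexp (t * ((∑ j ∈ Finset.range n, extR0 z j : ℝ) : ℂ)) = 1 := by
      rw [← Complex.exp_add, neg_add_cancel, Complex.exp_zero]
    linear_combination (cexp (t * ((∑ j ∈ Finset.range (n + 1), x j : ℝ) : ℂ)) *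
      kLam n (c 0) x (extR0 z) * toda n (fun j => c (j + 1)) (extR0 z)) * h

theorem toda_one (c : ℕ → ℂ) (x : ℕ → ℝ) : toda 1 c x = cexp (c 0 * x 0) := by
  rw [toda_succ]
  simp [toda_zero, kLam, prodKer, measureReal_def, volume_pi]

theorem BesselK_eq (ν : ℂ) (u : ℝ) : 2 * BesselK ν (2 * Real.exp u) =
    ∫ z : ℝ, expKer (Real.exp u) (Real.exp u) ν z := by
  rw [BesselK, integral_Ioi_eq_integral_comp_exp, ← mul_assoc]
  norm_num
  congr 1 with z
  have h0 : ((Real.exp z : ℝ) : ℂ) ≠ 0 := ofReal_ne_zero.2 (Real.exp_pos z).ne'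
  rw [← ofReal_exp z, ofReal_exp_cpow, mul_div_cancel₀ _ h0, expKer, Complex.exp_add,
    Real.exp_neg]
  push_cast
  ring_nf

/-- The logarithmic Toda coordinates attached to the logarithms of simple root coordinates. -/
def rootLog (n : ℕ) (η : ℕ → ℝ) (j : ℕ) : ℝ :=
  2 * ∑ p ∈ Finset.Ico j n, (η p + Real.log Real.pi)

theorem rootLog_of_le {n j : ℕ} (η : ℕ → ℝ) (h : n ≤ j) : rootLog n η j = 0 := by
  simp [rootLog, Finset.Ico_eq_empty_of_le h]

theorem rootLog_eq_add {n j : ℕ} (η : ℕ → ℝ) (h : j < n) :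
    rootLog n η j = 2 * (η j + Real.log Real.pi) + rootLog n η (j + 1) := by
  rw [rootLog, Finset.sum_eq_sum_Ico_succ_bot h, mul_add]
  rfl

theorem rootLog_telescope {n j : ℕ} {η Z : ℕ → ℝ} (hj : j ≤ n)
    (h : ∀ p < n, 2 * (η p + Real.log Real.pi) = Z p - Z (p + 1)) :
    rootLog n η j = Z j - Z n := by
  induction hj using Nat.decreasingInduction with
  | self => rw [rootLog_of_le η le_rfl, sub_self]
  | of_succ k hk ih => rw [rootLog_eq_add η hk, h k hk, ih]; ring

theorem toda_two (c : ℕ → ℂ) {x : ℕ → ℝ} (hx : x 1 = 0) : toda 2 c x =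
    cexp ((c 0 + c 1) * x 0 / 2) *
      ∫ z : ℝ, expKer (Real.exp (x 0 / 2)) (Real.exp (x 0 / 2)) (c 0 - c 1) z := by
  rw [toda_succ]
  have h := (volume_preserving_funUnique (Fin 1) ℝ).symm.integral_comp
    (MeasurableEquiv.measurableEmbedding _)
    (fun z : Fin 1 → ℝ => kLam 1 (c 0) x (extR0 z) * toda 1 (fun j => c (j + 1)) (extR0 z))
  refine h.symm.trans ?_
  rw [← integral_sub_left_eq_self _ volume (x 0 / 2), ← integral_const_mul]
  congr 1 with z
  have hz : extR0 ((MeasurableEquiv.funUnique (Fin 1) ℝ).symm (x 0 / 2 - z)) 0 = x 0 / 2 - z := by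
    simp [extR0]
  rw [toda_one, kLam_eq, hz, expKer, ← Complex.exp_add, ← Complex.exp_add]
  congr 1
  simp only [Finset.sum_range_succ, Finset.sum_range_zero, hz, hx, zero_add, ← Real.exp_add]
  have e1 : x 0 - (x 0 / 2 - z) = x 0 / 2 + z := by ring
  have e2 : x 0 / 2 - z - 0 = x 0 / 2 + -z := by ring
  rw [e1, e2]
  push_cast
  ring

theorem log_pi_exp : Real.pi = Real.exp (Real.log Real.pi) := (Real.exp_log Real.pi_pos).symm

theorem WhittAr_two (a : ℕ → ℂ) {y : ℕ → ℝ} {η : ℕ → ℝ} (hy : y 0 = Real.exp (η 0)) :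
    WhittAr 2 a y = cexp (-((a 0 + a 1) / 2 * Real.log Real.pi)) *
      toda 2 (fun j => a j / 2) (rootLog 1 η) := by
  have h0 : rootLog 1 η 0 / 2 = η 0 + Real.log Real.pi := by simp [rootLog]
  have h1 : 2 * Real.pi * y 0 = 2 * Real.exp (η 0 + Real.log Real.pi) := by
    rw [hy, Real.exp_add, Real.exp_log Real.pi_pos]; ring
  have h2 : WhittAr 2 a y = (y 0 : ℂ) ^ ((a 0 + a 1) / 2) *
      (2 * BesselK ((a 0 - a 1) / 2) (2 * Real.pi * y 0)) := by
    rw [WhittAr]; ring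
  rw [toda_two _ (rootLog_of_le η le_rfl), h0, h2, h1, BesselK_eq, hy, ofReal_exp_cpow, ← mul_assoc,
    ← Complex.exp_add, ← sub_div]
  congr 2
  have h3 : rootLog 1 η 0 = 2 * (η 0 + Real.log Real.pi) := by linarith
  rw [h3]
  push_cast
  ring

theorem sumA_tildeA (n : ℕ) (a : ℕ → ℂ) : sumA (n + 2) (tildeA (n + 3) a) = sumA (n + 3) a := by
  have h : (((n + 3 : ℕ) : ℂ) - 1) = ((n + 2 : ℕ) : ℂ) := by push_cast; ring
  have h0 : ((n + 2 : ℕ) : ℂ) ≠ 0 := Nat.cast_ne_zero.2 (by omega)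
  simp only [sumA, tildeA]
  rw [Finset.sum_add_distrib, Finset.sum_const, Finset.card_range, nsmul_eq_mul, h,
    mul_div_cancel₀ _ h0, ← Finset.sum_range_succ']

theorem sum_telescope (N M : ℕ) (X : ℕ → ℝ) :
    ∑ j ∈ Finset.range M, (((N : ℝ) - j) * X j + (j + 1) * X (j + 1)) =
      N * ∑ j ∈ Finset.range M, X j + M * X M := by
  induction M with
  | zero => simp
  | succ M ih =>
    rw [Finset.sum_range_succ, ih, Finset.sum_range_succ]
    push_cast
    ring

theorem WhittAr_eq_toda (n : ℕ) (a : ℕ → ℂ) (y η : ℕ → ℝ) (hy : ∀ j < n, y j = Real.exp (η j)) :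
    WhittAr (n + 1) a y = cexp (-(n * sumA (n + 1) a / 2 * Real.log Real.pi)) *
      toda (n + 1) (fun j => a j / 2) (rootLog n η) := by
  induction n generalizing a y η with
  | zero => simp [WhittAr, toda_one, rootLog]
  | succ n ih =>
    rcases n with _ | n
    · rw [WhittAr_two a (hy 0 (by omega))]
      simp [sumA, Finset.sum_range_succ]
    set X := rootLog (n + 2) η with hX
    set L := Real.log Real.pi with hL
    have hXs : ∀ j < n + 2, X j = 2 * (η j + L) + X (j + 1) := fun j hj => rootLog_eq_add η hj
    have hXl : X (n + 2) = 0 := rootLog_of_le η le_rfl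
    rw [WhittAr, integral_posSet_mul_inv (fun t => WhittAr (n + 2) (tildeA (n + 3) a)
            (fun j => y (j + 1) * Real.sqrt (extR t (j + 1) / extR t j)) *
          (∏ j ∈ Finset.range (n + 2),
            Complex.exp (((-(Real.pi * y j) ^ 2 * extR t j - 1 / extR t j : ℝ) : ℂ)) *
              ((Real.pi * y j : ℝ) : ℂ) ^ ((((n + 2 - j : ℕ) : ℂ) * a 0) / ((n + 2 : ℕ) : ℂ)) *
              ((extR t j : ℝ) : ℂ) ^ ((((n + 3 : ℕ) : ℂ) * a 0) / (2 * ((n + 2 : ℕ) : ℂ)))) *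
          ((Real.pi * extR t (n + 1) : ℝ) : ℂ) ^ (-(sumA (n + 3) a) / 2)),
      toda_succ, ← integral_const_mul, ← integral_sub_left_eq_self _ volume
        (fun j : Fin (n + 2) => X (j + 1))]
    congr 1 with z
    set t : Fin (n + 2) → ℝ := fun i => Real.exp (((fun j : Fin (n + 2) => X (j + 1)) - z) i)
    have ht : ∀ j < n + 2, extR t j = Real.exp (X (j + 1) - extR0 z j) := fun j hj => by
      simp [extR, extR0, hj, t]
    have hfac : ∀ j ∈ Finset.range (n + 2),
        Complex.exp (((-(Real.pi * y j) ^ 2 * extR t j - 1 / extR t j : ℝ) : ℂ)) *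
          ((Real.pi * y j : ℝ) : ℂ) ^ ((((n + 2 - j : ℕ) : ℂ) * a 0) / ((n + 2 : ℕ) : ℂ)) *
          ((extR t j : ℝ) : ℂ) ^ ((((n + 3 : ℕ) : ℂ) * a 0) / (2 * ((n + 2 : ℕ) : ℂ))) =
        cexp (-((Real.exp (X j - extR0 z j) + Real.exp (extR0 z j - X (j + 1)) : ℝ) : ℂ) +
          a 0 / (2 * ((n + 2 : ℕ) : ℂ)) * ((((((n + 2 : ℕ) : ℝ) - j) * X j + (j + 1) * X (j + 1)) -
            (n + 3) * extR0 z j : ℝ) : ℂ)) := fun j hj => by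
      have hj := Finset.mem_range.1 hj
      have h1 : Real.pi * y j = Real.exp (η j + L) := by
        rw [hy j hj, Real.exp_add, hL, Real.exp_log Real.pi_pos, mul_comm]
      have h2 : η j + L = (X j - X (j + 1)) / 2 := by rw [hXs j hj]; ring
      have h0 : ((n + 2 : ℕ) : ℂ) ≠ 0 := Nat.cast_ne_zero.2 (by omega)
      rw [h1, ht j hj, ofReal_exp_cpow, ofReal_exp_cpow, ← Complex.exp_add, ← Complex.exp_add, h2,
        one_div, ← Real.exp_neg, ← Real.exp_nat_mul, neg_mul, ← Real.exp_add, neg_sub,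
        show ((2 : ℕ) : ℝ) * ((X j - X (j + 1)) / 2) + (X (j + 1) - extR0 z j) = X j - extR0 z j by
          push_cast; ring, Nat.cast_sub hj.le]
      congr 1
      push_cast at h0 ⊢
      field_simp
      ring
    have hin : WhittAr (n + 2) (tildeA (n + 3) a)
        (fun j => y (j + 1) * Real.sqrt (extR t (j + 1) / extR t j)) =
        cexp (-(((n + 1 : ℕ) : ℂ) * sumA (n + 3) a / 2 * L)) *
        (cexp (sumA (n + 3) a / 2 * -extR0 z (n + 1)) *
        (cexp (a 0 / (2 * ((n + 2 : ℕ) : ℂ)) * ((∑ j ∈ Finset.range (n + 2), extR0 z j : ℝ) : ℂ)) *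
          toda (n + 2) (fun j => a (j + 1) / 2) (extR0 z))) := by
      set η' : ℕ → ℝ := fun j => η (j + 1) +
        ((X (j + 2) - extR0 z (j + 1)) - (X (j + 1) - extR0 z j)) / 2
      rw [ih (tildeA (n + 3) a) _ η' fun j hj => ?_, sumA_tildeA,
        toda_congr (fun _ _ => rfl) (x' := fun j => extR0 z j + -extR0 z (n + 1)) fun j hj => ?_,
        toda_add_const, toda_congr (c' := fun j => a (j + 1) / 2 + a 0 / (2 * ((n + 2 : ℕ) : ℂ)))
          (fun j hj => ?_) (fun _ _ => rfl), toda_add_param, ← Finset.sum_div]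
      · rw [show ∑ i ∈ Finset.range (n + 1 + 1), tildeA (n + 3) a i = sumA (n + 3) a from
          sumA_tildeA n a, ofReal_neg]
      · simp only [tildeA]
        have h : (((n + 3 : ℕ) : ℂ) - 1) = ((n + 2 : ℕ) : ℂ) := by push_cast; ring
        rw [h, add_div, div_div, mul_comm (2 : ℂ)]
      · rw [rootLog_telescope (Z := extR0 z) (by omega) fun p hp => ?_, sub_eq_add_neg]
        have := hXs (p + 1) (by omega)
        simp only [η']
        linarith
      · rw [hy (j + 1) (by omega), ht (j + 1) (by omega), ht j (by omega), ← Real.exp_sub,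
          Real.sqrt_eq_rpow, ← Real.exp_mul, ← Real.exp_add]
        congr 1
        simp only [η']
        ring
    rw [hin, Finset.prod_congr rfl hfac, ← Complex.exp_sum, Finset.sum_add_distrib,
      ← Finset.mul_sum, ← ofReal_sum, Finset.sum_sub_distrib, sum_telescope, ← Finset.mul_sum,
      Finset.sum_neg_distrib, ← ofReal_sum, kLam_eq, ht (n + 1) (by omega)]
    have hpi : Real.pi * Real.exp (X (n + 1 + 1) - extR0 z (n + 1)) =
        Real.exp (L - extR0 z (n + 1)) := by
      rw [hXl, zero_sub, sub_eq_add_neg L, Real.exp_add, hL, Real.exp_log Real.pi_pos]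
    rw [hpi, ofReal_exp_cpow]
    have hn : ((n : ℂ) + 2) ≠ 0 := by exact_mod_cast (Nat.succ_ne_zero (n + 1))
    simp only [← mul_assoc, ← Complex.exp_add]
    rw [mul_right_comm _ (toda _ _ _), mul_right_comm _ (toda _ _ _), ← Complex.exp_add,
      ← Complex.exp_add]
    congr 2
    rw [Finset.sum_range_succ (fun j => X j) (n + 2), hXl]
    push_cast
    field_simp
    ring

/-! ### Whittaker functions on the group -/

/-- Upper triangular unipotent matrices. -/
def IsUnip {n : ℕ} (u : Matrix (Fin n) (Fin n) ℝ) : Prop :=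
  (∀ i, u i i = 1) ∧ ∀ i j : Fin n, j < i → u i j = 0

theorem gram_apply {n : ℕ} (u : Matrix (Fin n) (Fin n) ℝ) (e : Fin n → ℝ) (i j : Fin n) :
    (u * Matrix.diagonal e * u.transpose) i j = ∑ l, u i l * e l * u j l := by
  rw [Matrix.mul_apply]
  simp only [Matrix.mul_diagonal, Matrix.transpose_apply]

theorem IsUnip.eq_of_gram_eq {n : ℕ} {u u' : Matrix (Fin n) (Fin n) ℝ} {e e' : Fin n → ℝ}
    (hu : IsUnip u) (hu' : IsUnip u') (he : ∀ i, e i ≠ 0)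
    (h : u * Matrix.diagonal e * u.transpose = u' * Matrix.diagonal e' * u'.transpose) :
    u = u' ∧ e = e' := by
  have key : ∀ m : ℕ, ∀ j : Fin n, n - 1 - j = m → e j = e' j ∧ ∀ i, u i j = u' i j := by
    intro m
    induction m using Nat.strong_induction_on with
    | _ m ih =>
      intro j hj
      have hs : ∀ i, u i j * e j = u' i j * e' j := by
        intro i
        have h1 := congrFun (congrFun h i) j
        rw [gram_apply, gram_apply, ← sub_eq_zero, ← Finset.sum_sub_distrib,
          Finset.sum_eq_single j (fun l _ hl => ?_) (by simp), hu.1, hu'.1, mul_one, mul_one,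
          sub_eq_zero] at h1
        · exact h1
        · rcases lt_or_gt_of_ne hl with h2 | h2
          · rw [hu.2 j l h2, hu'.2 j l h2]; ring
          · have := l.2
            have h3 := ih (n - 1 - l) (by have : (j : ℕ) < l := h2; omega) l rfl
            rw [h3.1, h3.2 i, h3.2 j, sub_self]
      have hj := hs j
      rw [hu.1, hu'.1, one_mul, one_mul] at hj
      exact ⟨hj, fun i => mul_right_cancel₀ (he j) (by rw [hs i, hj])⟩
  exact ⟨by ext i j; exact (key _ j rfl).2 i, by ext j; exact (key _ j rfl).1⟩

theorem IsUnip.det_eq_one {n : ℕ} {u : Matrix (Fin n) (Fin n) ℝ} (hu : IsUnip u) : u.det = 1 := by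
  rw [Matrix.det_of_isUpperTriangular (fun i j h => hu.2 i j h)]
  simp [hu.1]

theorem IsIwasawa.gram_eq {n : ℕ} {g u k : Matrix (Fin n) (Fin n) ℝ} {d : Fin n → ℝ}
    (h : IsIwasawa n g u d k) :
    g * g.transpose = u * Matrix.diagonal (fun i => d i ^ 2) * u.transpose := by
  obtain ⟨-, -, -, hk, hg⟩ := h
  have hk' : k * k.transpose = 1 := mul_eq_one_comm.1 hk
  rw [hg, Matrix.transpose_mul, Matrix.transpose_mul, Matrix.diagonal_transpose,
    Matrix.mul_assoc, ← Matrix.mul_assoc k, hk', Matrix.one_mul, Matrix.mul_assoc u,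
    ← Matrix.mul_assoc (Matrix.diagonal d), Matrix.diagonal_mul_diagonal, ← Matrix.mul_assoc]
  simp only [sq]

theorem isIwasawa_of_gram_eq {n : ℕ} {g u : Matrix (Fin n) (Fin n) ℝ} {d : Fin n → ℝ}
    (hu : IsUnip u) (hd : ∀ i, 0 < d i)
    (h : g * g.transpose = u * Matrix.diagonal (fun i => d i ^ 2) * u.transpose) :
    IsIwasawa n g u d ((u * Matrix.diagonal d)⁻¹ * g) := by
  have hdet : IsUnit (u * Matrix.diagonal d).det := by
    rw [Matrix.det_mul, hu.det_eq_one, one_mul, Matrix.det_diagonal]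
    exact (Finset.prod_pos fun i _ => hd i).ne'.isUnit
  refine ⟨hu.1, hu.2, hd, ?_, ?_⟩
  · refine mul_eq_one_comm.1 ?_
    have h2 : g * g.transpose = (u * Matrix.diagonal d) * (u * Matrix.diagonal d).transpose := by
      rw [h, Matrix.transpose_mul, Matrix.diagonal_transpose, Matrix.mul_assoc u (Matrix.diagonal d),
        ← Matrix.mul_assoc (Matrix.diagonal d), Matrix.diagonal_mul_diagonal, ← Matrix.mul_assoc]
      simp only [sq]
    rw [Matrix.transpose_mul, Matrix.mul_assoc, ← Matrix.mul_assoc g, h2, Matrix.mul_assoc,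
      ← Matrix.transpose_mul, Matrix.nonsing_inv_mul _ hdet, Matrix.transpose_one, Matrix.mul_one,
      Matrix.nonsing_inv_mul _ hdet]
  · rw [← Matrix.mul_assoc, Matrix.mul_nonsing_inv _ hdet, Matrix.one_mul]

/-- The sum of the superdiagonal entries of a square matrix. -/
def superdiagSum {n : ℕ} (u : Matrix (Fin n) (Fin n) ℝ) : ℝ :=
  ∑ j ∈ Finset.range (n - 1), if h : j + 1 < n then u ⟨j, Nat.lt_of_succ_lt h⟩ ⟨j + 1, h⟩ else 0

theorem sum_rho_telescope (N M : ℕ) (δ : ℕ → ℝ) :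
    ∑ j ∈ Finset.range M, ((j : ℝ) + 1) * (N - j) * (δ j - δ (j + 1)) =
      (∑ j ∈ Finset.range M, ((N : ℝ) - 2 * j) * δ j) - M * (N - M + 1) * δ M := by
  induction M with
  | zero => simp
  | succ M ih =>
    rw [Finset.sum_range_succ, ih, Finset.sum_range_succ]
    push_cast
    ring

theorem WhittAGrp_eq (N : ℕ) (a : ℕ → ℂ) {g u : Matrix (Fin (N + 1)) (Fin (N + 1)) ℝ}
    (δ : ℕ → ℝ) (hu : IsUnip u)
    (h : g * g.transpose =
      u * Matrix.diagonal (fun i : Fin (N + 1) => Real.exp (2 * δ i)) * u.transpose) :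
    WhittAGrp (N + 1) a g = cexp (2 * (Real.pi : ℂ) * I * (superdiagSum u : ℝ)) *
      cexp ((((∑ j ∈ Finset.range (N + 1), ((N : ℝ) - 2 * j) * δ j) / 2 : ℝ) : ℂ)) *
      cexp (-(N * sumA (N + 1) a / 2 * Real.log Real.pi)) *
      toda (N + 1) (fun j => a j / 2) (fun j => 2 * δ j + 2 * ((N : ℝ) - j) * Real.log Real.pi) := by
  have hd : ∀ i : Fin (N + 1), 0 < Real.exp (δ i) := fun i => Real.exp_pos _
  have h' : g * g.transpose =
      u * Matrix.diagonal (fun i : Fin (N + 1) => Real.exp (δ i) ^ 2) * u.transpose := by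
    simp only [← Real.exp_nat_mul, Nat.cast_ofNat]
    exact h
  have hex : ∃ q : Matrix (Fin (N + 1)) (Fin (N + 1)) ℝ × (Fin (N + 1) → ℝ) ×
      Matrix (Fin (N + 1)) (Fin (N + 1)) ℝ, IsIwasawa (N + 1) g q.1 q.2.1 q.2.2 :=
    ⟨(_, _, _), isIwasawa_of_gram_eq (d := fun i => Real.exp (δ i)) hu hd h'⟩
  rw [WhittAGrp, dif_pos hex]
  have hq := Classical.choose_spec hex
  set q := Classical.choose hex
  obtain ⟨e1, e2⟩ := hu.eq_of_gram_eq ⟨hq.1, hq.2.1⟩ (fun i => (pow_pos (hd i) 2).ne')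
    (h'.symm.trans hq.gram_eq)
  have e3 : ∀ i : Fin (N + 1), q.2.1 i = Real.exp (δ i) := fun i => by
    exact ((pow_left_inj₀ (hd i).le (hq.2.2.1 i).le two_ne_zero).1 (congrFun e2 i)).symm
  extract_lets q0 y
  have hy1 : ∀ j < N, y j = Real.exp (δ j - δ (j + 1)) := fun j hj => by
    simp only [y]
    rw [dif_pos (by omega : j + 1 < N + 1), Real.exp_sub]
    exact congrArg₂ _ (e3 _) (e3 _)
  have hy2 : y N = Real.exp (δ N) := by
    simp only [y]
    rw [dif_neg (by omega), dif_pos (Nat.lt_succ_self N)]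
    exact e3 _
  have hρ : ∏ j ∈ Finset.range (N + 1 - 1),
        ((y j : ℝ) : ℂ) ^ ((((j + 1) * (N + 1 - (j + 1)) : ℕ) : ℂ) / 2) =
      cexp ((((∑ j ∈ Finset.range (N + 1), ((N : ℝ) - 2 * j) * δ j) / 2 : ℝ) : ℂ)) := by
    have hs : (∑ j ∈ Finset.range (N + 1), ((N : ℝ) - 2 * j) * δ j) =
        ∑ j ∈ Finset.range N, ((j : ℝ) + 1) * (N - j) * (δ j - δ (j + 1)) := by
      rw [sum_rho_telescope, Finset.sum_range_succ]
      ring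
    rw [hs, Finset.sum_div, ofReal_sum, Complex.exp_sum, Nat.add_sub_cancel]
    refine Finset.prod_congr rfl fun j hj => ?_
    have hj := Finset.mem_range.1 hj
    rw [hy1 j hj, ofReal_exp_cpow, Nat.cast_mul, Nat.add_sub_add_right, Nat.cast_sub hj.le]
    push_cast
    ring_nf
  have hψ : (∑ j ∈ Finset.range (N + 1 - 1), if h4 : j + 1 < N + 1 then
      q0.1 ⟨j, Nat.lt_of_succ_lt h4⟩ ⟨j + 1, h4⟩ else 0) = superdiagSum u := by
    rw [e1]; rfl
  rw [hψ, hρ, WhittAhat, Nat.add_sub_cancel, hy2, ofReal_exp_cpow,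
    WhittAr_eq_toda N a y (fun j => δ j - δ (j + 1)) hy1,
    toda_congr (fun _ _ => rfl) (x' := fun j =>
      (2 * δ j + 2 * ((N : ℝ) - j) * Real.log Real.pi) + -(2 * δ N)) fun j hj => ?_,
    toda_add_const, ← Finset.sum_div]
  · have h1 : cexp (sumA (N + 1) a * δ N) * cexp ((∑ j ∈ Finset.range (N + 1), a j) / 2 *
        ((-(2 * δ N) : ℝ) : ℂ)) = 1 := by
      rw [← Complex.exp_add, ← Complex.exp_zero, sumA]
      congr 1
      push_cast
      ring
    linear_combination (cexp (2 * (Real.pi : ℂ) * I * (superdiagSum u : ℝ)) *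
      cexp ((((∑ j ∈ Finset.range (N + 1), ((N : ℝ) - 2 * j) * δ j) / 2 : ℝ) : ℂ)) *
      cexp (-(N * sumA (N + 1) a / 2 * Real.log Real.pi)) *
      toda (N + 1) (fun j => a j / 2)
        (fun j => 2 * δ j + 2 * ((N : ℝ) - j) * Real.log Real.pi)) * h1
  · rw [rootLog_telescope (Z := fun j => 2 * δ j - 2 * j * Real.log Real.pi) (by omega)
      fun p _ => by push_cast; ring]
    ring

/-! ### Whittaker functions at the matrices of the dual zeta integral -/

theorem sum_range_reflect_Fin (n : ℕ) (f : ℕ → ℝ) :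
    ∑ i : Fin (n + 1), f (n - i) = ∑ i ∈ Finset.range (n + 1), f i := by
  rw [Fin.sum_univ_eq_sum_range (fun i => f (n - i)) (n + 1), ← Finset.sum_range_reflect f]
  exact Finset.sum_congr rfl fun i _ => by rw [Nat.add_sub_cancel]

theorem WhittAGrp_reflect (N : ℕ) (a : ℕ → ℂ) {g : Matrix (Fin (N + 1)) (Fin (N + 1)) ℝ}
    (V : ℕ → ℕ → ℝ) (Q : ℕ → ℝ) (hV1 : ∀ i, V i i = 1) (hV2 : ∀ i j, i < j → V i j = 0)
    (hg : ∀ i j : Fin (N + 1), (g * g.transpose) i j =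
      ∑ l ∈ Finset.range (N + 1), V (N - i) l * Real.exp (-Q l) * V (N - j) l) :
    WhittAGrp (N + 1) a g =
      cexp (2 * (Real.pi : ℂ) * I * ((∑ j ∈ Finset.range N, V (j + 1) j : ℝ) : ℂ)) *
      cexp ((((∑ j ∈ Finset.range (N + 1), ((N : ℝ) - 2 * j) * Q j) / 4 : ℝ) : ℂ)) *
      cexp (-(N * sumA (N + 1) a / 2 * Real.log Real.pi)) *
      toda (N + 1) (fun j => -(a j / 2)) (fun j => Q j - 2 * j * Real.log Real.pi) := by
  have hu : IsUnip (Matrix.of fun i j : Fin (N + 1) => V (N - i) (N - j)) := by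
    refine ⟨fun i => hV1 _, fun i j h => hV2 _ _ ?_⟩
    have : (j : ℕ) < i := h
    have := i.2
    omega
  rw [WhittAGrp_eq N a (fun j => -Q (N - j) / 2) hu]
  · have e1 : superdiagSum (Matrix.of fun i j : Fin (N + 1) => V (N - i) (N - j)) =
        ∑ j ∈ Finset.range N, V (j + 1) j := by
      rw [superdiagSum, Nat.add_sub_cancel, ← Finset.sum_range_reflect]
      refine Finset.sum_congr rfl fun j hj => ?_
      have := Finset.mem_range.1 hj
      rw [dif_pos (by omega), Matrix.of_apply]
      congr 1 <;> simp only [] <;> omega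
    have e2 : (∑ j ∈ Finset.range (N + 1), ((N : ℝ) - 2 * j) * (-Q (N - j) / 2)) / 2 =
        (∑ j ∈ Finset.range (N + 1), ((N : ℝ) - 2 * j) * Q j) / 4 := by
      rw [← Finset.sum_range_reflect, Finset.sum_div, Finset.sum_div]
      refine Finset.sum_congr rfl fun j hj => ?_
      have := Finset.mem_range.1 hj
      rw [show N + 1 - 1 - j = N - j by omega, show N - (N - j) = j by omega,
        Nat.cast_sub (by omega)]
      ring
    rw [e1, e2, ← toda_reflSeq]
    congr 1
    refine toda_congr (fun _ _ => rfl) fun j hj => ?_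
    rw [reflSeq, show N + 1 - 1 - j = N - j by omega, show N - (N - j) = j by omega,
      Nat.cast_sub (by omega)]
    ring
  · ext i j
    rw [hg, gram_apply, ← sum_range_reflect_Fin]
    refine Finset.sum_congr rfl fun l _ => ?_
    simp only [Matrix.of_apply]
    congr 3
    ring

theorem wMat_mul_apply (N : ℕ) (A : Matrix (Fin (N + 1)) (Fin (N + 1)) ℝ) (i j : Fin (N + 1)) :
    (wMat (N + 1) * A) i j = A ⟨N - i, by omega⟩ j := by
  rw [Matrix.mul_apply, Finset.sum_eq_single ⟨N - i, by omega⟩]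
  · have := i.2
    rw [wMat, Matrix.of_apply, if_pos (by simp only []; omega), one_mul]
  · intro b _ hb
    rw [wMat, Matrix.of_apply, if_neg, zero_mul]
    intro h
    exact hb (Fin.ext (by simp only []; omega))
  · simp

theorem gram_wMat_mul (N : ℕ) {f : ℕ → ℕ → ℝ} (i j : Fin (N + 1)) :
    ((wMat (N + 1) * Matrix.of fun i j : Fin (N + 1) => f i j) *
      (wMat (N + 1) * Matrix.of fun i j : Fin (N + 1) => f i j).transpose) i j =
    ∑ c ∈ Finset.range (N + 1), f (N - i) c * f (N - j) c := by
  rw [Matrix.mul_apply, ← Fin.sum_univ_eq_sum_range (fun c => f (N - i) c * f (N - j) c)]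
  simp only [Matrix.transpose_apply, wMat_mul_apply, Matrix.of_apply]

theorem WhittAGrp_alphaMat (k : ℕ) (a : ℕ → ℂ) (y E : ℕ → ℝ)
    (hE : ∀ i < k + 1, ∏ p ∈ Finset.Ico i (k + 1), y p = Real.exp (E i)) :
    WhittAGrp (k + 1) a (wMat (k + 1) * ((alphaMat (k + 1) y).transpose)⁻¹) =
      cexp ((((∑ j ∈ Finset.range (k + 1), ((k : ℝ) - 2 * j) * (2 * E j)) / 4 : ℝ) : ℂ)) *
      cexp (-(k * sumA (k + 1) a / 2 * Real.log Real.pi)) *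
      toda (k + 1) (fun j => -(a j / 2)) (fun j => 2 * E j - 2 * j * Real.log Real.pi) := by
  have hinv : ((alphaMat (k + 1) y).transpose)⁻¹ =
      Matrix.of fun i j : Fin (k + 1) =>
        (fun i j : ℕ => if i = j then Real.exp (-E i) else 0) i j := by
    have h1 : (Matrix.of fun i j : Fin (k + 1) =>
        (fun i j : ℕ => if i = j then Real.exp (-E i) else 0) i j) =
        Matrix.diagonal fun i : Fin (k + 1) => Real.exp (-E i) := by
      ext i j
      simp [Matrix.diagonal_apply, Fin.ext_iff]
    have h2 : alphaMat (k + 1) y = Matrix.diagonal fun i : Fin (k + 1) => Real.exp (E i) := by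
      ext i j
      rw [alphaMat, Matrix.of_apply, Matrix.diagonal_apply, hE i i.2]
    rw [h1, h2, Matrix.diagonal_transpose]
    refine Matrix.inv_eq_left_inv ?_
    rw [Matrix.diagonal_mul_diagonal, ← Matrix.diagonal_one]
    congr 1
    ext i
    rw [← Real.exp_add, neg_add_cancel, Real.exp_zero]
  rw [hinv, WhittAGrp_reflect k a (fun i j => if i = j then 1 else 0) (fun j => 2 * E j)
    (fun i => if_pos rfl) (fun i j h => if_neg h.ne)]
  · rw [Finset.sum_eq_zero fun j _ => if_neg (Nat.succ_ne_self j)]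
    simp
  · intro i j
    refine (gram_wMat_mul k (f := fun i j : ℕ => if i = j then Real.exp (-E i) else 0) i j).trans ?_
    refine Finset.sum_congr rfl fun c _ => ?_
    have : Real.exp (-(2 * E c)) = Real.exp (-E c) * Real.exp (-E c) := by
      rw [← Real.exp_add]; ring_nf
    rw [this]
    split_ifs with h1 h2 h2 <;> simp [*]

/-- The unipotent factor of the Gram matrix of the rows of the inverse of `MmatX`. -/
def unipFactor (X D S : ℕ → ℝ) (i l : ℕ) : ℝ :=
  if l < i then X i * X l * D l / (D i * S (l + 1)) else if i = l then 1 else 0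

theorem unipFactor_self (X D S : ℕ → ℝ) (i : ℕ) : unipFactor X D S i i = 1 := by
  rw [unipFactor, if_neg (lt_irrefl i), if_pos rfl]

theorem unipFactor_of_lt (X D S : ℕ → ℝ) {i l : ℕ} (h : i < l) : unipFactor X D S i l = 0 := by
  rw [unipFactor, if_neg h.not_gt, if_neg h.ne]

theorem unipFactor_of_gt (X D S : ℕ → ℝ) {i l : ℕ} (h : l < i) :
    unipFactor X D S i l = X i * X l * D l / (D i * S (l + 1)) := by
  rw [unipFactor, if_pos h]

theorem unipFactor_gram {m : ℕ} {X D S e : ℕ → ℝ} (hD : ∀ i, D i ≠ 0) (hS : ∀ i, S i ≠ 0)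
    (hS0 : S 0 = 1) (hS1 : ∀ i < m, S (i + 1) = S i + X i ^ 2) (hX : X (m + 1) = 0)
    (he : ∀ l < m + 2, e l = ((if l = m then 0 else S l) + X l ^ 2) / (S l * D l ^ 2))
    {i j : ℕ} (hi : i < m + 2) (hj : j < m + 2) :
    ∑ l ∈ Finset.range (m + 2), unipFactor X D S i l * e l * unipFactor X D S j l =
      ((if i = j ∧ i ≠ m then 1 else 0) + X i * X j) / (D i * D j) := by
  wlog hij : i ≤ j generalizing i j
  · rw [Finset.sum_congr rfl fun l _ => show unipFactor X D S i l * e l * unipFactor X D S j l =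
      unipFactor X D S j l * e l * unipFactor X D S i l by ring, this hj hi (by omega)]
    congr 1
    · rw [mul_comm]
      congr 2
      exact propext ⟨fun h => ⟨h.1.symm, by omega⟩, fun h => ⟨h.1.symm, by omega⟩⟩
    · ring
  have htel : ∀ i ≤ m, ∑ l ∈ Finset.range i, X l ^ 2 / (S l * S (l + 1)) = 1 - 1 / S i := by
    intro i
    induction i with
    | zero => intro _; simp [hS0]
    | succ i ih =>
      intro h
      rw [Finset.sum_range_succ, ih (by omega)]
      have h1 := hS i
      have h2 := hS (i + 1)
      field_simp
      rw [hS1 i (by omega)]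
      ring
  have hsub : ∑ l ∈ Finset.range (m + 2), unipFactor X D S i l * e l * unipFactor X D S j l =
      ∑ l ∈ Finset.range (i + 1), unipFactor X D S i l * e l * unipFactor X D S j l := by
    refine (Finset.sum_subset (Finset.range_mono (by omega)) fun l _ hl => ?_).symm
    rw [unipFactor_of_lt _ _ _ (by simpa using hl), zero_mul, zero_mul]
  have hlow : ∑ l ∈ Finset.range i, unipFactor X D S i l * e l * unipFactor X D S j l =
      X i * X j / (D i * D j) * (1 - 1 / S i) := by
    by_cases him : i ≤ m
    · rw [← htel i him, Finset.mul_sum]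
      refine Finset.sum_congr rfl fun l hl => ?_
      have hl := Finset.mem_range.1 hl
      rw [unipFactor_of_gt _ _ _ hl, unipFactor_of_gt _ _ _ (hl.trans_le hij), he l (by omega),
        if_neg (by omega), ← hS1 l (by omega)]
      have h1 := hS l
      have h2 := hS (l + 1)
      have h3 := hD i
      have h4 := hD j
      have h5 := hD l
      field_simp
    · obtain rfl : i = m + 1 := by omega
      rw [hX, zero_mul, zero_div, zero_mul]
      refine Finset.sum_eq_zero fun l hl => ?_
      rw [unipFactor_of_gt _ _ _ (Finset.mem_range.1 hl), hX]
      simp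
  rw [hsub, Finset.sum_range_succ, hlow, unipFactor_self, he i hi]
  have h1 := hS i
  have h2 := hD i
  have h3 := hD j
  rcases hij.eq_or_lt with rfl | hij
  · rw [unipFactor_self]
    by_cases him : i = m
    · simp only [him, ne_eq, not_true, and_false, if_false, if_true] at *
      field_simp
      ring
    · simp only [him, ne_eq, not_false_iff, and_self, if_false, if_true]
      field_simp
      ring
  · rw [unipFactor_of_gt _ _ _ hij, if_neg (c := i = j ∧ _) (fun h => hij.ne h.1)]
    by_cases him : i < m
    · rw [if_neg him.ne, ← hS1 i him]
      have h4 := hS (i + 1)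
      field_simp
      ring
    · obtain rfl : j = m + 1 := by omega
      rw [hX]
      simp

/-- The entries of the inverse transpose of `MmatX`. -/
def invEntry (m : ℕ) (X D : ℕ → ℝ) (i c : ℕ) : ℝ :=
  ((if c = i ∧ i ≠ m then 1 else 0) - (if c = m then X i else 0)) / D i

theorem sum_invEntry_mul {m : ℕ} (X D f : ℕ → ℝ) {i : ℕ} (hi : i < m + 2) :
    ∑ c ∈ Finset.range (m + 2), invEntry m X D i c * f c =
      ((if i = m then 0 else f i) - X i * f m) / D i := by
  simp only [invEntry, div_mul_eq_mul_div, ← Finset.sum_div, sub_mul, Finset.sum_sub_distrib]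
  congr 2
  · rw [Finset.sum_eq_single i (fun b _ hb => by rw [if_neg (fun h => hb h.1), zero_mul])
      (fun h => absurd (Finset.mem_range.2 hi) h)]
    by_cases h : i = m <;> simp [h]
  · simp [ite_mul]

theorem sum_invEntry_mul_invEntry {m : ℕ} (X D : ℕ → ℝ) {i j : ℕ}
    (hi : i < m + 2) (hD : D m = 1) (hXm : X m = -1) :
    ∑ c ∈ Finset.range (m + 2), invEntry m X D i c * invEntry m X D j c =
      ((if i = j ∧ i ≠ m then 1 else 0) + X i * X j) / (D i * D j) := by
  rw [sum_invEntry_mul X D _ hi]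
  have e1 : invEntry m X D j m = -X j / D j := by
    rw [invEntry, if_neg (fun h => h.2 h.1.symm), if_pos rfl, zero_sub]
  rw [e1]
  by_cases him : i = m
  · simp only [him, ne_eq, not_true, and_false, if_false, if_true, hD, hXm]
    ring
  · rw [if_neg him, invEntry, if_neg him]
    by_cases hij : i = j
    · subst hij
      simp only [him, ne_eq, not_false_iff, and_self, if_true]
      field_simp
      ring
    · simp only [hij, false_and, if_false]
      field_simp
      ring

/-- The last row of the matrix `MmatX`, extended by `-1` on the diagonal. -/
def rowSeq (m : ℕ) (x : ℕ → ℝ) (i : ℕ) : ℝ := if i < m then x i else if i = m then -1 else 0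

theorem inv_transpose_MmatX (m : ℕ) (x y D : ℕ → ℝ) (hD0 : ∀ i, D i ≠ 0)
    (hD : ∀ i < m, ∏ p ∈ Finset.Ico i m, y p = D i) (hD1 : ∀ i, m ≤ i → D i = 1) :
    ((MmatX (m + 2) x y).transpose)⁻¹ =
      Matrix.of fun i j : Fin (m + 2) => invEntry m (rowSeq m x) D i j := by
  refine Matrix.inv_eq_left_inv ?_
  ext i j
  have hM : ∀ c : Fin (m + 2), MmatX (m + 2) x y j c =
      (fun c : ℕ => if (j : ℕ) = m then (if c = m then 1 else rowSeq m x c)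
        else if c = j then D j else 0) c := by
    intro c
    have hj := j.2
    have hc := c.2
    simp only [MmatX, Matrix.of_apply, Nat.add_sub_cancel, rowSeq, Nat.add_succ_sub_one]
    split_ifs <;> 
      first | omega | rfl | exact hD _ (by omega) | exact (hD1 _ (by omega)).symm
  rw [Matrix.mul_apply]
  simp only [Matrix.of_apply, Matrix.transpose_apply, hM]
  refine (Fin.sum_univ_eq_sum_range (fun c => invEntry m (rowSeq m x) D i c *
    (fun c : ℕ => if (j : ℕ) = m then (if c = m then 1 else rowSeq m x c)
      else if c = j then D j else 0) c)
    (m + 2)).trans ?_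
  rw [sum_invEntry_mul _ _ _ i.2, Matrix.one_apply]
  simp only [rowSeq, Fin.ext_iff]
  have := hD0 i
  have hDm := hD1 m le_rfl
  split_ifs <;> first | omega | (simp_all)

/-- The coordinates `τ_j (∏_{l < j} (1 + τ_l²))^{1/2}`. -/
def scaleSeq (τ : ℕ → ℝ) (j : ℕ) : ℝ := τ j * Real.exp (sumLog j τ / 2)

theorem scaleSeq_sq (τ : ℕ → ℝ) (j : ℕ) :
    scaleSeq τ j ^ 2 = τ j ^ 2 * Real.exp (sumLog j τ) := by
  rw [scaleSeq, mul_pow, ← Real.exp_nat_mul]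
  congr 2
  push_cast
  ring

theorem exp_sumLog_succ (τ : ℕ → ℝ) (j : ℕ) :
    Real.exp (sumLog (j + 1) τ) = Real.exp (sumLog j τ) + scaleSeq τ j ^ 2 := by
  rw [scaleSeq_sq, sumLog, Finset.sum_range_succ, Real.exp_add, exp_log_one_add_sq, ← sumLog]
  ring

/-- The logarithms of the inverse squares of the Iwasawa radii, in reversed order. -/
def radialLog (k : ℕ) (E τ : ℕ → ℝ) (j : ℕ) : ℝ :=
  if j < k + 1 then 2 * E j - Real.log (1 + τ j ^ 2) else if j = k + 1 then sumLog (k + 1) τ else 0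

theorem radialLog_of_lt {k j : ℕ} (E τ : ℕ → ℝ) (h : j < k + 1) :
    radialLog k E τ j = 2 * E j - Real.log (1 + τ j ^ 2) := if_pos h

theorem radialLog_self (k : ℕ) (E τ : ℕ → ℝ) : radialLog k E τ (k + 1) = sumLog (k + 1) τ := by
  rw [radialLog, if_neg (lt_irrefl _), if_pos rfl]

theorem radialLog_last (k : ℕ) (E τ : ℕ → ℝ) : radialLog k E τ (k + 2) = 0 := by
  rw [radialLog, if_neg (by omega), if_neg (by omega)]

theorem sqrt_one_add_sq (t : ℝ) : Real.sqrt (1 + t ^ 2) = Real.exp (Real.log (1 + t ^ 2) / 2) := by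
  rw [Real.exp_half, exp_log_one_add_sq]

theorem phase_eq_dualPhase {k : ℕ} {E τ P D X : ℕ → ℝ} (hX : ∀ i < k + 1, X i = scaleSeq τ i)
    (hX1 : X (k + 1) = -1) (hX2 : X (k + 2) = 0)
    (hD : ∀ i < k + 1, D i = Real.exp (E i)) (hD1 : D (k + 1) = 1)
    (hP : ∀ i < k + 2, P i = radialLog k E τ i + 2 * (((k : ℝ) + 2) - i) * Real.log Real.pi) :
    2 * Real.pi * ∑ j ∈ Finset.range (k + 2),
      unipFactor X D (fun i => Real.exp (sumLog i τ)) (j + 1) j = dualPhase k P τ := by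
  have hπ := log_pi_exp
  have hdiv : ∀ a b : ℝ, a / Real.exp b = a * Real.exp (-b) := fun a b => by
    rw [Real.exp_neg, div_eq_mul_inv]
  rw [Finset.sum_range_succ, Finset.sum_range_succ, dualPhase, mul_assoc]
  simp only [unipFactor_of_gt _ _ _ (Nat.lt_succ_self _)]
  rw [hX2, zero_mul, zero_mul, zero_div, add_zero, hX1, hD1, mul_add, sub_eq_add_neg, Finset.mul_sum]
  congr 2
  · refine Finset.sum_congr rfl fun j hj => ?_
    have hj := Finset.mem_range.1 hj
    rw [hX j (by omega), hX (j + 1) (by omega), hD j (by omega), hD (j + 1) (by omega),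
      hP j (by omega), hP (j + 1) (by omega), radialLog_of_lt _ _ (by omega),
      radialLog_of_lt _ _ (by omega), sqrt_one_add_sq, scaleSeq, scaleSeq,
      ← Real.exp_add, hdiv, hdiv]
    have h1 : sumLog (j + 1) τ = sumLog j τ + Real.log (1 + τ j ^ 2) := Finset.sum_range_succ _ _
    have h2 : Real.pi * (τ (j + 1) * Real.exp (sumLog (j + 1) τ / 2) *
        (τ j * Real.exp (sumLog j τ / 2)) * Real.exp (E j) *
        Real.exp (-(E (j + 1) + sumLog (j + 1) τ))) = (Real.exp (Real.log Real.pi) *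
        Real.exp (sumLog (j + 1) τ / 2) * Real.exp (sumLog j τ / 2) * Real.exp (E j) *
        Real.exp (-(E (j + 1) + sumLog (j + 1) τ))) * (τ j * τ (j + 1)) := by
      rw [← hπ]; ring
    rw [h2, mul_right_comm (Real.exp ((_ - _) / 2))]
    simp only [← Real.exp_add]
    congr 2
    rw [h1]
    push_cast
    ring
  · rw [hX k (by omega), hD k (by omega), hP k (by omega), hP (k + 1) (by omega),
      radialLog_of_lt _ _ (by omega), radialLog_self, scaleSeq, one_mul, hdiv]
    have h1 : sumLog (k + 1) τ = sumLog k τ + Real.log (1 + τ k ^ 2) := Finset.sum_range_succ _ _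
    have h2 : Real.pi * (-1 * (τ k * Real.exp (sumLog k τ / 2)) * Real.exp (E k) *
        Real.exp (-sumLog (k + 1) τ)) = -((Real.exp (Real.log Real.pi) *
        Real.exp (sumLog k τ / 2) * Real.exp (E k) * Real.exp (-sumLog (k + 1) τ)) * τ k) := by
      rw [← hπ]; ring
    rw [h2]
    simp only [← Real.exp_add]
    congr 3
    rw [h1]
    push_cast
    ring

theorem WhittAGrp_MmatX (k : ℕ) (a : ℕ → ℂ) {x y E τ P : ℕ → ℝ}
    (hE : ∀ i < k + 1, ∏ p ∈ Finset.Ico i (k + 1), y p = Real.exp (E i))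
    (hx : ∀ i < k + 1, x i = scaleSeq τ i)
    (hP : ∀ i < k + 2, P i = radialLog k E τ i + 2 * (((k : ℝ) + 2) - i) * Real.log Real.pi) :
    WhittAGrp (k + 3) a (wMat (k + 3) * ((MmatX (k + 3) x y).transpose)⁻¹) =
      cexp (I * (dualPhase k P τ : ℝ)) *
      cexp ((((∑ j ∈ Finset.range (k + 3), ((k : ℝ) + 2 - 2 * j) * radialLog k E τ j) / 4 : ℝ) : ℂ)) *
      cexp (-((k + 2) * sumA (k + 3) a / 2 * Real.log Real.pi)) *
      toda (k + 3) (fun j => -(a j / 2))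
        (fun j => radialLog k E τ j - 2 * j * Real.log Real.pi) := by
  set D : ℕ → ℝ := fun i => if i < k + 1 then Real.exp (E i) else 1 with hDdef
  have hDlt : ∀ i < k + 1, D i = Real.exp (E i) := fun i hi => if_pos hi
  have hDge : ∀ i, k + 1 ≤ i → D i = 1 := fun i hi => if_neg (by omega)
  have hD0 : ∀ i, D i ≠ 0 := fun i => by
    simp only [hDdef]; split_ifs
    exacts [(Real.exp_pos _).ne', one_ne_zero]
  set X := rowSeq (k + 1) x with hXdef
  have hX : ∀ i < k + 1, X i = scaleSeq τ i := fun i hi => by rw [hXdef, rowSeq, if_pos hi, hx i hi]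
  have hX1 : X (k + 1) = -1 := by simp [hXdef, rowSeq]
  have hX2 : X (k + 2) = 0 := by simp [hXdef, rowSeq]
  rw [inv_transpose_MmatX (k + 1) x y D hD0 (fun i hi => (hE i hi).trans (hDlt i hi).symm) hDge,
    WhittAGrp_reflect (k + 2) a (unipFactor X D fun i => Real.exp (sumLog i τ)) (radialLog k E τ)
      (unipFactor_self _ _ _) fun i j h => unipFactor_of_lt _ _ _ h]
  · rw [← phase_eq_dualPhase hX hX1 hX2 hDlt (hDge _ le_rfl) hP]
    have h : ∀ S : ℝ, 2 * (Real.pi : ℂ) * I * (S : ℂ) = I * ((2 * Real.pi * S : ℝ) : ℂ) :=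
      fun S => by push_cast; ring
    rw [h]
    simp only [Nat.cast_add, Nat.cast_ofNat]
  · intro i j
    refine (gram_wMat_mul (k + 2) (f := invEntry (k + 1) X D) i j).trans ?_
    rw [sum_invEntry_mul_invEntry X D (by omega) (hDge _ le_rfl) hX1]
    refine (unipFactor_gram (m := k + 1) (e := fun l => Real.exp (-radialLog k E τ l)) hD0
      (fun i => (Real.exp_pos _).ne') (by simp [sumLog]) (fun i hi => ?_) hX2 (fun l hl => ?_)
      (by omega) (by omega)).symm
    · rw [exp_sumLog_succ, hX i hi]
    · rcases lt_trichotomy l (k + 1) with h | h | h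
      · rw [if_neg h.ne, radialLog_of_lt _ _ h, hX l h, hDlt l h, scaleSeq_sq, neg_sub, Real.exp_sub,
          exp_log_one_add_sq, ← Real.exp_nat_mul]
        have := Real.exp_pos (sumLog l τ)
        push_cast
        field_simp
      · rw [if_pos h, h, radialLog_self, hX1, hDge _ le_rfl, Real.exp_neg]
        norm_num
      · obtain rfl : l = k + 2 := by omega
        rw [if_neg (by omega), radialLog_last, hX2, hDge _ (by omega)]
        simp

theorem sum_sumLog (M : ℕ) (τ : ℕ → ℝ) : ∑ j ∈ Finset.range M, sumLog j τ =
    ∑ j ∈ Finset.range M, ((M : ℝ) - 1 - j) * Real.log (1 + τ j ^ 2) := by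
  induction M with
  | zero => simp
  | succ M ih =>
    rw [Finset.sum_range_succ, ih, sumLog, ← Finset.sum_add_distrib, Finset.sum_range_succ]
    push_cast
    rw [add_sub_cancel_right, sub_self, zero_mul, add_zero]
    exact Finset.sum_congr rfl fun j _ => by ring

theorem sum_torus_telescope (M : ℕ) (t : ℂ) (E : ℕ → ℝ) :
    ∑ j ∈ Finset.range M, ((j : ℂ) + 1) * (t + j) * ((E j - E (j + 1) : ℝ) : ℂ) =
      ∑ j ∈ Finset.range M, (t + 2 * j) * E j - M * (t + M - 1) * E M := by
  induction M with
  | zero => simp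
  | succ M ih =>
    rw [Finset.sum_range_succ, ih, Finset.sum_range_succ]
    push_cast
    ring

theorem dual_exponent_eq (k : ℕ) (s : ℂ) (L : ℝ) {E τ P : ℕ → ℝ} (hE : E (k + 1) = 0)
    (hP : ∀ j < k + 1, P j = 2 * E j - Real.log (1 + τ j ^ 2) + 2 * ((k : ℝ) + 2 - j) * L) :
    (((∑ j ∈ Finset.range (k + 1), sumLog j τ) / 2 : ℝ) : ℂ) +
      (((∑ j ∈ Finset.range (k + 3), ((k : ℝ) + 2 - 2 * j) * radialLog k E τ j) / 4 : ℝ) : ℂ) +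
      (((∑ j ∈ Finset.range (k + 1), ((k : ℝ) - 2 * j) * (2 * E j)) / 4 : ℝ) : ℂ) +
      ∑ j ∈ Finset.range (k + 1), ((j : ℂ) + 1) * ((s - (k + 1)) + j) * ((E j - E (j + 1) : ℝ) : ℂ) =
    s / 2 * ((∑ j ∈ Finset.range (k + 1), P j : ℝ) : ℂ) + -(1 / 2 - s / 2) * sumLog (k + 1) τ +
      -(s * L * ∑ j ∈ Finset.range (k + 1), ((k : ℂ) + 2 - j)) := by
  rw [sum_sumLog, sum_torus_telescope, hE, Finset.sum_range_succ _ (k + 2),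
    Finset.sum_range_succ _ (k + 1), radialLog_last, radialLog_self,
    Finset.sum_congr (s₁ := Finset.range (k + 1))
      (f := fun j : ℕ => ((k : ℝ) + 2 - 2 * j) * radialLog k E τ j)
      (g := fun j : ℕ => ((k : ℝ) + 2 - 2 * j) * (2 * E j - Real.log (1 + τ j ^ 2))) rfl
      (fun j hj => by rw [radialLog_of_lt _ _ (Finset.mem_range.1 hj)]),
    Finset.sum_congr (s₁ := Finset.range (k + 1)) (f := P) rfl fun j hj => hP j (Finset.mem_range.1 hj),
    sumLog]
  push_cast
  simp only [Finset.mul_sum, Finset.sum_div, mul_zero, add_zero, sub_zero, add_div,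
    ← Finset.sum_neg_distrib,
    ← Finset.sum_add_distrib]
  refine Finset.sum_congr rfl fun j _ => ?_
  ring

/-- The power of `π` relating the dual zeta integral to `dualJ`. -/
def dualConst (k : ℕ) (a a' : ℕ → ℂ) (s : ℂ) : ℂ :=
  cexp (((k + 2) * sumA (k + 3) a / 2 + (k / 2 + 2) * sumA (k + 1) a' -
    s * ∑ j ∈ Finset.range (k + 1), ((k : ℂ) + 2 - j)) * Real.log Real.pi)

theorem IcheckIntegrand_eq_dualKer (k : ℕ) (a a' : ℕ → ℂ) (s : ℂ) {x y : Fin (k + 1) → ℝ}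
    {E τ P : ℕ → ℝ} (hE : E (k + 1) = 0)
    (hP : ∀ j < k + 1, P j =
      2 * E j - Real.log (1 + τ j ^ 2) + 2 * ((k : ℝ) + 2 - j) * Real.log Real.pi)
    (hP1 : P (k + 1) = 2 * Real.log Real.pi + sumLog (k + 1) τ) (hP2 : P (k + 2) = 0)
    (hx : ∀ i : Fin (k + 1), x i = scaleSeq τ i)
    (hy : ∀ i : Fin (k + 1), y i = Real.exp (E i - E (i + 1))) :
    ((∏ j ∈ Finset.range (k + 1), Real.exp (sumLog j τ / 2) : ℝ) : ℂ) *
      (((∏ i, y i : ℝ) : ℂ) * IcheckIntegrand (k + 3) a a' s (y, x)) =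
    dualConst k a a' s * dualKer k (s / 2) 0 (1 / 2 - s / 2) (fun j => -(a j / 2))
      (fun j => -(a' j / 2)) P τ := by
  have hyr : ∀ j < k + 1, extR y j = Real.exp (E j - E (j + 1)) := fun j hj => by
    rw [extR, dif_pos hj, hy]
  have hxr : ∀ j < k + 1, extR0 x j = scaleSeq τ j := fun j hj => by
    rw [extR0_of_lt _ hj, hx]
  have hEy : ∀ i < k + 1, ∏ p ∈ Finset.Ico i (k + 1), extR y p = Real.exp (E i) := fun i hi => by
    rw [Finset.prod_congr rfl fun p hp => hyr p (Finset.mem_Ico.1 hp).2, ← Real.exp_sum]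
    simp only [Finset.sum_Ico_eq_sum_range, add_assoc]
    rw [Finset.sum_range_sub' (fun j => E (i + j)), add_zero,
      Nat.add_sub_cancel' hi.le, hE, sub_zero]
  have hPr : ∀ i < k + 2, P i = radialLog k E τ i + 2 * (((k : ℝ) + 2) - i) * Real.log Real.pi := by
    intro i hi
    rcases Nat.lt_succ_iff_lt_or_eq.1 hi with h | rfl
    · rw [radialLog_of_lt _ _ h, hP i h]
    · rw [radialLog_self, hP1]
      push_cast
      ring
  have hW1 := WhittAGrp_MmatX k a hEy hxr hPr
  have hW2 := WhittAGrp_alphaMat k a' (extR y) E hEy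
  have ht1 : toda (k + 3) (fun j => -(a j / 2))
      (fun j => radialLog k E τ j - 2 * j * Real.log Real.pi) =
      cexp ((k + 2) * sumA (k + 3) a * Real.log Real.pi) *
        toda (k + 3) (fun j => -(a j / 2)) P := by
    rw [toda_congr (fun _ _ => rfl)
      (x' := fun j => P j + -(2 * ((k : ℝ) + 2) * Real.log Real.pi)), toda_add_const]
    · congr 2
      rw [Finset.sum_neg_distrib, ← Finset.sum_div, sumA]
      push_cast
      ring
    · intro j hj
      rcases Nat.lt_succ_iff_lt_or_eq.1 hj with h | rfl
      · rw [hPr j h]; ring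
      · rw [hP2, radialLog_last]; push_cast; ring
  have ht2 : toda (k + 1) (fun j => -(a' j / 2)) (fun j => 2 * E j - 2 * j * Real.log Real.pi) =
      cexp ((k + 2) * sumA (k + 1) a' * Real.log Real.pi) *
        toda (k + 1) (fun j => -(a' j / 2)) (shiftLog P τ) := by
    rw [toda_congr (fun _ _ => rfl)
      (x' := fun j => shiftLog P τ j + -(2 * ((k : ℝ) + 2) * Real.log Real.pi)), toda_add_const]
    · congr 2
      rw [Finset.sum_neg_distrib, ← Finset.sum_div, sumA]
      push_cast
      ring
    · intro j hj
      rw [shiftLog, hP j hj]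
      ring
  have hpow : ((∏ i, y i : ℝ) : ℂ) * ∏ j ∈ Finset.range (k + 1),
      ((extR y j : ℝ) : ℂ) ^ (((j + 1 : ℕ) : ℂ) * (s - ((k + 3 : ℕ) : ℂ) + ((j : ℕ) : ℂ) + 2)) /
        ((extR y j : ℝ) : ℂ) = cexp (∑ j ∈ Finset.range (k + 1),
          ((j : ℂ) + 1) * ((s - (k + 1)) + j) * ((E j - E (j + 1) : ℝ) : ℂ)) := by
    have h1 : ∏ i, y i = ∏ j ∈ Finset.range (k + 1), extR y j := by
      rw [← Fin.prod_univ_eq_prod_range]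
      exact Finset.prod_congr rfl fun i _ => by rw [extR, dif_pos i.2]
    rw [h1, ofReal_prod, ← Finset.prod_mul_distrib, Complex.exp_sum]
    refine Finset.prod_congr rfl fun j hj => ?_
    rw [hyr j (Finset.mem_range.1 hj), mul_div_cancel₀ _ (by simp [Complex.exp_ne_zero]),
      ofReal_exp_cpow]
    push_cast
    ring_nf
  have hs := congrArg cexp (dual_exponent_eq k s (Real.log Real.pi) hE hP)
  simp only [Complex.exp_add] at hs
  have hJ : ((∏ j ∈ Finset.range (k + 1), Real.exp (sumLog j τ / 2) : ℝ) : ℂ) =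
      cexp (((∑ j ∈ Finset.range (k + 1), sumLog j τ) / 2 : ℝ) : ℂ) := by
    rw [← Real.exp_sum, Finset.sum_div, ofReal_exp]
  have hC : dualConst k a a' s = cexp (-((k + 2) * sumA (k + 3) a / 2 * Real.log Real.pi)) *
      cexp ((k + 2) * sumA (k + 3) a * Real.log Real.pi) *
      (cexp (-(k * sumA (k + 1) a' / 2 * Real.log Real.pi)) *
      cexp ((k + 2) * sumA (k + 1) a' * Real.log Real.pi)) *
      cexp (-(s * Real.log Real.pi * ∑ j ∈ Finset.range (k + 1), ((k : ℂ) + 2 - j))) := by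
    rw [dualConst]
    simp only [← Complex.exp_add]
    congr 1
    ring
  rw [ht1] at hW1
  rw [ht2] at hW2
  have hI : IcheckIntegrand (k + 3) a a' s (y, x) =
      WhittAGrp (k + 3) a (wMat (k + 3) * ((MmatX (k + 3) (extR0 x) (extR y)).transpose)⁻¹) *
      WhittAGrp (k + 1) a' (wMat (k + 1) * ((alphaMat (k + 1) (extR y)).transpose)⁻¹) *
      ∏ j ∈ Finset.range (k + 1), ((extR y j : ℝ) : ℂ) ^
        (((j + 1 : ℕ) : ℂ) * (s - ((k + 3 : ℕ) : ℂ) + ((j : ℕ) : ℂ) + 2)) /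
        ((extR y j : ℝ) : ℂ) := rfl
  rw [hI, mul_left_comm (((∏ i, y i : ℝ) : ℂ)), hpow, hW1, hW2, hC, hJ]
  unfold dualKer
  rw [zero_mul, Complex.exp_zero, mul_one]
  linear_combination (cexp (I * (dualPhase k P τ : ℝ)) *
    cexp (-((k + 2) * sumA (k + 3) a / 2 * Real.log Real.pi)) *
      cexp ((k + 2) * sumA (k + 3) a * Real.log Real.pi) *
      (cexp (-(k * sumA (k + 1) a' / 2 * Real.log Real.pi)) *
      cexp ((k + 2) * sumA (k + 1) a' * Real.log Real.pi)) *
    toda (k + 3) (fun j => -(a j / 2)) P * toda (k + 1) (fun j => -(a' j / 2)) (shiftLog P τ)) * hs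

/-! ### Change of variables -/

theorem integral_eq_integral_det_mul {m : ℕ} {Φ : (Fin m → ℝ) → Fin m → ℝ}
    {A : (Fin m → ℝ) → (Fin m → ℝ) →L[ℝ] (Fin m → ℝ)} (hA : ∀ z, HasFDerivAt Φ (A z) z)
    (hΦ : Function.Bijective Φ) (f : (Fin m → ℝ) → ℂ) :
    ∫ x, f x = ∫ z, ((|(A z).det| : ℝ) : ℂ) * f (Φ z) := by
  rw [← setIntegral_univ, ← Set.image_univ_of_surjective hΦ.2,
    integral_image_eq_integral_abs_det_fderiv_smul volume MeasurableSet.univ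
    (fun z _ => (hA z).hasFDerivWithinAt) (hΦ.1.injOn), setIntegral_univ]
  simp only [real_smul]

/-- The matrix of the half differences of consecutive coordinates. -/
def halfDiff (m : ℕ) : Matrix (Fin m) (Fin m) ℝ :=
  Matrix.of fun i j => if j = i then 1 / 2 else if (j : ℕ) = i + 1 then -(1 / 2) else 0

theorem det_halfDiff (m : ℕ) : (halfDiff m).det = (1 / 2) ^ m := by
  rw [Matrix.det_of_isUpperTriangular]
  · simp [halfDiff]
  · intro i j h
    have h : (j : ℕ) < i := h
    rw [halfDiff, Matrix.of_apply, if_neg (by rintro rfl; omega), if_neg (by omega)]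

theorem halfDiff_mulVec {m : ℕ} (p : Fin m → ℝ) (i : Fin m) :
    (halfDiff m).mulVec p i = (extR0 p i - extR0 p (i + 1)) / 2 := by
  have h : ∀ j : Fin m, halfDiff m i j * p j =
      (fun j : ℕ => (if j = i then extR0 p j / 2 else 0) -
        (if j = i + 1 then extR0 p j / 2 else 0)) j := by
    intro j
    simp only [halfDiff, Matrix.of_apply, Fin.ext_iff, extR0_coe]
    split_ifs <;> first | omega | ring
  rw [Matrix.mulVec, dotProduct]
  simp only [h]
  refine (Fin.sum_univ_eq_sum_range (fun j : ℕ => (if j = (i : ℕ) then extR0 p j / 2 else 0) -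
    (if j = (i : ℕ) + 1 then extR0 p j / 2 else 0)) m).trans ?_
  rw [Finset.sum_sub_distrib, Finset.sum_ite_eq', Finset.sum_ite_eq',
    if_pos (Finset.mem_range.2 i.2)]
  simp only [Finset.mem_range]
  split_ifs with h
  · ring
  · rw [extR0_of_le p (i := i + 1) (by omega)]
    ring

theorem integral_halfDiff {m : ℕ} (c : Fin m → ℝ) (f : (Fin m → ℝ) → ℂ) :
    (2 : ℂ) ^ m * ∫ x, f x = ∫ p, f ((halfDiff m).mulVec p + c) := by
  have hdet : IsUnit (halfDiff m) := by
    rw [Matrix.isUnit_iff_isUnit_det, det_halfDiff]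
    exact (by positivity : (1 / 2 : ℝ) ^ m ≠ 0).isUnit
  have hA : ∀ z, HasFDerivAt (fun p : Fin m → ℝ => (halfDiff m).mulVec p + c)
      (Matrix.toLin' (halfDiff m)).toContinuousLinearMap z := fun z =>
    ((Matrix.toLin' (halfDiff m)).toContinuousLinearMap.hasFDerivAt).add_const c
  rw [integral_eq_integral_det_mul hA, integral_const_mul, ← mul_assoc]
  · rw [ContinuousLinearMap.det, LinearMap.coe_toContinuousLinearMap, LinearMap.det_toLin',
      det_halfDiff, abs_of_pos (by positivity)]
    push_cast
    rw [← mul_pow]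
    norm_num
  · refine ⟨fun p q h => Matrix.mulVec_injective_iff_isUnit.2 hdet (add_right_cancel h),
      fun x => ?_⟩
    obtain ⟨p, hp⟩ := Matrix.mulVec_surjective_iff_isUnit.2 hdet (x - c)
    exact ⟨p, by simp only [hp, sub_add_cancel]⟩

theorem sumLog_congr {j : ℕ} {τ τ' : ℕ → ℝ} (h : ∀ l < j, τ l = τ' l) : sumLog j τ = sumLog j τ' :=
  Finset.sum_congr rfl fun l hl => by rw [h l (Finset.mem_range.1 hl)]

theorem exp_sumLog (τ : ℕ → ℝ) (j : ℕ) :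
    Real.exp (sumLog j τ) = 1 + ∑ l ∈ Finset.range j, scaleSeq τ l ^ 2 := by
  induction j with
  | zero => simp [sumLog]
  | succ j ih => rw [exp_sumLog_succ, ih, Finset.sum_range_succ, add_assoc]

/-- The map sending `τ` to the coordinates `scaleSeq τ`. -/
def scaleMap (m : ℕ) (τ : Fin m → ℝ) (j : Fin m) : ℝ := scaleSeq (extR0 τ) j

theorem bijective_scaleMap (m : ℕ) : Function.Bijective (scaleMap m) := by
  have h0 : ∀ τ : ℕ → ℝ, ∀ j, τ j =
      scaleSeq τ j / Real.sqrt (1 + ∑ l ∈ Finset.range j, scaleSeq τ l ^ 2) := fun τ j => by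
    rw [← exp_sumLog, ← Real.exp_half, scaleSeq, mul_div_cancel_right₀ _ (Real.exp_pos _).ne']
  refine ⟨fun τ τ' h => ?_, fun x => ?_⟩
  · have hj : ∀ j < m, scaleSeq (extR0 τ) j = scaleSeq (extR0 τ') j := fun j hj =>
      congrFun h ⟨j, hj⟩
    ext j
    rw [← extR0_coe τ, ← extR0_coe τ', h0 (extR0 τ), h0 (extR0 τ'), hj j j.2,
      Finset.sum_congr rfl fun l hl => by rw [hj l ((Finset.mem_range.1 hl).trans j.2)]]
  · set τ : ℕ → ℝ := fun j =>
      extR0 x j / Real.sqrt (1 + ∑ l ∈ Finset.range j, extR0 x l ^ 2) with hτ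
    have h1 : ∀ j, Real.exp (sumLog j τ) = 1 + ∑ l ∈ Finset.range j, extR0 x l ^ 2 := by
      intro j
      induction j with
      | zero => simp [sumLog]
      | succ j ih =>
        have hpos : 0 < 1 + ∑ l ∈ Finset.range j, extR0 x l ^ 2 := ih ▸ Real.exp_pos _
        rw [exp_sumLog_succ, scaleSeq_sq, ih, Finset.sum_range_succ, hτ, div_pow,
          Real.sq_sqrt hpos.le, div_mul_cancel₀ _ hpos.ne', add_assoc]
    refine ⟨fun j => τ j, ?_⟩
    ext j
    have hl : ∀ l < m, extR0 (fun j : Fin m => τ j) l = τ l := fun l hl => extR0_of_lt _ hl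
    rw [scaleMap, scaleSeq, hl j j.2, sumLog_congr fun l hl' => hl l (hl'.trans j.2), Real.exp_half,
      h1, hτ]
    have hpos : 0 < 1 + ∑ l ∈ Finset.range j, extR0 x l ^ 2 := by
      rw [← h1]; exact Real.exp_pos _
    simp only [extR0_coe]
    rw [div_mul_cancel₀ _ (Real.sqrt_pos.2 hpos).ne']

theorem differentiable_scaleMap (m : ℕ) : Differentiable ℝ (scaleMap m) := by
  have hd : ∀ l, Differentiable ℝ fun τ : Fin m → ℝ => extR0 τ l := fun l => by
    by_cases h : l < m
    · simp only [extR0, h, dif_pos]; fun_prop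
    · simp only [extR0, h, dif_neg, not_false_iff]; fun_prop
  refine differentiable_pi.2 fun i => ?_
  have h : Differentiable ℝ fun τ : Fin m → ℝ => sumLog i (extR0 τ) :=
    Differentiable.fun_sum fun l _ => Differentiable.log
      ((differentiable_const _).add ((hd l).pow 2)) fun τ => by positivity
  have h2 : Differentiable ℝ fun τ : Fin m → ℝ => sumLog i (extR0 τ) / 2 := by
    simpa only [div_eq_mul_inv] using h.mul_const (2 : ℝ)⁻¹
  exact (hd i).mul h2.exp

theorem fderiv_scaleMap_single {m : ℕ} (τ : Fin m → ℝ) {i j : Fin m} (h : i ≤ j) :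
    fderiv ℝ (scaleMap m) τ (Pi.single j 1) i =
      if i = j then Real.exp (sumLog i (extR0 τ) / 2) else 0 := by
  have h1 := ((differentiable_scaleMap m τ).hasFDerivAt.hasLineDerivAt (Pi.single j 1))
  have h2 : HasDerivAt (fun t : ℝ => scaleMap m (τ + t • Pi.single j 1) i)
      (fderiv ℝ (scaleMap m) τ (Pi.single j 1) i) 0 := (hasDerivAt_pi.1 h1) i
  have h3 : (fun t : ℝ => scaleMap m (τ + t • Pi.single j 1) i) = fun t =>
      (τ i + t * (if i = j then 1 else 0)) * Real.exp (sumLog i (extR0 τ) / 2) := by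
    ext t
    rw [scaleMap, scaleSeq]
    congr 1
    · simp [Pi.single_apply]
    · congr 2
      refine sumLog_congr fun l hl => ?_
      rw [extR0_of_lt _ (hl.trans i.2), extR0_of_lt _ (hl.trans i.2)]
      have : (⟨l, hl.trans i.2⟩ : Fin m) ≠ j := fun e => by
        have h : (i : ℕ) ≤ j := h
        have := congrArg Fin.val e
        simp only [] at this
        omega
      simp [this]
  rw [h3] at h2
  have h4 : HasDerivAt (fun t : ℝ => (τ i + t * (if i = j then 1 else 0)) *
      Real.exp (sumLog i (extR0 τ) / 2))
      ((1 * (if i = j then 1 else 0)) * Real.exp (sumLog i (extR0 τ) / 2)) 0 :=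
    (((hasDerivAt_id (0 : ℝ)).mul_const _).const_add _).mul_const _
  rw [h2.unique h4]
  split_ifs <;> simp

theorem det_fderiv_scaleMap {m : ℕ} (τ : Fin m → ℝ) : (fderiv ℝ (scaleMap m) τ).det =
    ∏ j ∈ Finset.range m, Real.exp (sumLog j (extR0 τ) / 2) := by
  rw [ContinuousLinearMap.det, ← LinearMap.det_toMatrix', Matrix.det_of_isLowerTriangular,
    ← Fin.prod_univ_eq_prod_range]
  · refine Finset.prod_congr rfl fun i _ => ?_
    rw [LinearMap.toMatrix'_apply]
    refine (congrFun (congrArg _ ?_) i).trans ((fderiv_scaleMap_single τ le_rfl).trans (if_pos rfl))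
    ext j
    simp [Pi.single_apply]
  · intro i j h
    have h : i < j := h
    rw [LinearMap.toMatrix'_apply]
    refine (congrFun (congrArg _ ?_) i).trans
      ((fderiv_scaleMap_single τ h.le).trans (if_neg h.ne))
    ext j
    simp [Pi.single_apply]

theorem integral_scaleMap {m : ℕ} (f : (Fin m → ℝ) → ℂ) : ∫ x, f x =
    ∫ τ, ((∏ j ∈ Finset.range m, Real.exp (sumLog j (extR0 τ) / 2) : ℝ) : ℂ) *
      f (scaleMap m τ) := by
  rw [integral_eq_integral_det_mul (fun z => (differentiable_scaleMap m z).hasFDerivAt)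
    (bijective_scaleMap m)]
  congr 1 with τ
  rw [det_fderiv_scaleMap, abs_of_pos (Finset.prod_pos fun j _ => Real.exp_pos _)]

/-! ### The dual zeta integral in logarithmic coordinates -/

theorem integral_posSet_prod_univ {k : ℕ} {f : (Fin k → ℝ) × (Fin k → ℝ) → ℂ}
    (hf : IntegrableOn f (posSet k ×ˢ (Set.univ : Set (Fin k → ℝ)))) :
    ∫ q in posSet k ×ˢ (Set.univ : Set (Fin k → ℝ)), f q =
      ∫ x : Fin k → ℝ, ∫ η : Fin k → ℝ,
        ((∏ i, Real.exp (η i) : ℝ) : ℂ) * f (fun i => Real.exp (η i), x) := by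
  have h : (volume : Measure ((Fin k → ℝ) × (Fin k → ℝ))).restrict
      (posSet k ×ˢ (Set.univ : Set (Fin k → ℝ))) =
      (volume.restrict (posSet k)).prod volume := by
    rw [Measure.volume_eq_prod, ← Measure.prod_restrict, Measure.restrict_univ]
  rw [IntegrableOn, h] at hf
  rw [h, integral_prod_symm _ hf]
  congr 1 with x
  exact integral_posSet fun y => f (y, x)

/-- The translation relating half the Toda coordinates to the logarithms of the torus
coordinates. -/
def torusShift (k : ℕ) (τ : ℕ → ℝ) (j : ℕ) : ℝ :=
  if j < k + 1 then Real.log (1 + τ j ^ 2) / 2 - ((k : ℝ) + 2 - j) * Real.log Real.pi else 0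

theorem two_pow_mul_integral_Icheck_slice (k : ℕ) (a a' : ℕ → ℂ) (s : ℂ) (τ : Fin (k + 1) → ℝ) :
    (2 : ℂ) ^ (k + 1) * (((∏ j ∈ Finset.range (k + 1),
      Real.exp (sumLog j (extR0 τ) / 2) : ℝ) : ℂ) *
      ∫ η : Fin (k + 1) → ℝ, ((∏ i, Real.exp (η i) : ℝ) : ℂ) *
        IcheckIntegrand (k + 3) a a' s (fun i => Real.exp (η i), scaleMap (k + 1) τ)) =
    ∫ p : Fin (k + 1) → ℝ, dualConst k a a' s * dualKer k (s / 2) 0 (1 / 2 - s / 2)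
      (fun j => -(a j / 2)) (fun j => -(a' j / 2))
      (extR0 (shearMap k (2 * Real.log Real.pi, (p, τ))).1) (extR0 τ) := by
  rw [← integral_const_mul]
  refine (integral_halfDiff (fun i : Fin (k + 1) =>
    torusShift k (extR0 τ) i - torusShift k (extR0 τ) (i + 1)) _).trans ?_
  congr 1 with p
  refine IcheckIntegrand_eq_dualKer k a a' s (y := fun i => Real.exp _)
    (E := fun j => extR0 p j / 2 + torusShift k (extR0 τ) j) ?_ ?_ ?_ ?_ ?_ ?_
  · rw [extR0_of_le p le_rfl, torusShift, if_neg (lt_irrefl _)]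
    norm_num
  · intro j hj
    rw [shearMap, extR0_snoc_lt _ _ hj, torusShift, if_pos hj]
    ring
  · rw [shearMap, extR0_snoc_self]
  · exact extR0_of_le _ le_rfl
  · intro i
    rfl
  · intro i
    rw [Pi.add_apply, halfDiff_mulVec]
    congr 1
    ring

theorem Icheck_eq_dualJ (k : ℕ) {a a' : ℕ → ℂ} (ha : ∀ j < k + 3, (a j).re = 0)
    (ha' : ∀ j < k + 1, (a' j).re = 0) {s : ℂ} (hs : 0 < s.re)
    (hconv : IntegrableOn (IcheckIntegrand (k + 3) a a' s)
      (posSet (k + 1) ×ˢ (Set.univ : Set (Fin (k + 1) → ℝ)))) :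
    Icheck (k + 3) a a' s = dualConst k a a' s * dualJ k (s / 2) (fun j => -(a j / 2))
      (fun j => -(a' j / 2)) (2 * Real.log Real.pi) := by
  have hσ : 0 < (s / 2).re := by
    rw [div_ofNat_re]; linarith
  have hi := integrable_dualKer_slice k (σ := s / 2) (b := fun j => -(a j / 2))
    (b' := fun j => -(a' j / 2)) hσ
    (fun j hj => by simp [div_ofNat_re, ha j hj]) (fun j hj => by simp [div_ofNat_re, ha' j hj])
    (2 * Real.log Real.pi)
  refine (congrArg ((2 : ℂ) ^ (k + 1) * ·) ((integral_posSet_prod_univ hconv).trans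
    (integral_scaleMap _))).trans ?_
  rw [← integral_const_mul, dualJ, ← integral_const_mul]
  refine Eq.trans ?_ (integral_prod_symm _ (hi.const_mul (dualConst k a a' s))).symm
  congr 1 with τ
  exact two_pow_mul_integral_Icheck_slice k a a' s τ

/-! ### Conclusion -/

theorem prod_GammaR {ι : Type*} (t : Finset ι) (f : ι → ℂ) : ∏ j ∈ t, GammaR (f j) =
    cexp (-((∑ j ∈ t, f j) / 2) * Real.log Real.pi) * ∏ j ∈ t, Complex.Gamma (f j / 2) := by
  have h : ∀ z : ℂ, GammaR z = cexp (-(z / 2) * Real.log Real.pi) * Complex.Gamma (z / 2) := by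
    intro z
    rw [GammaR, cpow_def_of_ne_zero (by exact_mod_cast Real.pi_ne_zero), ← ofReal_log Real.pi_pos.le]
    congr 2
    ring
  simp only [h]
  rw [Finset.prod_mul_distrib, ← Complex.exp_sum]
  congr 2
  rw [Finset.sum_div, ← Finset.sum_neg_distrib, Finset.sum_mul]

theorem GammaR_quot_eq (k : ℕ) (a a' : ℕ → ℂ) (s w : ℂ) :
    (∏ j ∈ Finset.range (k + 3), GammaR (w - a j)) /
        ∏ j ∈ Finset.range (k + 1), GammaR (1 - s + w + a' j) =
      cexp (((sumA (k + 3) a + sumA (k + 1) a' + (k + 1) * (1 - s)) / 2) * Real.log Real.pi) *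
        (cexp (-(w / 2 * (2 * Real.log Real.pi : ℝ))) *
          gammaQuot k (fun j => -(a j / 2)) (fun j => 1 / 2 - s / 2 - -(a' j / 2)) (w / 2)) := by
  rw [prod_GammaR, prod_GammaR, mul_div_mul_comm, ← Complex.exp_sub, ← mul_assoc,
    ← Complex.exp_add, gammaQuot]
  congr 1
  · congr 1
    rw [Finset.sum_sub_distrib, Finset.sum_add_distrib, Finset.sum_const, Finset.sum_const,
      Finset.card_range, Finset.card_range, sumA, sumA]
    push_cast
    simp only [nsmul_eq_mul]
    push_cast
    ring
  · congr 1
    · refine Finset.prod_congr rfl fun j _ => ?_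
      congr 1
      ring
    · refine Finset.prod_congr rfl fun j _ => ?_
      congr 1
      ring

theorem prod_prod_GammaR_eq (k : ℕ) (a a' : ℕ → ℂ) (s : ℂ) :
    ∏ j ∈ Finset.range (k + 3), ∏ l ∈ Finset.range (k + 1), GammaR (s - a j - a' l) =
      cexp (-(((k + 3) * (k + 1) * s - (k + 1) * sumA (k + 3) a - (k + 3) * sumA (k + 1) a') / 2) *
        Real.log Real.pi) * ∏ j ∈ Finset.range (k + 3), ∏ l ∈ Finset.range (k + 1),
          Complex.Gamma (s / 2 + -(a j / 2) + -(a' l / 2)) := by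
  simp only [prod_GammaR]
  rw [Finset.prod_mul_distrib, ← Complex.exp_sum]
  congr 1
  · congr 1
    rw [← Finset.sum_mul]
    congr 1
    rw [Finset.sum_neg_distrib, ← Finset.sum_div]
    simp only [Finset.sum_sub_distrib, Finset.sum_const, Finset.card_range, nsmul_eq_mul,
      ← Finset.mul_sum, sumA]
    push_cast
    ring
  · refine Finset.prod_congr rfl fun j _ => Finset.prod_congr rfl fun l _ => ?_
    congr 1
    ring

theorem sum_range_dual_weight (k : ℕ) :
    ∑ j ∈ Finset.range (k + 1), ((k : ℂ) + 2 - j) = (k + 1) * (k + 4) / 2 := by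
  have h : ∀ m : ℕ, ∑ j ∈ Finset.range m, (j : ℂ) = m * (m - 1) / 2 := by
    intro m
    induction m with
    | zero => simp
    | succ m ih => rw [Finset.sum_range_succ, ih]; push_cast; ring
  rw [Finset.sum_sub_distrib, h, Finset.sum_const, Finset.card_range, nsmul_eq_mul]
  push_cast
  ring

theorem sqrt_pi_pow (m : ℕ) :
    ((Real.sqrt Real.pi ^ m : ℝ) : ℂ) = cexp (m / 2 * Real.log Real.pi) := by
  rw [← Real.exp_log Real.pi_pos, ← Real.exp_half, ← Real.exp_nat_mul, Real.exp_log Real.pi_pos,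
    ofReal_exp]
  congr 1
  push_cast
  ring

theorem Icheck_eq_integral (k : ℕ) {a a' : ℕ → ℂ} (ha : ∀ j < k + 3, (a j).re = 0)
    (ha' : ∀ j < k + 1, (a' j).re = 0) {s : ℂ} (hs : 0 < s.re)
    (hconv : IntegrableOn (IcheckIntegrand (k + 3) a a' s)
      (posSet (k + 1) ×ˢ (Set.univ : Set (Fin (k + 1) → ℝ))))
    {c : ℝ} (hc : 0 < c) (hc' : 0 < 1 - s.re + c) :
    Icheck (k + 3) a a' s =
      (∏ j ∈ Finset.range (k + 3), ∏ l ∈ Finset.range (k + 1), GammaR (s - a j - a' l)) *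
        ((4 * (Real.pi : ℂ) * I)⁻¹ * VInt c (fun w =>
          (∏ j ∈ Finset.range (k + 3), GammaR (w - a j)) /
            ∏ j ∈ Finset.range (k + 1), GammaR (1 - s + w + a' j))) := by
  have hre : (s / 2).re = s.re / 2 := div_ofNat_re s 2
  rw [Icheck_eq_dualJ k ha ha' hs hconv, dualJ_eq k (by rw [hre]; linarith)
    (fun j hj => by simp [div_ofNat_re, ha j hj]) (fun j hj => by simp [div_ofNat_re, ha' j hj])
    (2 * Real.log Real.pi) (c := c / 2) (by linarith) (by rw [hre]; linarith), VInt]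
  simp only [GammaR_quot_eq]
  set G : ℂ → ℂ := fun z => cexp (-(z * (2 * Real.log Real.pi : ℝ))) *
    gammaQuot k (fun j => -(a j / 2)) (fun j => 1 / 2 - s / 2 - -(a' j / 2)) z with hG
  have hsub : ∫ t : ℝ, G ((c + t * I) / 2) = 2 * ∫ y : ℝ, G ((c / 2 : ℝ) + y * I) := by
    have h := Measure.integral_comp_div (fun y : ℝ => G ((c / 2 : ℝ) + y * I)) 2
    rw [abs_of_pos (by norm_num : (0 : ℝ) < 2), real_smul] at h
    push_cast at h ⊢
    rw [← h]
    congr 1 with t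
    congr 1
    ring
  have hI : (4 * (Real.pi : ℂ) * I)⁻¹ * I = (4 * Real.pi : ℂ)⁻¹ := by
    rw [mul_inv, mul_assoc, inv_mul_cancel₀ I_ne_zero, mul_one]
  have hexp : dualConst k a a' s * ((Real.sqrt Real.pi ^ (k + 1) : ℝ) : ℂ) =
      cexp (-(((k + 3) * (k + 1) * s - (k + 1) * sumA (k + 3) a - (k + 3) * sumA (k + 1) a') / 2) *
        Real.log Real.pi) *
      cexp (((sumA (k + 3) a + sumA (k + 1) a' + (k + 1) * (1 - s)) / 2) * Real.log Real.pi) := by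
    rw [sqrt_pi_pow, dualConst, sum_range_dual_weight, ← Complex.exp_add, ← Complex.exp_add]
    congr 1
    push_cast
    ring
  have hl : ∫ y : ℝ, cexp (-((((c / 2 : ℝ) : ℂ) + y * I) * (2 * Real.log Real.pi : ℝ))) *
      gammaQuot k (fun j => -(a j / 2)) (fun j => 1 / 2 - s / 2 - -(a' j / 2))
        (((c / 2 : ℝ) : ℂ) + y * I) = ∫ y : ℝ, G ((c / 2 : ℝ) + y * I) := rfl
  rw [hl, integral_const_mul, prod_prod_GammaR_eq]
  change _ = _ * (_ * (I * (_ * ∫ t : ℝ, G ((c + t * I) / 2))))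
  rw [hsub]
  set J := ∫ y : ℝ, G ((c / 2 : ℝ) + y * I)
  set Q := ∏ j ∈ Finset.range (k + 3), ∏ l ∈ Finset.range (k + 1),
    Complex.Gamma (s / 2 + -(a j / 2) + -(a' l / 2))
  have hpi : (2 * Real.pi : ℂ)⁻¹ = (4 * Real.pi : ℂ)⁻¹ * 2 := by
    have : (Real.pi : ℂ) ≠ 0 := ofReal_ne_zero.2 Real.pi_ne_zero
    field_simp
    norm_num
  rw [hpi, ← hI]
  linear_combination (Q * ((4 * (Real.pi : ℂ) * I)⁻¹ * I * 2 * J)) * hexp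

/-- Evaluation of the dual archimedean `GL_n × GL_{n-2}` zeta integral
(Theorem 2.4 of Ishii–Stade). -/
theorem gl_glnminus2_dual_zeta (n : ℕ) (hn : 3 ≤ n)
    (a a' : ℕ → ℂ) (ha : ∀ j < n, (a j).re = 0) (ha' : ∀ k < n - 2, (a' k).re = 0)
    (s : ℂ) (hs : 0 < s.re)
    (hconv : IntegrableOn (IcheckIntegrand n a a' s)
      (posSet (n - 2) ×ˢ (Set.univ : Set (Fin (n - 2) → ℝ))))
    (c : ℝ)
    (hc1 : ∀ j < n, 0 < ((c : ℂ) - a j).re)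
    (hc2 : ∀ j < n - 2, 0 < (1 - s + (c : ℂ) + a' j).re) :
    Icheck n a a' s =
      (∏ j ∈ Finset.range n, ∏ k ∈ Finset.range (n - 2), GammaR (s - a j - a' k)) *
        ((4 * (Real.pi : ℂ) * Complex.I)⁻¹ *
          VInt c (fun w =>
            (∏ j ∈ Finset.range n, GammaR (w - a j)) /
              ∏ j ∈ Finset.range (n - 2), GammaR (1 - s + w + a' j))) := by
  obtain ⟨k, rfl⟩ : ∃ k, n = k + 3 := ⟨n - 3, by omega⟩
  refine Icheck_eq_integral k ha ha' hs hconv (c := c) ?_ ?_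
  · simpa [ha 0 (by omega)] using hc1 0 (by omega)
  · simpa [ha' 0 (by omega)] using hc2 0 (by omega)

end
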